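/- arXiv:0903.1418 — 6 statements merged into one kernel-verified Lean document; each statement's English description precedes it below -/
import Mathlib

section
/- Let K be a field of characteristic zero, V a finite-dimensional K-vector space, and B a nondegenerate symmetric bilinear form on V. Then every isometry x of B is conjugate to its inverse within the isometry group of B: there exists a linear automorphism h of V satisfying B(h u, h v) = B(u, v) for all u, v ∈ V, such that h ∘ x ∘ h⁻¹ = x⁻¹. (This is the orthogonal-group instance of the classical fact that ğxğ⁻¹ is conjugate to x⁻¹ inside U(E) for ğ ∈ Ŭ(E)∖U(E).) -/
section OrthConj
variable {K : Type*} [Field K] {V : Type*} [AddCommGroup V] [Module K V]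

theorem oc_pow_adj (B : V →ₗ[K] V →ₗ[K] K) (T : V →ₗ[K] V) (e : K)
    (hT : ∀ a b, B (T a) b = e * B a (T b)) (n : ℕ) (a b : V) :
    B ((T ^ n) a) b = e ^ n * B a ((T ^ n) b) := by
  induction n generalizing a b with
  | zero => simp
  | succ n ih =>
    have h1 : (T ^ (n + 1)) b = (T ^ n) (T b) := by rw [pow_succ, Module.End.mul_apply]
    rw [h1, pow_succ' T, Module.End.mul_apply, hT, ih]
    ring

/-- Orthogonal Fitting decomposition. -/
theorem oc_fitting [FiniteDimensional K V] (T : V →ₗ[K] V) :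
    ∃ n : ℕ, 0 < n ∧ IsCompl (LinearMap.ker (T ^ n)) (LinearMap.range (T ^ n)) := by
  have h := LinearMap.eventually_isCompl_ker_pow_range_pow T
  obtain ⟨n, hn⟩ := Filter.eventually_atTop.1 h
  exact ⟨n + 1, by omega, hn (n + 1) (by omega)⟩

theorem oc_exists_pair [FiniteDimensional K V] (B : V →ₗ[K] V →ₗ[K] K)
    (hnd : ∀ u : V, (∀ v : V, B u v = 0) → u = 0)
    (T : V →ₗ[K] V) (e : K)
    (hT : ∀ a b, B (T a) b = e * B a (T b)) (he : e ≠ 0)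
    (x : V) (hx0 : x ≠ 0) (hx : T x = 0) :
    ∃ (k : ℕ) (u w : V), (T ^ (k + 1)) u = 0 ∧ (T ^ (k + 1)) w = 0 ∧ B ((T ^ k) u) w ≠ 0 := by
  classical
  obtain ⟨n, hn0, hn⟩ := oc_fitting T
  -- the least power killing `ker T ^ n`
  have hex : ∃ m : ℕ, ∀ v, (T ^ n) v = 0 → (T ^ m) v = 0 := ⟨n, fun v h => h⟩
  obtain ⟨m, hm, hmin⟩ : ∃ m : ℕ, (∀ v, (T ^ n) v = 0 → (T ^ m) v = 0) ∧
      ∀ l < m, ¬ (∀ v, (T ^ n) v = 0 → (T ^ l) v = 0) :=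
    ⟨Nat.find hex, Nat.find_spec hex, fun l hl => Nat.find_min hex hl⟩
  have hxn : (T ^ n) x = 0 := by
    obtain ⟨j, rfl⟩ : ∃ j, n = j + 1 := ⟨n - 1, by omega⟩
    rw [pow_succ, Module.End.mul_apply, hx, map_zero]
  obtain ⟨k, rfl⟩ : ∃ k, m = k + 1 := by
    refine ⟨m - 1, ?_⟩
    have : m ≠ 0 := by
      rintro rfl
      exact hx0 (by simpa using hm x hxn)
    omega
  have h1 := hmin k (by omega)
  push Not at h1
  obtain ⟨u, hu, huk⟩ := h1
  have h2 : ∃ w0, B ((T ^ k) u) w0 ≠ 0 := by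
    by_contra hc
    push Not at hc
    exact huk (hnd _ hc)
  obtain ⟨w0, hw0⟩ := h2
  have h3 : w0 ∈ LinearMap.ker (T ^ n) ⊔ LinearMap.range (T ^ n) := by
    rw [hn.sup_eq_top]; trivial
  obtain ⟨w, hw, r, ⟨s, rfl⟩, rfl⟩ := Submodule.mem_sup.1 h3
  refine ⟨k, u, w, hm u hu, hm w hw, ?_⟩
  have h4 : B ((T ^ k) u) ((T ^ n) s) = 0 := by
    have h5 := oc_pow_adj B T e hT n ((T ^ k) u) s
    rw [← Module.End.mul_apply, ← pow_add, add_comm n k, pow_add, Module.End.mul_apply, hu,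
      map_zero, map_zero, LinearMap.zero_apply] at h5
    have := pow_ne_zero n he
    rcases mul_eq_zero.1 h5.symm with h | h
    · exact absurd h this
    · exact h
  rw [map_add, h4, add_zero] at hw0
  exact hw0

/-- Polarization. -/
theorem oc_polar [CharZero K] (B : V →ₗ[K] V →ₗ[K] K) (hsymm : ∀ u v : V, B u v = B v u)
    (S T : V →ₗ[K] V) (hS : ∀ a b, B (S a) b = B a (S b))
    (u w : V) (hu : T u = 0) (hw : T w = 0) (h : B (S u) w ≠ 0) :
    ∃ v, T v = 0 ∧ B (S v) v ≠ 0 := by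
  by_contra hc
  push Not at hc
  have h1 := hc u hu
  have h2 := hc w hw
  have h3 := hc (u + w) (by rw [map_add, hu, hw, add_zero])
  simp only [map_add, LinearMap.add_apply, h1, h2] at h3
  rw [hS w u, hsymm w (S u)] at h3
  apply h
  have : (2 : K) * B (S u) w = 0 := by linear_combination h3
  simpa using this

/-- Span of `z^(2i) u` and `z^(2i+1) w`. -/
def ocP (z : V →ₗ[K] V) (u w : V) : Submodule K V :=
  Submodule.span K (Set.range (fun i : ℕ => (z ^ (2 * i)) u) ∪
    Set.range (fun i : ℕ => (z ^ (2 * i + 1)) w))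

theorem ocP_even (z : V →ₗ[K] V) (u w : V) (i : ℕ) : (z ^ (2 * i)) u ∈ ocP z u w :=
  Submodule.subset_span (Or.inl ⟨i, rfl⟩)

theorem ocP_odd (z : V →ₗ[K] V) (u w : V) (i : ℕ) : (z ^ (2 * i + 1)) w ∈ ocP z u w :=
  Submodule.subset_span (Or.inr ⟨i, rfl⟩)

theorem ocP_map (z : V →ₗ[K] V) (u w : V) (v : V) (hv : v ∈ ocP z u w) : z v ∈ ocP z w u := by
  unfold ocP at hv
  induction hv using Submodule.span_induction with
  | mem x hx =>
    rcases hx with ⟨i, rfl⟩ | ⟨i, rfl⟩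
    · have := ocP_odd z w u i
      rwa [pow_succ', Module.End.mul_apply] at this
    · have := ocP_even z w u (i + 1)
      rwa [show 2 * (i + 1) = (2 * i + 1) + 1 by ring, pow_succ', Module.End.mul_apply] at this
  | zero => simp
  | add x y _ _ hx hy => rw [map_add]; exact add_mem hx hy
  | smul a x _ hx => rw [map_smul]; exact Submodule.smul_mem _ _ hx

theorem oc_skew_odd [CharZero K] (B : V →ₗ[K] V →ₗ[K] K) (hsymm : ∀ u v : V, B u v = B v u)
    (z : V →ₗ[K] V) (hz : ∀ a b, B (z a) b = (-1) * B a (z b)) (k : ℕ) (hk : Odd k) (u : V) :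
    B ((z ^ k) u) u = 0 := by
  have h := oc_pow_adj B z (-1) hz k u u
  rw [hk.neg_one_pow, hsymm u] at h
  have : (2 : K) * B ((z ^ k) u) u = 0 := by linear_combination h
  simpa using this

theorem oc_move (B : V →ₗ[K] V →ₗ[K] K)
    (z : V →ₗ[K] V) (hz : ∀ a b, B (z a) b = (-1) * B a (z b)) (i j : ℕ) (u w : V) :
    B ((z ^ i) u) ((z ^ j) w) = (-1) ^ j * B ((z ^ (i + j)) u) w := by
  rw [add_comm, pow_add, Module.End.mul_apply, oc_pow_adj B z (-1) hz j, ← mul_assoc, ← mul_pow]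
  simp

theorem ocP_orth [CharZero K] (B : V →ₗ[K] V →ₗ[K] K) (hsymm : ∀ u v : V, B u v = B v u)
    (z : V →ₗ[K] V) (hz : ∀ a b, B (z a) b = (-1) * B a (z b)) (u w : V)
    (huw : ∀ i : ℕ, B ((z ^ (2 * i)) u) w = 0)
    (p q : V) (hp : p ∈ ocP z u w) (hq : q ∈ ocP z w u) : B p q = 0 := by
  have hwu : ∀ i : ℕ, B ((z ^ (2 * i)) w) u = 0 := by
    intro i
    rw [oc_pow_adj B z (-1) hz, hsymm, huw, mul_zero]
  unfold ocP at hp hq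
  induction hp using Submodule.span_induction with
  | mem x hx =>
    induction hq using Submodule.span_induction with
    | mem y hy =>
      rcases hx with ⟨i, rfl⟩ | ⟨i, rfl⟩ <;> rcases hy with ⟨j, rfl⟩ | ⟨j, rfl⟩ <;>
        simp only [oc_move B z hz]
      · rw [show 2 * i + 2 * j = 2 * (i + j) by ring, huw, mul_zero]
      · rw [oc_skew_odd B hsymm z hz _ ⟨i + j, by ring⟩, mul_zero]
      · rw [oc_skew_odd B hsymm z hz _ ⟨i + j, by ring⟩, mul_zero]
      · rw [show 2 * i + 1 + (2 * j + 1) = 2 * (i + j + 1) by ring, hwu, mul_zero]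
    | zero => simp
    | add x y _ _ hx hy => rw [map_add, hx, hy, add_zero]
    | smul a x _ hx => rw [map_smul, hx, smul_zero]
  | zero => simp
  | add x y _ _ hx hy => rw [map_add, LinearMap.add_apply, hx, hy, add_zero]
  | smul a x _ hx => rw [map_smul, LinearMap.smul_apply, hx, smul_zero]

/-- The conclusion of the block lemma. -/
def OCBlock (B : V →ₗ[K] V →ₗ[K] K) (z : V →ₗ[K] V) : Prop :=
  ∃ P Q : Submodule K V, (∀ p ∈ P, ∀ q ∈ Q, B p q = 0) ∧ (∀ p ∈ P, z p ∈ Q) ∧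
    (∀ q ∈ Q, z q ∈ P) ∧ (∀ r ∈ P ⊔ Q, (∀ t ∈ P ⊔ Q, B r t = 0) → r = 0) ∧ P ⊔ Q ≠ ⊥

theorem oc_block_of [CharZero K] (B : V →ₗ[K] V →ₗ[K] K) (hsymm : ∀ u v : V, B u v = B v u)
    (z : V →ₗ[K] V) (hz : ∀ a b, B (z a) b = (-1) * B a (z b)) (u w : V)
    (huw : ∀ i : ℕ, B ((z ^ (2 * i)) u) w = 0) (hu : u ≠ 0)
    (hr : ∀ r ∈ ocP z u w ⊔ ocP z w u, (∀ t ∈ ocP z u w ⊔ ocP z w u, B r t = 0) → r = 0) :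
    OCBlock B z := by
  refine ⟨ocP z u w, ocP z w u, fun p hp q hq => ocP_orth B hsymm z hz u w huw p q hp hq,
    ocP_map z u w, ocP_map z w u, hr, fun h => hu ?_⟩
  have h1 : u ∈ ocP z u w ⊔ ocP z w u :=
    Submodule.mem_sup_left (by simpa using ocP_even z u w 0)
  rw [h] at h1
  simpa using h1

theorem ocW_map (z : V →ₗ[K] V) (u w : V) (v : V) (hv : v ∈ ocP z u w ⊔ ocP z w u) :
    z v ∈ ocP z u w ⊔ ocP z w u := by
  obtain ⟨p, hp, q, hq, rfl⟩ := Submodule.mem_sup.1 hv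
  rw [map_add]
  exact add_mem (Submodule.mem_sup_right (ocP_map z u w p hp))
    (Submodule.mem_sup_left (ocP_map z w u q hq))

theorem ocW_map_pow (z : V →ₗ[K] V) (u w : V) (n : ℕ) (v : V)
    (hv : v ∈ ocP z u w ⊔ ocP z w u) :
    (z ^ n) v ∈ ocP z u w ⊔ ocP z w u := by
  induction n with
  | zero => simpa using hv
  | succ n ih => rw [pow_succ', Module.End.mul_apply]; exact ocW_map z u w _ ih

theorem ocW_u (z : V →ₗ[K] V) (u w : V) : u ∈ ocP z u w ⊔ ocP z w u :=
  Submodule.mem_sup_left (by simpa using ocP_even z u w 0)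

theorem ocW_w (z : V →ₗ[K] V) (u w : V) : w ∈ ocP z u w ⊔ ocP z w u :=
  Submodule.mem_sup_right (by simpa using ocP_even z w u 0)

theorem ocW_decomp (z : V →ₗ[K] V) (u w : V) (v : V) (hv : v ∈ ocP z u w ⊔ ocP z w u) :
    ∃ (c d : K) (r : V), r ∈ ocP z u w ⊔ ocP z w u ∧ v = c • u + d • w + z r := by
  have key : ∀ (i : ℕ) (t : V), t ∈ ocP z u w ⊔ ocP z w u →
      ∃ (c d : K) (r : V), r ∈ ocP z u w ⊔ ocP z w u ∧ (z ^ (i + 1)) t = c • u + d • w + z r :=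
    fun i t ht => ⟨0, 0, (z ^ i) t, ocW_map_pow z u w i t ht, by
      rw [pow_succ', Module.End.mul_apply]; simp⟩
  have keyu : ∀ (i : ℕ), 
      ∃ (c d : K) (r : V), r ∈ ocP z u w ⊔ ocP z w u ∧ (z ^ i) u = c • u + d • w + z r := by
    rintro (_ | i)
    · exact ⟨1, 0, 0, zero_mem _, by simp⟩
    · exact key i u (ocW_u z u w)
  have keyw : ∀ (i : ℕ), 
      ∃ (c d : K) (r : V), r ∈ ocP z u w ⊔ ocP z w u ∧ (z ^ i) w = c • u + d • w + z r := by
    rintro (_ | i)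
    · exact ⟨0, 1, 0, zero_mem _, by simp⟩
    · exact key i w (ocW_w z u w)
  have hv2 := hv
  unfold ocP at hv2
  rw [← Submodule.span_union] at hv2
  clear hv
  induction hv2 using Submodule.span_induction with
  | mem x hx =>
    rcases hx with (⟨i, rfl⟩ | ⟨i, rfl⟩) | (⟨i, rfl⟩ | ⟨i, rfl⟩)
    · exact keyu _
    · exact keyw _
    · exact keyw _
    · exact keyu _
  | zero => exact ⟨0, 0, 0, zero_mem _, by simp⟩
  | add x y _ _ hx hy =>
    obtain ⟨c, d, r, hr, rfl⟩ := hx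
    obtain ⟨c', d', r', hr', rfl⟩ := hy
    exact ⟨c + c', d + d', r + r', add_mem hr hr', by rw [map_add]; module⟩
  | smul a x _ hx =>
    obtain ⟨c, d, r, hr, rfl⟩ := hx
    exact ⟨a * c, a * d, a • r, Submodule.smul_mem _ _ hr, by rw [map_smul]; module⟩

/-- Nondegeneracy in the nilpotent case. -/
theorem ocW_nondeg (B : V →ₗ[K] V →ₗ[K] K)
    (z : V →ₗ[K] V) (hz : ∀ a b, B (z a) b = (-1) * B a (z b)) (u w : V) (k : ℕ)
    (hu : (z ^ (k + 1)) u = 0) (hw : (z ^ (k + 1)) w = 0)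
    (hcd : ∀ c d : K, B ((z ^ k) (c • u + d • w)) u = 0 → B ((z ^ k) (c • u + d • w)) w = 0 →
      c • u + d • w = 0)
    (r : V) (hr : r ∈ ocP z u w ⊔ ocP z w u)
    (hrt : ∀ t ∈ ocP z u w ⊔ ocP z w u, B r t = 0) : r = 0 := by
  have hkill : ∀ t ∈ ocP z u w ⊔ ocP z w u, (z ^ (k + 1)) t = 0 := by
    have : ocP z u w ⊔ ocP z w u ≤ LinearMap.ker (z ^ (k + 1)) := by
      unfold ocP
      rw [← Submodule.span_union, Submodule.span_le]
      rintro x ((⟨i, rfl⟩ | ⟨i, rfl⟩) | (⟨i, rfl⟩ | ⟨i, rfl⟩)) <;>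
      · simp only [SetLike.mem_coe, LinearMap.mem_ker]
        rw [← Module.End.mul_apply, ← pow_add, add_comm, pow_add, Module.End.mul_apply]
        simp [hu, hw]
    exact this
  have step : ∀ i ≤ k + 1, ∃ s ∈ ocP z u w ⊔ ocP z w u, r = (z ^ i) s := by
    intro i
    induction i with
    | zero => exact fun _ => ⟨r, hr, by simp⟩
    | succ i ih =>
      intro hi
      obtain ⟨s, hs, hrs⟩ := ih (by omega)
      obtain ⟨c, d, r', hr', rfl⟩ := ocW_decomp z u w s hs
      have h1 : ∀ t ∈ ocP z u w ⊔ ocP z w u, B ((z ^ k) (c • u + d • w)) t = 0 := by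
        intro t ht
        have h2 := hrt _ (ocW_map_pow z u w (k - i) t ht)
        rw [hrs, oc_move B z hz, show i + (k - i) = k by omega, map_add (z ^ k),
          ← Module.End.mul_apply (z ^ k) z, ← pow_succ, hkill r' hr', add_zero] at h2
        exact (mul_eq_zero.1 h2).resolve_left (pow_ne_zero _ (by simp))
      have h3 := hcd c d (h1 u (ocW_u z u w)) (h1 w (ocW_w z u w))
      exact ⟨r', hr', by rw [hrs, h3, zero_add, ← Module.End.mul_apply, ← pow_succ]⟩
  obtain ⟨s, hs, h⟩ := step (k + 1) le_rfl
  rw [h, hkill s hs]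

/-- Adjust `w` such that only the top pairing survives. -/
theorem oc_adjust (B : V →ₗ[K] V →ₗ[K] K)
    (z : V →ₗ[K] V) (hz : ∀ a b, B (z a) b = (-1) * B a (z b)) (u w : V) (k : ℕ)
    (hu : (z ^ (k + 1)) u = 0) (hw : (z ^ (k + 1)) w = 0) (h : B ((z ^ k) u) w ≠ 0) (m : ℕ) :
    ∃ w', (z ^ (k + 1)) w' = 0 ∧ B ((z ^ k) u) w' ≠ 0 ∧
      ∀ i, k ≤ i + m → i < k → B ((z ^ i) u) w' = 0 := by
  have hbig : ∀ i, k < i → (z ^ i) u = 0 := by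
    intro i hi
    obtain ⟨j, rfl⟩ : ∃ j, i = j + (k + 1) := ⟨i - (k + 1), by omega⟩
    rw [pow_add, Module.End.mul_apply, hu, map_zero]
  induction m with
  | zero => exact ⟨w, hw, h, fun i h1 h2 => by omega⟩
  | succ m ih =>
    obtain ⟨w', h1, h2, h3⟩ := ih
    by_cases hm : m + 1 ≤ k
    · obtain ⟨i0, hi0⟩ : ∃ i0, k = i0 + (m + 1) := ⟨k - (m + 1), by omega⟩
      refine ⟨w' - ((-1) ^ (m + 1) * B ((z ^ i0) u) w' / B ((z ^ k) u) w') • (z ^ (m + 1)) w',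
        ?_, ?_, ?_⟩
      · rw [map_sub, map_smul, h1, ← Module.End.mul_apply, ← pow_add, add_comm (k + 1),
          pow_add z, Module.End.mul_apply, h1]
        simp
      · rw [map_sub, map_smul, oc_move B z hz, hbig (k + (m + 1)) (by omega)]
        simpa using h2
      · intro i hi hik
        rw [map_sub, map_smul, oc_move B z hz]
        by_cases hii : i = i0
        · subst hii
          rw [← hi0, smul_eq_mul]
          have h4 : ((-1 : K) ^ (m + 1)) * (-1) ^ (m + 1) = 1 := by
            rw [← mul_pow]; simp
          field_simp
          linear_combination (-B ((z ^ i) u) w') * h4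
        · rw [hbig (i + (m + 1)) (by omega), h3 i (by omega) hik]
          simp
    · exact ⟨w', h1, h2, fun i hi hik => h3 i (by omega) hik⟩

theorem oc_block_sing [CharZero K] [FiniteDimensional K V] (B : V →ₗ[K] V →ₗ[K] K)
    (hsymm : ∀ u v : V, B u v = B v u)
    (hnd : ∀ u : V, (∀ v : V, B u v = 0) → u = 0)
    (z : V →ₗ[K] V) (hz : ∀ a b, B (z a) b = (-1) * B a (z b))
    (x : V) (hx0 : x ≠ 0) (hx : z x = 0) : OCBlock B z := by
  obtain ⟨k, u, w, hu, hw, h⟩ := oc_exists_pair B hnd z (-1) hz (by simp) x hx0 hx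
  rcases Nat.even_or_odd k with hk | hk
  · obtain ⟨v, hv, hvv⟩ := oc_polar B hsymm (z ^ k) (z ^ (k + 1))
      (fun a b => by rw [oc_pow_adj B z (-1) hz, hk.neg_one_pow, one_mul]) u w hu hw h
    refine oc_block_of B hsymm z hz v 0 (by simp) (by rintro rfl; simp at hvv)
      (ocW_nondeg B z hz v 0 k hv (by simp) ?_)
    intro c d h1 _
    simp only [smul_zero, add_zero, map_smul, LinearMap.smul_apply, smul_eq_mul] at h1
    rw [(mul_eq_zero.1 h1).resolve_right hvv]
    simp
  · obtain ⟨w', h1, h2, h3⟩ := oc_adjust B z hz u w k hu hw h k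
    refine oc_block_of B hsymm z hz u w' ?_ (by rintro rfl; simp at h2)
      (ocW_nondeg B z hz u w' k hu h1 ?_)
    · intro i
      rcases lt_trichotomy (2 * i) k with hi | hi | hi
      · exact h3 _ (by omega) hi
      · exfalso
        obtain ⟨j, rfl⟩ := hk
        omega
      · obtain ⟨j, hj⟩ : ∃ j, 2 * i = j + (k + 1) := ⟨2 * i - (k + 1), by omega⟩
        rw [hj, pow_add, Module.End.mul_apply, hu]
        simp
    · intro c d h4 h5
      simp only [map_add, map_smul, LinearMap.add_apply, LinearMap.smul_apply, smul_eq_mul,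
        oc_skew_odd B hsymm z hz k hk, mul_zero, add_zero, zero_add] at h4 h5
      rw [oc_pow_adj B z (-1) hz, hsymm, hk.neg_one_pow] at h4
      have hc : c = 0 := (mul_eq_zero.1 h5).resolve_right h2
      have hd : d = 0 := (mul_eq_zero.1 h4).resolve_right (by simpa using h2)
      simp [hc, hd]

theorem oc_aeval_adj (B : V →ₗ[K] V →ₗ[K] K) (s : V →ₗ[K] V)
    (hs : ∀ a b, B (s a) b = B a (s b)) (g : Polynomial K) (a b : V) :
    B (Polynomial.aeval s g a) b = B a (Polynomial.aeval s g b) := by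
  induction g using Polynomial.induction_on' generalizing a b with
  | add p q hp hq => simp [hp, hq]
  | monomial n c =>
    have h := oc_pow_adj B s 1 (by simpa using hs) n a b
    simp only [one_pow, one_mul] at h
    simp [Polynomial.aeval_monomial, Module.algebraMap_end_apply, h]

/-- One generator over `K[s]`, `s` self-adjoint: nondegeneracy. -/
theorem oc_onegen (B : V →ₗ[K] V →ₗ[K] K) (s : V →ₗ[K] V)
    (hs : ∀ a b, B (s a) b = B a (s b)) (f : Polynomial K) (hf : Irreducible f) (k : ℕ) (u : V)
    (hu : Polynomial.aeval s (f ^ (k + 1)) u = 0) (huu : B (Polynomial.aeval s (f ^ k) u) u ≠ 0)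
    (g : Polynomial K)
    (hg : ∀ g' : Polynomial K, B (Polynomial.aeval s g u) (Polynomial.aeval s g' u) = 0) :
    Polynomial.aeval s g u = 0 := by
  have step : ∀ i ≤ k + 1, f ^ i ∣ g := by
    intro i
    induction i with
    | zero => simp
    | succ i ih =>
      intro hi
      obtain ⟨g1, rfl⟩ := ih (by omega)
      have hdvd : f ∣ g1 := by
        by_contra hnd
        obtain ⟨a, b, hab⟩ := (hf.coprime_iff_not_dvd.2 hnd)
        apply huu
        have h1 := hg (b * f ^ (k - i))
        rw [← oc_aeval_adj B s hs, ← Module.End.mul_apply, ← map_mul] at h1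
        have h2 : b * f ^ (k - i) * (f ^ i * g1) = f ^ k - a * f ^ (k + 1) := by
          have h3 : f ^ k = f ^ (k - i) * f ^ i := by rw [← pow_add]; congr 1; omega
          rw [pow_succ, h3]
          linear_combination (f ^ (k - i) * f ^ i) * hab
        rw [h2, map_sub, map_mul, LinearMap.sub_apply, Module.End.mul_apply, hu, map_zero,
          sub_zero] at h1
        exact h1
      obtain ⟨g2, rfl⟩ := hdvd
      exact ⟨g2, by ring⟩
  obtain ⟨g1, rfl⟩ := step (k + 1) le_rfl
  rw [mul_comm, map_mul, Module.End.mul_apply, hu, map_zero]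

theorem oc_exists_irred [FiniteDimensional K V] [Nontrivial V] (s : V →ₗ[K] V) :
    ∃ f : Polynomial K, Irreducible f ∧ ∃ x : V, x ≠ 0 ∧ Polynomial.aeval s f x = 0 := by
  have hint : IsIntegral K s := Algebra.IsIntegral.isIntegral s
  obtain ⟨f, hf, g, hg⟩ := WfDvdMonoid.exists_irreducible_factor (minpoly.not_isUnit K s)
    (minpoly.ne_zero hint)
  refine ⟨f, hf, ?_⟩
  have hg0 : g ≠ 0 := by
    rintro rfl
    exact minpoly.ne_zero hint (by simpa using hg)
  have hgs : Polynomial.aeval s g ≠ 0 := by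
    intro h
    have h1 := Polynomial.natDegree_le_of_dvd (minpoly.dvd K s h) hg0
    rw [hg, Polynomial.natDegree_mul hf.ne_zero hg0] at h1
    have := hf.natDegree_pos
    omega
  obtain ⟨v, hv⟩ : ∃ v, Polynomial.aeval s g v ≠ 0 := by
    by_contra hc
    push Not at hc
    exact hgs (LinearMap.ext hc)
  refine ⟨_, hv, ?_⟩
  rw [← Module.End.mul_apply, ← map_mul, ← hg, minpoly.aeval, LinearMap.zero_apply]

theorem ocP_poly (z : V →ₗ[K] V) (u : V) (v : V) (hv : v ∈ ocP z u 0) :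
    ∃ g : Polynomial K, v = Polynomial.aeval (z ^ 2) g u := by
  unfold ocP at hv
  induction hv using Submodule.span_induction with
  | mem x hx =>
    rcases hx with ⟨i, rfl⟩ | ⟨i, rfl⟩
    · exact ⟨Polynomial.X ^ i, by simp [pow_mul]⟩
    · exact ⟨0, by simp⟩
  | zero => exact ⟨0, by simp⟩
  | add x y _ _ hx hy =>
    obtain ⟨g, rfl⟩ := hx
    obtain ⟨g', rfl⟩ := hy
    exact ⟨g + g', by simp⟩
  | smul a x _ hx =>
    obtain ⟨g, rfl⟩ := hx
    exact ⟨a • g, by simp⟩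

theorem ocP_poly_mem (z : V →ₗ[K] V) (u : V) (g : Polynomial K) :
    Polynomial.aeval (z ^ 2) g u ∈ ocP z u 0 := by
  induction g using Polynomial.induction_on' with
  | add p q hp hq => rw [map_add, LinearMap.add_apply]; exact add_mem hp hq
  | monomial n c =>
    have h := Submodule.smul_mem _ c (ocP_even z u 0 n)
    simpa [Polynomial.aeval_monomial, Module.algebraMap_end_apply, pow_mul] using h

theorem ocP_poly' (z : V →ₗ[K] V) (u : V) (v : V) (hv : v ∈ ocP z 0 u) :
    ∃ g : Polynomial K, v = z (Polynomial.aeval (z ^ 2) g u) := by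
  unfold ocP at hv
  induction hv using Submodule.span_induction with
  | mem x hx =>
    rcases hx with ⟨i, rfl⟩ | ⟨i, rfl⟩
    · exact ⟨0, by simp⟩
    · refine ⟨Polynomial.X ^ i, ?_⟩
      simp only [map_pow, Polynomial.aeval_X, ← pow_mul]
      rw [← Module.End.mul_apply, ← pow_succ']
  | zero => exact ⟨0, by simp⟩
  | add x y _ _ hx hy =>
    obtain ⟨g, rfl⟩ := hx
    obtain ⟨g', rfl⟩ := hy
    exact ⟨g + g', by simp⟩
  | smul a x _ hx =>
    obtain ⟨g, rfl⟩ := hx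
    exact ⟨a • g, by simp⟩

theorem oc_block_inj [CharZero K] [FiniteDimensional K V] [Nontrivial V]
    (B : V →ₗ[K] V →ₗ[K] K)
    (hsymm : ∀ u v : V, B u v = B v u)
    (hnd : ∀ u : V, (∀ v : V, B u v = 0) → u = 0)
    (z : V →ₗ[K] V) (hz : ∀ a b, B (z a) b = (-1) * B a (z b))
    (hinj : ∀ x, z x = 0 → x = 0) : OCBlock B z := by
  have hs : ∀ a b, B ((z ^ 2) a) b = B a ((z ^ 2) b) := by
    intro a b
    rw [oc_pow_adj B z (-1) hz]
    simp
  obtain ⟨f, hf, x, hx0, hx⟩ := oc_exists_irred (z ^ 2)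
  have hT := oc_aeval_adj B (z ^ 2) hs f
  obtain ⟨k, u0, w0, hu0, hw0, h⟩ := oc_exists_pair B hnd (Polynomial.aeval (z ^ 2) f) 1
    (by simpa using hT) one_ne_zero x hx0 hx
  rw [← map_pow] at hu0 hw0 h
  obtain ⟨u, hu, huu⟩ := oc_polar B hsymm _ _ (oc_aeval_adj B (z ^ 2) hs (f ^ k)) u0 w0 hu0 hw0 h
  have hone := oc_onegen B (z ^ 2) hs f hf k u hu huu
  have hzz : ∀ v, (z ^ 2) v = z (z v) := fun v => by rw [pow_two, Module.End.mul_apply]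
  have horth := ocP_orth B hsymm z hz u 0 (by simp)
  refine oc_block_of B hsymm z hz u 0 (by simp) (by rintro rfl; simp at huu) ?_
  intro r hr hrt
  obtain ⟨p, hp, q, hq, rfl⟩ := Submodule.mem_sup.1 hr
  have hp0 : p = 0 := by
    obtain ⟨g, rfl⟩ := ocP_poly z u p hp
    refine hone g fun g' => ?_
    have h1 := hrt _ (Submodule.mem_sup_left (ocP_poly_mem z u g'))
    rwa [map_add, LinearMap.add_apply, hsymm q, horth _ _ (ocP_poly_mem z u g') hq,
      add_zero] at h1
  have hq0 : q = 0 := by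
    obtain ⟨g, rfl⟩ := ocP_poly' z u q hq
    have h2 : Polynomial.aeval (z ^ 2) (Polynomial.X * g) u = 0 := by
      refine hone _ fun g' => ?_
      have h1 := hrt _ (Submodule.mem_sup_right (ocP_map z u 0 _ (ocP_poly_mem z u g')))
      rw [hp0, zero_add, hsymm, hz, hsymm] at h1
      rw [map_mul, Polynomial.aeval_X, Module.End.mul_apply, hzz]
      simpa using h1
    rw [map_mul, Polynomial.aeval_X, Module.End.mul_apply, hzz] at h2
    exact hinj _ h2
  rw [hp0, hq0, add_zero]

theorem oc_block [CharZero K] [FiniteDimensional K V] [Nontrivial V]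
    (B : V →ₗ[K] V →ₗ[K] K)
    (hsymm : ∀ u v : V, B u v = B v u)
    (hnd : ∀ u : V, (∀ v : V, B u v = 0) → u = 0)
    (z : V →ₗ[K] V) (hz : ∀ a b, B (z a) b = (-1) * B a (z b)) : OCBlock B z := by
  by_cases h : ∀ x, z x = 0 → x = 0
  · exact oc_block_inj B hsymm hnd z hz h
  · push Not at h
    obtain ⟨x, hx, hx0⟩ := h
    exact oc_block_sing B hsymm hnd z hz x hx0 hx

/-- Restriction of the form. -/
def ocRes (B : V →ₗ[K] V →ₗ[K] K) (W : Submodule K V) : W →ₗ[K] W →ₗ[K] K :=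
  B.domRestrict₁₂ W W

theorem ocRes_apply (B : V →ₗ[K] V →ₗ[K] K) (W : Submodule K V) (a b : W) :
    ocRes B W a b = B a b := rfl

theorem ocRes_nondeg (B : V →ₗ[K] V →ₗ[K] K)
    (hnd : ∀ u : V, (∀ v : V, B u v = 0) → u = 0) (W W' : Submodule K V) (hc : W ⊔ W' = ⊤)
    (ho : ∀ a ∈ W, ∀ b ∈ W', B a b = 0) (u : W) (hu : ∀ v : W, ocRes B W u v = 0) : u = 0 := by
  apply Subtype.ext
  apply hnd
  intro v
  have hv : v ∈ W ⊔ W' := by rw [hc]; trivial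
  obtain ⟨a, ha, b, hb, rfl⟩ := Submodule.mem_sup.1 hv
  rw [map_add, ho u u.2 b hb, add_zero]
  exact hu ⟨a, ha⟩

theorem oc_isCompl [FiniteDimensional K V] (B : V →ₗ[K] V →ₗ[K] K)
    (hsymm : ∀ u v : V, B u v = B v u) (W : Submodule K V)
    (hW : ∀ r ∈ W, (∀ t ∈ W, B r t = 0) → r = 0) :
    ∃ W' : Submodule K V, IsCompl W W' ∧ ∀ b, b ∈ W' ↔ ∀ a ∈ W, B a b = 0 := by
  refine ⟨LinearMap.BilinForm.orthogonal B W, ?_, fun b => Iff.rfl⟩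
  rw [LinearMap.BilinForm.isCompl_orthogonal_iff_disjoint]
  · rw [Submodule.disjoint_def]
    intro r hr hr'
    exact hW r hr fun t ht => by rw [hsymm]; exact hr' t ht
  · intro a b h
    rw [hsymm]; exact h

end OrthConj

theorem oc_skew_aux (K : Type*) [Field K] [CharZero K] (n : ℕ) :
    ∀ (V : Type*) [AddCommGroup V] [Module K V] [FiniteDimensional K V]
    (B : V →ₗ[K] V →ₗ[K] K)
    (_ : ∀ u v : V, B u v = B v u)
    (_ : ∀ u : V, (∀ v : V, B u v = 0) → u = 0)
    (z : V →ₗ[K] V) (_ : ∀ a b, B (z a) b = (-1) * B a (z b)),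
    Module.finrank K V = n →
    ∃ P Q : Submodule K V, (∀ p ∈ P, ∀ q ∈ Q, B p q = 0) ∧ (∀ p ∈ P, z p ∈ Q) ∧
      (∀ q ∈ Q, z q ∈ P) ∧ P ⊔ Q = ⊤ := by
  induction n using Nat.strong_induction_on with
  | _ n ih =>
  intro V _ _ _ B hsymm hnd z hz hn
  rcases subsingleton_or_nontrivial V with hV | hV
  · refine ⟨⊥, ⊥, by simp, by simp, by simp, ?_⟩
    exact Subsingleton.elim _ _
  obtain ⟨P, Q, ho, hPQ, hQP, hW, hne⟩ := oc_block B hsymm hnd z hz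
  obtain ⟨N, hc, hN⟩ := oc_isCompl B hsymm (P ⊔ Q) hW
  have hzN : ∀ v ∈ N, z v ∈ N := by
    intro v hv
    rw [hN] at hv ⊢
    intro a ha
    have h1 : z a ∈ P ⊔ Q := by
      obtain ⟨p, hp, q, hq, rfl⟩ := Submodule.mem_sup.1 ha
      rw [map_add]
      exact add_mem (Submodule.mem_sup_right (hPQ p hp)) (Submodule.mem_sup_left (hQP q hq))
    have h2 := hv _ h1
    rw [hz] at h2
    simpa using h2
  have hlt : Module.finrank K N < n := by
    have h1 := Submodule.finrank_add_eq_of_isCompl hc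
    have h2 : Module.finrank K ↥(P ⊔ Q) ≠ 0 := by
      rw [Ne, Submodule.finrank_eq_zero]
      exact hne
    omega
  obtain ⟨P1, Q1, ho1, hPQ1, hQP1, htop⟩ := ih _ hlt N (ocRes B N)
    (fun a b => hsymm a b)
    (ocRes_nondeg B hnd N (P ⊔ Q) (by rw [sup_comm]; exact hc.sup_eq_top)
      (fun a ha b hb => by rw [hsymm]; exact (hN a).1 ha b hb))
    (z.restrict hzN) (fun a b => hz a b) rfl
  refine ⟨P ⊔ P1.map N.subtype, Q ⊔ Q1.map N.subtype, ?_, ?_, ?_, ?_⟩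
  · intro p' hp' q' hq'
    obtain ⟨p, hp, _, ⟨p1, hp1, rfl⟩, rfl⟩ := Submodule.mem_sup.1 hp'
    obtain ⟨q, hq, _, ⟨q1, hq1, rfl⟩, rfl⟩ := Submodule.mem_sup.1 hq'
    have h1 := ho p hp q hq
    have h2 : B p1 q1 = 0 := ho1 p1 hp1 q1 hq1
    have h3 := (hN q1).1 q1.2 p (Submodule.mem_sup_left hp)
    have h4 := (hN p1).1 p1.2 q (Submodule.mem_sup_right hq)
    rw [hsymm] at h4
    simp [h1, h2, h3, h4]
  · intro p' hp'
    obtain ⟨p, hp, _, ⟨p1, hp1, rfl⟩, rfl⟩ := Submodule.mem_sup.1 hp'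
    rw [map_add]
    exact add_mem (Submodule.mem_sup_left (hPQ p hp))
      (Submodule.mem_sup_right ⟨_, hPQ1 p1 hp1, rfl⟩)
  · intro p' hp'
    obtain ⟨p, hp, _, ⟨p1, hp1, rfl⟩, rfl⟩ := Submodule.mem_sup.1 hp'
    rw [map_add]
    exact add_mem (Submodule.mem_sup_left (hQP p hp))
      (Submodule.mem_sup_right ⟨_, hQP1 p1 hp1, rfl⟩)
  · rw [sup_sup_sup_comm, ← Submodule.map_sup, htop, Submodule.map_top, Submodule.range_subtype]
    exact hc.sup_eq_top

section OrthConj2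
variable {K : Type*} [Field K] [CharZero K] {V : Type*} [AddCommGroup V] [Module K V]
  [FiniteDimensional K V]

theorem oc_skew (B : V →ₗ[K] V →ₗ[K] K)
    (hsymm : ∀ u v : V, B u v = B v u)
    (hnd : ∀ u : V, (∀ v : V, B u v = 0) → u = 0)
    (z : V →ₗ[K] V) (hz : ∀ a b, B (z a) b = (-1) * B a (z b)) :
    ∃ h : V →ₗ[K] V, (∀ u v, B (h u) (h v) = B u v) ∧ ∀ v, h (z v) = - z (h v) := by
  obtain ⟨P, Q, ho, hPQ, hQP, htop⟩ := oc_skew_aux K _ V B hsymm hnd z hz rfl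
  have hc : IsCompl P Q := by
    refine ⟨?_, codisjoint_iff.2 htop⟩
    rw [Submodule.disjoint_def]
    intro v hv hv'
    apply hnd
    intro t
    have ht : t ∈ P ⊔ Q := by rw [htop]; trivial
    obtain ⟨p, hp, q, hq, rfl⟩ := Submodule.mem_sup.1 ht
    rw [map_add, ho v hv q hq, hsymm, ho p hp v hv', add_zero]
  have hex : ∃ h : V →ₗ[K] V, (∀ p ∈ P, h p = p) ∧ (∀ q ∈ Q, h q = -q) :=
    ⟨LinearMap.ofIsCompl hc P.subtype (-Q.subtype),
      fun p hp => LinearMap.ofIsCompl_apply_left hc (⟨p, hp⟩ : P),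
      fun q hq => LinearMap.ofIsCompl_apply_right hc (⟨q, hq⟩ : Q)⟩
  obtain ⟨h, hP, hQ⟩ := hex
  have hdec : ∀ v, ∃ p ∈ P, ∃ q ∈ Q, p + q = v := fun v =>
    Submodule.mem_sup.1 (by rw [htop]; trivial)
  refine ⟨h, fun u v => ?_, fun v => ?_⟩
  · obtain ⟨p, hp, q, hq, rfl⟩ := hdec u
    obtain ⟨p', hp', q', hq', rfl⟩ := hdec v
    have h1 := ho p hp q' hq'
    have h2 := ho p' hp' q hq
    rw [hsymm] at h2
    simp [hP p hp, hP p' hp', hQ q hq, hQ q' hq', h1, h2]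
  · obtain ⟨p, hp, q, hq, rfl⟩ := hdec v
    simp only [map_add, hP p hp, hQ q hq, hQ _ (hPQ p hp), hP _ (hQP q hq), map_neg]
    abel

/-- Cayley transform step. -/
theorem oc_cayley (B : V →ₗ[K] V →ₗ[K] K)
    (hsymm : ∀ u v : V, B u v = B v u)
    (hnd : ∀ u : V, (∀ v : V, B u v = 0) → u = 0)
    (x : V →ₗ[K] V) (hx : ∀ a b, B (x a) (x b) = B a b) (hinj : ∀ v, x v + v = 0 → v = 0) :
    ∃ h : V →ₗ[K] V, (∀ u v, B (h u) (h v) = B u v) ∧ ∀ v, x (h (x v)) = h v := by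
  have hi : Function.Injective (x + LinearMap.id : V →ₗ[K] V) := by
    rw [injective_iff_map_eq_zero]
    exact hinj
  let c : V ≃ₗ[K] V := LinearEquiv.ofInjectiveEndo (x + LinearMap.id) hi
  have hcv : ∀ v, c v = x v + v := fun v => rfl
  let z : V →ₗ[K] V := (x - LinearMap.id) ∘ₗ (c.symm : V →ₗ[K] V)
  have hzc : ∀ v, z (x v + v) = x v - v := by
    intro v
    rw [← hcv]
    simp [z]
  have hsurj : ∀ v, ∃ t, x t + t = v := fun v => ⟨c.symm v, by rw [← hcv]; simp⟩
  obtain ⟨h, h1, h2⟩ := oc_skew B hsymm hnd z (by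
    intro a b
    obtain ⟨a, rfl⟩ := hsurj a
    obtain ⟨b, rfl⟩ := hsurj b
    rw [hzc, hzc]
    simp only [map_add, map_sub, LinearMap.add_apply, LinearMap.sub_apply, hx]
    ring)
  refine ⟨h, h1, fun v => ?_⟩
  have h3 := h2 (x v + v)
  rw [hzc, map_sub, map_add] at h3
  obtain ⟨t, ht⟩ := hsurj (h (x v) + h v)
  rw [← ht, hzc] at h3
  have h4 : h (x v) = t := by
    have : (2 : K) • (h (x v) - t) = 0 := by
      linear_combination (norm := module) h3 - ht
    exact sub_eq_zero.1 ((smul_eq_zero.1 this).resolve_left two_ne_zero)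
  rw [h4] at ht ⊢
  exact add_right_cancel (b := t) (by rw [ht, add_comm])

/-- Gluing along an orthogonal decomposition. -/
theorem oc_glue (B : V →ₗ[K] V →ₗ[K] K) (hsymm : ∀ u v : V, B u v = B v u)
    (x : V →ₗ[K] V) (W W' : Submodule K V) (hc : IsCompl W W')
    (ho : ∀ a ∈ W, ∀ b ∈ W', B a b = 0)
    (hW : ∀ a ∈ W, x a ∈ W) (hW' : ∀ a ∈ W', x a ∈ W')
    (h1 : ∃ h : W →ₗ[K] W, (∀ u v : W, B (h u) (h v) = B u v) ∧
      ∀ v : W, x (h ⟨x v, hW v v.2⟩) = h v)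
    (h2 : ∃ h : W' →ₗ[K] W', (∀ u v : W', B (h u) (h v) = B u v) ∧
      ∀ v : W', x (h ⟨x v, hW' v v.2⟩) = h v) :
    ∃ h : V →ₗ[K] V, (∀ u v, B (h u) (h v) = B u v) ∧ ∀ v, x (h (x v)) = h v := by
  obtain ⟨h1, hi1, hx1⟩ := h1
  obtain ⟨h2, hi2, hx2⟩ := h2
  have hex : ∃ h : V →ₗ[K] V, (∀ p : W, h p = h1 p) ∧ (∀ q : W', h q = h2 q) :=
    ⟨LinearMap.ofIsCompl hc (W.subtype ∘ₗ h1) (W'.subtype ∘ₗ h2),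
      fun p => by simp,
      fun q => by simp⟩
  obtain ⟨h, hP, hQ⟩ := hex
  have hdec : ∀ v, ∃ (p : W) (q : W'), (p : V) + q = v := fun v => by
    have hv : v ∈ W ⊔ W' := by rw [hc.sup_eq_top]; trivial
    obtain ⟨p, hp, q, hq, rfl⟩ := Submodule.mem_sup.1 hv
    exact ⟨⟨p, hp⟩, ⟨q, hq⟩, rfl⟩
  have ho' : ∀ (p : W) (q : W'), B p q = 0 := fun p q => ho p p.2 q q.2
  have ho'' : ∀ (p : W) (q : W'), B q p = 0 := fun p q => by rw [hsymm]; exact ho' p q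
  refine ⟨h, fun u v => ?_, fun v => ?_⟩
  · obtain ⟨p, q, rfl⟩ := hdec u
    obtain ⟨p', q', rfl⟩ := hdec v
    simp only [map_add, LinearMap.add_apply, hP, hQ, ho', ho'', hi1, hi2]
  · obtain ⟨p, q, rfl⟩ := hdec v
    have e1 := hP ⟨x p, hW p p.2⟩
    have e2 := hQ ⟨x q, hW' q q.2⟩
    simp only at e1 e2
    simp only [map_add, hP, hQ, e1, e2, hx1, hx2]

theorem oc_main (B : V →ₗ[K] V →ₗ[K] K)
    (hsymm : ∀ u v : V, B u v = B v u)
    (hnd : ∀ u : V, (∀ v : V, B u v = 0) → u = 0)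
    (x : V ≃ₗ[K] V) (hx : ∀ u v : V, B (x u) (x v) = B u v) :
    ∃ h : V →ₗ[K] V, (∀ u v, B (h u) (h v) = B u v) ∧ ∀ v, x (h (x v)) = h v := by
  let T : V →ₗ[K] V := (x : V →ₗ[K] V) + (x.symm : V →ₗ[K] V) + (2 : K) • LinearMap.id
  have hTv : ∀ v, T v = x v + x.symm v + (2 : K) • v := fun v => rfl
  have hadj : ∀ a b, B (x.symm a) b = B a (x b) := fun a b => by
    rw [← hx (x.symm a), x.apply_symm_apply]
  have hadj' : ∀ a b, B (x a) b = B a (x.symm b) := fun a b => by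
    rw [← hx a, x.apply_symm_apply]
  have hT : ∀ a b, B (T a) b = 1 * B a (T b) := by
    intro a b
    simp only [hTv, map_add, map_smul, LinearMap.add_apply, LinearMap.smul_apply, hadj, hadj']
    ring
  have hcomm : ∀ n v, (T ^ n) (x v) = x ((T ^ n) v) := by
    intro n
    induction n with
    | zero => simp
    | succ n ih =>
      intro v
      rw [pow_succ, Module.End.mul_apply, Module.End.mul_apply, ← ih]
      congr 1
      simp [hTv]
  obtain ⟨n, hn0, hn⟩ := oc_fitting T
  have hTn : ∀ (c : K) v, T v = c • v → (T ^ n) v = c ^ n • v := by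
    intro c v hv
    clear hn hn0
    induction n with
    | zero => simp
    | succ n ih => rw [pow_succ, Module.End.mul_apply, hv, map_smul, ih, smul_smul, pow_succ']
  have ho : ∀ a ∈ LinearMap.ker (T ^ n), ∀ b ∈ LinearMap.range (T ^ n), B a b = 0 := by
    rintro a ha _ ⟨b, rfl⟩
    have h1 := oc_pow_adj B T 1 hT n a b
    rw [LinearMap.mem_ker.1 ha] at h1
    simpa using h1.symm
  have hW : ∀ a ∈ LinearMap.ker (T ^ n), (x : V →ₗ[K] V) a ∈ LinearMap.ker (T ^ n) := by
    intro a ha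
    rw [LinearMap.mem_ker] at ha ⊢
    simp [hcomm, ha]
  have hW' : ∀ a ∈ LinearMap.range (T ^ n), (x : V →ₗ[K] V) a ∈ LinearMap.range (T ^ n) := by
    rintro _ ⟨b, rfl⟩
    exact ⟨x b, hcomm n b⟩
  refine oc_glue B hsymm (x : V →ₗ[K] V) _ _ hn ho hW hW' ?_ ?_
  · obtain ⟨h, h1, h2⟩ := oc_cayley (ocRes B (LinearMap.ker (T ^ n))) (fun a b => hsymm a b)
      (ocRes_nondeg B hnd _ _ hn.sup_eq_top ho) (-((x : V →ₗ[K] V).restrict hW)) (by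
        intro a b
        simp only [LinearMap.neg_apply, map_neg, neg_neg]
        exact hx a b) (by
        intro v hv
        have hv1 : x v = v := by
          have := congrArg Subtype.val hv
          simp only [LinearMap.neg_apply, Submodule.coe_add, Submodule.coe_neg,
            LinearMap.coe_restrict_apply, Submodule.coe_zero] at this
          exact (neg_add_eq_zero.1 this)
        have hv2 : x.symm v = v := by rw [LinearEquiv.symm_apply_eq, hv1]
        have h3 := hTn (4 : K) v (by rw [hTv, hv1, hv2]; module)
        rw [LinearMap.mem_ker.1 v.2] at h3
        exact Subtype.ext ((smul_eq_zero.1 h3.symm).resolve_left (pow_ne_zero n (by norm_num))))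
    refine ⟨h, h1, fun v => ?_⟩
    have h4 := congrArg Subtype.val (h2 v)
    simp only [LinearMap.neg_apply, map_neg, neg_neg] at h4
    exact h4
  · obtain ⟨h, h1, h2⟩ := oc_cayley (ocRes B (LinearMap.range (T ^ n))) (fun a b => hsymm a b)
      (ocRes_nondeg B hnd _ _ (by rw [sup_comm]; exact hn.sup_eq_top)
        (fun a ha b hb => by rw [hsymm]; exact ho b hb a ha)) ((x : V →ₗ[K] V).restrict hW')
      (fun a b => hx a b) (by
        intro v hv
        have hv1 : x v = -(v : V) := eq_neg_of_add_eq_zero_left (congrArg Subtype.val hv)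
        have hv2 : x.symm v = -(v : V) := by
          rw [LinearEquiv.symm_apply_eq, map_neg, hv1, neg_neg]
        have h3 := hTn 0 v (by rw [hTv, hv1, hv2]; module)
        rw [zero_pow (by omega), zero_smul] at h3
        exact Subtype.ext ((Submodule.disjoint_def.1 hn.disjoint) v h3 v.2))
    exact ⟨h, h1, fun v => congrArg Subtype.val (h2 v)⟩

end OrthConj2



/-- Every isometry of a nondegenerate symmetric bilinear form on a finite-dimensional
vector space over a field of characteristic zero is conjugate to its inverse within
the isometry group (orthogonal group) of the form. -/
theorem stmt1 (K : Type*) [Field K] [CharZero K]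
    (V : Type*) [AddCommGroup V] [Module K V] [FiniteDimensional K V]
    (B : V →ₗ[K] V →ₗ[K] K)
    (hsymm : ∀ u v : V, B u v = B v u)
    (hnd : ∀ u : V, (∀ v : V, B u v = 0) → u = 0)
    (x : V ≃ₗ[K] V) (hx : ∀ u v : V, B (x u) (x v) = B u v) :
    ∃ h : V ≃ₗ[K] V, (∀ u v : V, B (h u) (h v) = B u v) ∧ h * x * h⁻¹ = x⁻¹ := by
  obtain ⟨h, h1, h2⟩ := oc_main B hsymm hnd x hx
  have hi : Function.Injective h := by
    rw [injective_iff_map_eq_zero]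
    intro a ha
    apply hnd
    intro v
    rw [← h1, ha, map_zero, LinearMap.zero_apply]
  refine ⟨LinearEquiv.ofInjectiveEndo h hi, h1, ?_⟩
  rw [mul_inv_eq_iff_eq_mul, eq_inv_mul_iff_mul_eq]
  ext v
  exact h2 v
end

section
/- Let K be a field of characteristic zero, V a finite-dimensional K-vector space, and B a nondegenerate symmetric bilinear form on V. Then every isometry x of B is a product of two involutive isometries: there exist linear automorphisms s, t of V with B(s u, s v) = B(u,v) and B(t u, t v) = B(u,v) for all u, v, with s² = 1 and t² = 1, such that x = s ∘ t. (Classical bireflectionality of orthogonal groups, the linear-algebra fact underlying the conjugacy of ğxğ⁻¹ to x⁻¹.) -/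
open Polynomial

structure BirSetup {K A V : Type*} [Field K] [CommRing A] [Algebra K A]
    [AddCommGroup V] [Module K V] [Module A V]
    (B : V →ₗ[K] V →ₗ[K] K) (σ : A →ₐ[K] A) : Prop where
  symm : ∀ u v, B u v = B v u
  nd : ∀ u, (∀ v, B u v = 0) → u = 0
  adj : ∀ (a : A) u v, B (a • u) v = B u (σ a • v)
  invol : ∀ a, σ (σ a) = a
  indec : ∀ W : Submodule A V, (∀ w ∈ W, (∀ w' ∈ W, B w w' = 0) → w = 0) → W = ⊥ ∨ W = ⊤

def BirGood {K A V : Type*} [Field K] [CommRing A] [Algebra K A]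
    [AddCommGroup V] [Module K V] [Module A V]
    (B : V →ₗ[K] V →ₗ[K] K) (σ : A →ₐ[K] A) : Prop :=
  ∃ s : V →ₗ[K] V, (∀ v, s (s v) = v) ∧ (∀ (a : A) v, s (a • v) = σ a • s v) ∧
    ∀ u v, B (s u) (s v) = B u v

section
set_option linter.unusedSectionVars false
variable {K A V : Type*} [Field K] [CharZero K] [CommRing A] [Algebra K A]
    [AddCommGroup V] [Module K V] [Module A V] [IsScalarTower K A V] [FaithfulSMul A V]
    {B : V →ₗ[K] V →ₗ[K] K} {σ : A →ₐ[K] A}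

theorem BirSetup.adj' (h : BirSetup B σ) (a : A) (u v : V) : B u (a • v) = B (σ a • u) v := by
  rw [h.adj, h.invol]

theorem BirSetup.swap (h : BirSetup B σ) (a b : A) (u : V) :
    B (σ a • u) (σ b • u) = B (a • u) (b • u) := by
  rw [h.symm (a • u), h.adj, h.adj, h.invol, smul_smul, smul_smul, mul_comm]

theorem BirSetup.skew (h : BirSetup B σ) (a : A) (ha : σ a = -a) (u : V) : B (a • u) u = 0 := by
  have h1 := h.adj a u u
  rw [ha, h.symm, neg_smul, map_neg] at h1
  rw [h.symm]
  exact self_eq_neg.mp h1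

theorem bir_cyclic (h : BirSetup B σ) (v : V) (hv : ∀ z : V, ∃ a : A, a • v = z) :
    BirGood B σ := by
  have hinj : ∀ a : A, a • v = 0 → a = 0 := by
    intro a ha
    apply FaithfulSMul.eq_of_smul_eq_smul (α := V)
    intro z
    obtain ⟨b, rfl⟩ := hv z
    rw [smul_comm, ha, smul_zero, zero_smul]
  let f : A →ₗ[K] V := (LinearMap.toSpanSingleton A V v).restrictScalars K
  have hf : ∀ a, f a = a • v := fun a => rfl
  let e : A ≃ₗ[K] V := LinearEquiv.ofBijective f
    ⟨(injective_iff_map_eq_zero f).2 hinj, hv⟩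
  have he : ∀ a, e a = a • v := fun a => rfl
  have hs : ∀ a : A, e.symm (a • v) = a := fun a => by rw [← he, e.symm_apply_apply]
  refine ⟨e.toLinearMap ∘ₗ σ.toLinearMap ∘ₗ e.symm.toLinearMap, ?_, ?_, ?_⟩
  · intro z
    obtain ⟨a, rfl⟩ := hv z
    simp [hs, he, h.invol]
  · intro b z
    obtain ⟨a, rfl⟩ := hv z
    simp [hs, he, smul_smul]
  · intro y z
    obtain ⟨a, rfl⟩ := hv z
    obtain ⟨b, rfl⟩ := hv y
    simp [hs, he, h.swap]

theorem bir_H1 (h : BirSetup B σ) (c : A) (hc : c ≠ 0) (hσ : σ c = c)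
    (hmin : ∀ a : A, a ≠ 0 → ∃ b b' : A, b * a + b' * σ a = c) : BirGood B σ := by
  obtain ⟨v, hv⟩ : ∃ v, B (c • v) v ≠ 0 := by
    by_contra! hall
    apply hc
    apply FaithfulSMul.eq_of_smul_eq_smul (α := V)
    intro u
    rw [zero_smul]
    apply h.nd
    intro w
    have h1 := hall (u + w)
    have h2 : B (c • w) u = B (c • u) w := by
      rw [h.adj, hσ, h.symm]
    simp only [smul_add, map_add, LinearMap.add_apply, hall, h2, zero_add, add_zero] at h1
    exact self_eq_neg.mp (eq_neg_of_add_eq_zero_left h1)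
  have := h.indec (Submodule.span A {v}) (by
    intro w hw hrad
    obtain ⟨a, rfl⟩ := Submodule.mem_span_singleton.1 hw
    by_contra hne
    have ha : a ≠ 0 := by rintro rfl; simp at hne
    obtain ⟨b, b', hb⟩ := hmin a ha
    apply hv
    have e1 : ∀ b : A, B ((b * a) • v) v = 0 := by
      intro b
      rw [mul_smul, h.adj, hrad _ (Submodule.mem_span_singleton.2 ⟨_, rfl⟩)]
    have e2 : B ((b' * σ a) • v) v = 0 := by
      rw [h.adj, map_mul, h.invol, h.symm, mul_comm, ← e1 (σ b'), mul_comm]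
    rw [← hb, add_smul, map_add, LinearMap.add_apply, e1, e2, add_zero])
  rcases this with h0 | h0
  · rw [Submodule.span_singleton_eq_bot] at h0
    subst h0
    simp at hv
  · exact bir_cyclic h v fun z => Submodule.mem_span_singleton.1 (h0 ▸ Submodule.mem_top)

theorem bir_H2 [FiniteDimensional K A] (h : BirSetup B σ) (c : A) (hc : c ≠ 0) (hσ : σ c = -c)
    (hscal : ∀ a : A, ∃ α : K, a * c = α • c)
    (hmin : ∀ a : A, a ≠ 0 → ∃ b : A, b * a = c) : BirGood B σ := by
  obtain ⟨w₀, v, hv⟩ : ∃ w₀ v, B (c • w₀) v ≠ 0 := by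
    by_contra! hall
    apply hc
    apply FaithfulSMul.eq_of_smul_eq_smul (α := V)
    intro u
    rw [zero_smul]
    exact h.nd _ (hall u)
  let f : A →ₗ[K] K := (B.flip v) ∘ₗ (LinearMap.toSpanSingleton A V w₀).restrictScalars K
  have hf : ∀ a, f a = B (a • w₀) v := fun a => rfl
  let F : A →ₗ[K] Module.Dual K A := (LinearMap.mul K A).compr₂ f
  have hF : ∀ a b, F a b = f (a * b) := fun a b => rfl
  have hFinj : Function.Injective F := by
    rw [injective_iff_map_eq_zero]
    intro a ha
    by_contra hne
    obtain ⟨b, hb⟩ := hmin a hne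
    apply hv
    rw [← hf, ← hb, mul_comm, ← hF, ha, LinearMap.zero_apply]
  have hFsurj : Function.Surjective F :=
    (LinearMap.injective_iff_surjective_of_finrank_eq_finrank
      (Subspace.dual_finrank_eq (K := K) (V := A)).symm).1 hFinj
  obtain ⟨t, ht⟩ := hFsurj (f - f ∘ₗ σ.toLinearMap)
  obtain ⟨w, hw⟩ : ∃ w, ∀ a, B (a • w) v = f a - f (σ a) := by
    refine ⟨t • w₀, fun a => ?_⟩
    have := LinearMap.congr_fun ht a
    rw [hF, mul_comm, hf, mul_smul] at this
    exact this
  have hwσ : ∀ a, B (σ a • w) v = - B (a • w) v := by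
    intro a; rw [hw, hw, h.invol]; ring
  have hcw : B (c • w) v ≠ 0 := by
    rw [hw, hσ, map_neg, sub_neg_eq_add, ← two_mul]
    exact mul_ne_zero two_ne_zero hv
  have hcv : B (c • v) w ≠ 0 := by
    rw [h.symm, h.adj', hσ, neg_smul, map_neg, LinearMap.neg_apply]
    exact neg_ne_zero.2 hcw
  have hscv : ∀ a : A, B ((a * c) • v) v = 0 := by
    intro a
    obtain ⟨α, hα⟩ := hscal a
    rw [hα, smul_assoc, map_smul, LinearMap.smul_apply, h.skew c hσ, smul_zero]
  have hscw : ∀ a : A, B ((a * c) • w) w = 0 := by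
    intro a
    obtain ⟨α, hα⟩ := hscal a
    rw [hα, smul_assoc, map_smul, LinearMap.smul_apply, h.skew c hσ, smul_zero]
  have key : ∀ p q : A, (∀ a : A, B (a • (p • v + q • w)) v = 0) →
      (∀ a : A, B (a • (p • v + q • w)) w = 0) → p = 0 ∧ q = 0 := by
    intro p q h1 h2
    have h1' : ∀ a : A, B ((a * p) • v) v + B ((a * q) • w) v = 0 := by
      intro a
      have := h1 a
      rwa [smul_add, smul_smul, smul_smul, map_add, LinearMap.add_apply] at this
    have h2' : ∀ a : A, B ((a * p) • v) w + B ((a * q) • w) w = 0 := by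
      intro a
      have := h2 a
      rwa [smul_add, smul_smul, smul_smul, map_add, LinearMap.add_apply] at this
    constructor
    · by_contra hp
      obtain ⟨b, hb⟩ := hmin p hp
      by_cases hbq : b * q = 0
      · have := h2' b
        rw [hb, hbq] at this
        simp at this
        exact hcv this
      · obtain ⟨b', hb'⟩ := hmin _ hbq
        have := h1' (b' * b)
        rw [mul_assoc, hb, mul_assoc, hb', hscv, zero_add] at this
        exact hcw this
    · by_contra hq
      obtain ⟨b, hb⟩ := hmin q hq
      by_cases hbp : b * p = 0
      · have := h1' b
        rw [hb, hbp] at this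
        simp at this
        exact hcw this
      · obtain ⟨b', hb'⟩ := hmin _ hbp
        have := h2' (b' * b)
        rw [mul_assoc, hb', mul_assoc, hb, hscw, add_zero] at this
        exact hcv this
  have htop := h.indec (Submodule.span A {v, w}) (by
    intro z hz hrad
    obtain ⟨p, q, rfl⟩ := Submodule.mem_span_pair.1 hz
    obtain ⟨rfl, rfl⟩ := key p q
      (fun a => by
        rw [h.adj]
        exact hrad _ (Submodule.smul_mem _ _ (Submodule.subset_span (by simp))))
      (fun a => by
        rw [h.adj]
        exact hrad _ (Submodule.smul_mem _ _ (Submodule.subset_span (by simp))))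
    simp)
  have htop : ∀ z : V, ∃ p q : A, p • v + q • w = z := by
    rcases htop with h0 | h0
    · exfalso
      have : v ∈ Submodule.span A {v, w} := Submodule.subset_span (by simp)
      rw [h0, Submodule.mem_bot] at this
      rw [this] at hcv
      simp at hcv
    · intro z
      exact Submodule.mem_span_pair.1 (h0 ▸ Submodule.mem_top)
  let g : A × A →ₗ[K] V := LinearMap.coprod
    ((LinearMap.toSpanSingleton A V v).restrictScalars K)
    ((LinearMap.toSpanSingleton A V w).restrictScalars K)
  have hg : ∀ p q, g (p, q) = p • v + q • w := fun p q => by simp [g]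
  let e : (A × A) ≃ₗ[K] V := LinearEquiv.ofBijective g ⟨by
      rw [injective_iff_map_eq_zero]
      rintro ⟨p, q⟩ h0
      rw [hg] at h0
      obtain ⟨rfl, rfl⟩ := key p q (by simp [h0]) (by simp [h0])
      rfl, by
      intro z
      obtain ⟨p, q, rfl⟩ := htop z
      exact ⟨(p, q), hg p q⟩⟩
  have he : ∀ p q, e (p, q) = p • v + q • w := hg
  have hs : ∀ p q : A, e.symm (p • v + q • w) = (p, q) := fun p q => by
    rw [← he, e.symm_apply_apply]
  let s : V →ₗ[K] V := e.toLinearMap ∘ₗ (LinearMap.prodMap σ.toLinearMap (-σ.toLinearMap)) ∘ₗ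
    e.symm.toLinearMap
  have hsa : ∀ p q : A, s (p • v + q • w) = σ p • v + (-σ q) • w := by
    intro p q
    simp only [s, LinearMap.comp_apply, LinearEquiv.coe_coe, hs, LinearMap.prodMap_apply]
    exact he _ _
  refine ⟨s, ?_, ?_, ?_⟩
  · intro z
    obtain ⟨p, q, rfl⟩ := htop z
    rw [hsa, hsa, map_neg, h.invol, h.invol, neg_neg]
  · intro b z
    obtain ⟨p, q, rfl⟩ := htop z
    rw [hsa, smul_add, smul_smul, smul_smul, hsa, smul_add, smul_smul, smul_smul]
    simp
  · have cross : ∀ p q : A, B (σ p • w) (σ q • v) = - B (p • w) (q • v) := by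
      intro p q
      rw [h.adj', h.adj' q, smul_smul, smul_smul, ← map_mul, hwσ, ← hwσ, map_mul]
    intro y z
    obtain ⟨p, q, rfl⟩ := htop z
    obtain ⟨p', q', rfl⟩ := htop y
    rw [hsa, hsa]
    simp only [neg_smul, map_add, map_neg, LinearMap.add_apply, LinearMap.neg_apply, h.swap, cross]
    rw [h.symm (σ p' • v), cross, h.symm (q • w)]
    ring

theorem bir_fitting [FiniteDimensional K A] (h : BirSetup B σ) (a : A) (ha : σ a = a) :
    IsNilpotent a ∨ IsUnit a := by
  have : IsArtinianRing A := IsArtinianRing.of_finite K A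
  obtain ⟨N, y, hy⟩ := IsArtinian.exists_pow_succ_smul_dvd (M := A) a (1 : A)
  simp only [smul_eq_mul, mul_one] at hy
  have hm : ∀ m, a ^ (N + m) * y ^ m = a ^ N := by
    intro m
    induction m with
    | zero => simp
    | succ m ih =>
      rw [Nat.succ_eq_add_one] at hy
      linear_combination a ^ m * y ^ m * hy + ih
  rcases h.indec (LinearMap.range (LinearMap.lsmul A V (a ^ N))) (by
    rintro _ ⟨v, rfl⟩ hrad
    simp only [LinearMap.lsmul_apply] at hrad ⊢
    have h0 : (a ^ N * a ^ N) • v = 0 := by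
      apply h.nd
      intro z
      rw [mul_smul, h.adj, map_pow, ha]
      exact hrad _ ⟨z, rfl⟩
    rw [← hm N, mul_comm, mul_smul, pow_add, h0, smul_zero]) with h0 | h0
  · left
    refine ⟨N, ?_⟩
    apply FaithfulSMul.eq_of_smul_eq_smul (α := V)
    intro v
    rw [LinearMap.range_eq_bot] at h0
    simpa using LinearMap.congr_fun h0 v
  · right
    refine IsUnit.of_mul_eq_one y ?_
    apply FaithfulSMul.eq_of_smul_eq_smul (α := V)
    intro v
    obtain ⟨z, rfl⟩ := LinearMap.range_eq_top.1 h0 v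
    simp only [LinearMap.lsmul_apply, smul_smul, one_mul]
    congr 1
    rw [Nat.succ_eq_add_one] at hy
    linear_combination hy

theorem bir_poly (y : A) (q : K[X]) (hq : Irreducible q) (k : ℕ) (hk : (aeval y q) ^ (k + 1) = 0)
    (r : K[X]) (hr : aeval y r ≠ 0) : ∃ b : K[X], aeval y b * aeval y r = (aeval y q) ^ k := by
  have hr0 : r ≠ 0 := by rintro rfl; simp at hr
  obtain ⟨n, r', hnd, rfl⟩ := WfDvdMonoid.max_power_factor hr0 hq
  have hcop : IsCoprime (q ^ (k + 1)) r' := ((hq.coprime_iff_not_dvd).2 hnd).pow_left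
  obtain ⟨α, β, hab⟩ := hcop
  have h1 := congrArg (aeval y) hab
  simp only [map_add, map_mul, map_pow, hk, mul_zero, zero_add, map_one] at h1
  have hn : n ≤ k := by
    by_contra hlt
    apply hr
    rw [map_mul, map_pow, pow_eq_zero_of_le (by omega) hk, zero_mul]
  refine ⟨β * q ^ (k - n), ?_⟩
  obtain ⟨m, rfl⟩ := Nat.exists_eq_add_of_le hn
  simp only [map_mul, map_pow, Nat.add_sub_cancel_left]
  linear_combination (aeval y q) ^ (n + m) * h1

theorem bir_nilp [Nontrivial A] (a : A) (ha : IsNilpotent a) : ∃ k, a ^ k ≠ 0 ∧ a ^ (k + 1) = 0 := by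
  classical
  have hk := Nat.find_spec ha
  have hpos : Nat.find ha ≠ 0 := by
    intro h0
    rw [h0, pow_zero] at hk
    exact one_ne_zero hk
  obtain ⟨k, hk'⟩ := Nat.exists_eq_succ_of_ne_zero hpos
  refine ⟨k, Nat.find_min ha (by omega), ?_⟩
  rwa [hk'] at hk

theorem bir_unip [FiniteDimensional K A] [Nontrivial A] (h : BirSetup B σ) (x y : A)
    (hxy : x * y = 1) (hσ : σ x = y) (hgen : ∀ a : A, ∃ p : K[X], aeval x p = a)
    (δ : K) (hδ : δ * δ = 1) (hn : IsNilpotent (x - algebraMap K A δ)) : BirGood B σ := by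
  obtain ⟨k, hk0, hk1⟩ := bir_nilp _ hn
  have hq : aeval x (X - C δ) = x - algebraMap K A δ := by simp
  have hmin : ∀ a : A, a ≠ 0 → ∃ b : A, b * a = (x - algebraMap K A δ) ^ k := by
    intro a ha
    obtain ⟨p, rfl⟩ := hgen a
    obtain ⟨b, hb⟩ := bir_poly x (X - C δ) (irreducible_X_sub_C δ) k (by rw [hq, hk1]) p ha
    exact ⟨_, by rw [hb, hq]⟩
  have hδA : algebraMap K A δ * algebraMap K A δ = 1 := by rw [← map_mul, hδ, map_one]
  set D := algebraMap K A δ with hD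
  have hxc : x * (x - D) ^ k = D * (x - D) ^ k := by
    rw [pow_succ] at hk1
    linear_combination hk1
  have hyc : y * (x - D) ^ k = D * (x - D) ^ k := by
    linear_combination (- y * D) * hxc + D * (x - D) ^ k * hxy - y * (x - D) ^ k * hδA
  have hσc : σ ((x - D) ^ k) = (-1) ^ k * (x - D) ^ k := by
    have e : σ (x - D) = (- D * y) * (x - D) := by
      rw [map_sub, hσ, hD, AlgHom.commutes, ← hD]
      linear_combination D * hxy - y * hδA
    have e2 : ∀ j, (D * y) ^ j * (x - D) ^ k = (x - D) ^ k := by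
      intro j
      induction j with
      | zero => simp
      | succ j ih =>
        rw [pow_succ]
        linear_combination ih + (D * y) ^ j * (D * hyc + (x - D) ^ k * hδA)
    rw [map_pow, e, mul_pow, neg_mul, neg_pow, mul_assoc, e2]
  rcases Nat.even_or_odd k with hk | hk
  · rw [hk.neg_one_pow, one_mul] at hσc
    refine bir_H1 h _ hk0 hσc fun a ha => ?_
    obtain ⟨b, hb⟩ := hmin a ha
    exact ⟨b, 0, by simpa using hb⟩
  · rw [hk.neg_one_pow, neg_one_mul] at hσc
    refine bir_H2 h _ hk0 hσc ?_ hmin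
    intro a
    obtain ⟨p, rfl⟩ := hgen a
    refine ⟨p.eval δ, ?_⟩
    obtain ⟨r, hr⟩ := X_sub_C_dvd_sub_C_eval (a := δ) (p := p)
    have := congrArg (aeval x) hr
    simp only [map_sub, map_mul, aeval_X, aeval_C, ← hD] at this
    rw [Algebra.smul_def]
    rw [pow_succ] at hk1
    linear_combination (x - D) ^ k * this + aeval x r * hk1

theorem bir_core [FiniteDimensional K A] [Nontrivial A] (h : BirSetup B σ) (x y : A)
    (hxy : x * y = 1) (hσ : σ x = y) (hgen : ∀ a : A, ∃ p : K[X], aeval x p = a) :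
    BirGood B σ := by
  have hσy : σ y = x := by rw [← hσ, h.invol]
  have h2 : σ 2 = 2 := map_ofNat σ 2
  rcases bir_fitting h (x + y - 2) (by rw [map_sub, map_add, hσ, hσy, h2, add_comm]) with hm | hm
  · refine bir_unip h x y hxy hσ hgen 1 (by simp) ?_
    obtain ⟨N, hN⟩ := hm
    refine ⟨2 * N, ?_⟩
    have : (x - algebraMap K A 1) ^ 2 = x * (x + y - 2) := by
      rw [map_one]; linear_combination - hxy
    rw [pow_mul, this, mul_pow, hN, mul_zero]
  rcases bir_fitting h (x + y + 2) (by rw [map_add, map_add, hσ, hσy, h2, add_comm x]) with hp | hp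
  · refine bir_unip h x y hxy hσ hgen (-1) (by simp) ?_
    obtain ⟨N, hN⟩ := hp
    refine ⟨2 * N, ?_⟩
    have : (x - algebraMap K A (-1)) ^ 2 = x * (x + y + 2) := by
      rw [map_neg, map_one]; linear_combination - hxy
    rw [pow_mul, this, mul_pow, hN, mul_zero]
  have hd2 : IsUnit ((x - y) * (x - y)) := by
    have : (x - y) * (x - y) = (x + y - 2) * (x + y + 2) := by linear_combination -4 * hxy
    rw [this]
    exact hm.mul hp
  set u := x + y with hu
  have hσu : ∀ p : K[X], σ (aeval u p) = aeval u p := by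
    intro p
    rw [← Polynomial.aeval_algHom_apply, hu, map_add, hσ, hσy, add_comm]
  have hint : IsIntegral K u := IsIntegral.of_finite K u
  obtain ⟨q, hqi, m', hqm⟩ := WfDvdMonoid.exists_irreducible_factor (minpoly.not_isUnit K u)
    (minpoly.ne_zero hint)
  have hqn : IsNilpotent (aeval u q) := by
    rcases bir_fitting h (aeval u q) (hσu q) with h0 | h0
    · exact h0
    · exfalso
      have h1 : aeval u m' = 0 := by
        have := minpoly.aeval K u
        rw [hqm, map_mul] at this
        exact (h0.mul_right_eq_zero).1 this
      have hm0 : m' ≠ 0 := by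
        rintro rfl
        exact minpoly.ne_zero hint (by rw [hqm, mul_zero])
      obtain ⟨e, he⟩ := minpoly.dvd K u h1
      apply hqi.not_isUnit
      refine IsUnit.of_mul_eq_one e ?_
      apply mul_left_cancel₀ hm0
      conv_rhs => rw [mul_one, he, hqm]
      ring
  obtain ⟨k, hk0, hk1⟩ := bir_nilp _ hqn
  have h2A : algebraMap K A 2⁻¹ * 2 = 1 := by
    rw [← map_ofNat (algebraMap K A) 2, ← map_mul, inv_mul_cancel₀ two_ne_zero, map_one]
  have hdec : ∀ p : K[X], ∃ r₁ r₂ : K[X], aeval x p = aeval u r₁ + (x - y) * aeval u r₂ := by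
    intro p
    induction p using Polynomial.induction_on' with
    | add p q hp hq =>
      obtain ⟨a, b, h1⟩ := hp
      obtain ⟨a', b', h2⟩ := hq
      exact ⟨a + a', b + b', by simp only [map_add]; linear_combination h1 + h2⟩
    | monomial n a =>
      induction n with
      | zero => exact ⟨C a, 0, by simp⟩
      | succ n ih =>
        obtain ⟨r, t, hrt⟩ := ih
        refine ⟨C 2⁻¹ * (X * r + (X ^ 2 - 4) * t), C 2⁻¹ * (r + X * t), ?_⟩
        rw [← monomial_mul_X, map_mul, hrt]
        simp only [map_mul, map_add, map_sub, map_pow, aeval_X, aeval_C, map_ofNat]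
        set i := algebraMap K A 2⁻¹
        rw [hu]
        linear_combination (-((aeval (x + y) r + (x - y) * aeval (x + y) t) * x)) * h2A
          - 4 * i * aeval (x + y) t * hxy
  refine bir_H1 h ((aeval u q) ^ k) hk0 (by rw [map_pow, hσu]) ?_
  intro a ha
  obtain ⟨p, rfl⟩ := hgen a
  obtain ⟨r₁, r₂, hr⟩ := hdec p
  have hrσ : σ (aeval x p) = aeval u r₁ - (x - y) * aeval u r₂ := by
    rw [hr, map_add, map_mul, hσu, hσu, map_sub, hσ, hσy]; ring
  rw [hrσ, hr]
  rw [hr] at ha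
  by_cases h1 : aeval u r₁ = 0
  · rw [h1, zero_add] at ha
    have h3 : aeval u ((X ^ 2 - 4) * r₂) ≠ 0 := by
      have e : aeval u ((X ^ 2 - 4) * r₂) = (x - y) * (x - y) * aeval u r₂ := by
        simp only [map_mul, map_sub, map_pow, aeval_X, map_ofNat]
        rw [hu]
        linear_combination 4 * aeval (x + y) r₂ * hxy
      rw [e]
      intro h0
      rw [(hd2.mul_right_eq_zero).1 h0, mul_zero] at ha
      exact ha rfl
    obtain ⟨b, hb⟩ := bir_poly u q hqi k hk1 _ h3
    refine ⟨aeval u b * (x - y), 0, ?_⟩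
    rw [← hb, h1]
    simp only [map_mul, map_sub, map_pow, aeval_X, map_ofNat]
    rw [hu]
    linear_combination -4 * aeval (x + y) b * aeval (x + y) r₂ * hxy
  · obtain ⟨b, hb⟩ := bir_poly u q hqi k hk1 _ h1
    refine ⟨algebraMap K A 2⁻¹ * aeval u b, algebraMap K A 2⁻¹ * aeval u b, ?_⟩
    rw [← hb]
    linear_combination aeval u b * aeval u r₁ * h2A

theorem bir_abs [FiniteDimensional K A] [Nontrivial V]
    (hsymm : ∀ u v, B u v = B v u) (hnd : ∀ u, (∀ v, B u v = 0) → u = 0)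
    (hindec : ∀ W : Submodule A V, (∀ w ∈ W, (∀ w' ∈ W, B w w' = 0) → w = 0) → W = ⊥ ∨ W = ⊤)
    (x : A) (hgen : ∀ a : A, ∃ p : K[X], aeval x p = a)
    (hx : ∀ u v, B (x • u) (x • v) = B u v) :
    ∃ s : V →ₗ[K] V, (∀ v, s (s v) = v) ∧ (∀ v, x • s (x • v) = s v) ∧
      ∀ u v, B (s u) (s v) = B u v := by
  have : IsArtinianRing A := IsArtinianRing.of_finite K A
  have : Nontrivial A := by
    by_contra hA
    rw [not_nontrivial_iff_subsingleton] at hA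
    obtain ⟨v, hv⟩ := exists_ne (0 : V)
    apply hv
    rw [← one_smul A v, Subsingleton.elim (1 : A) 0, zero_smul]
  have hxu : IsUnit x := by
    rw [IsArtinianRing.isUnit_iff_mem_nonZeroDivisors, mem_nonZeroDivisors_iff_right]
    intro a ha
    apply FaithfulSMul.eq_of_smul_eq_smul (α := V)
    intro u
    rw [zero_smul]
    apply hnd
    intro v
    rw [← hx, smul_smul, mul_comm, ha, zero_smul, map_zero, LinearMap.zero_apply]
  obtain ⟨y, hxy⟩ := hxu.exists_right_inv
  have hxadj : ∀ u v, B (x • u) v = B u (y • v) := by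
    intro u v
    rw [← hx u, smul_smul, hxy, one_smul]
  have hadj : ∀ a : A, ∃ a' : A, ∀ u v, B (a • u) v = B u (a' • v) := by
    intro a
    obtain ⟨p, rfl⟩ := hgen a
    refine ⟨aeval y p, ?_⟩
    induction p using Polynomial.induction_on' with
    | add p q hp hq => intro u v; simp [add_smul, hp, hq]
    | monomial n a =>
      have hpow : ∀ n : ℕ, ∀ u v, B (x ^ n • u) v = B u (y ^ n • v) := by
        intro n
        induction n with
        | zero => simp
        | succ n ih =>
          intro u v
          rw [pow_succ, mul_smul, ih, hxadj, smul_smul, ← pow_succ']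
      intro u v
      simp [aeval_monomial, mul_smul, hpow]
  choose σ hσ using hadj
  have huniq : ∀ a b : A, (∀ u v, B u (a • v) = B u (b • v)) → a = b := by
    intro a b hab
    apply FaithfulSMul.eq_of_smul_eq_smul (α := V)
    intro v
    rw [← sub_eq_zero]
    apply hnd
    intro u
    rw [hsymm, map_sub, hab, sub_self]
  let τ : A →ₐ[K] A :=
    { toFun := σ
      map_one' := huniq _ _ fun u v => by rw [← hσ, one_smul, one_smul]
      map_mul' := fun a b => huniq _ _ fun u v => by
        rw [← hσ, mul_comm, mul_smul, hσ, hσ, mul_smul]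
      map_zero' := huniq _ _ fun u v => by rw [← hσ]; simp
      map_add' := fun a b => huniq _ _ fun u v => by
        rw [← hσ, add_smul, add_smul, map_add, map_add, ← hσ, ← hσ, LinearMap.add_apply]
      commutes' := fun r => huniq _ _ fun u v => by rw [← hσ]; simp }
  have hS : BirSetup B τ :=
    { symm := hsymm
      nd := hnd
      adj := hσ
      invol := fun a => huniq _ _ fun u v => by
        change B u (σ (σ a) • v) = _
        rw [← hσ, hsymm, ← hσ, hsymm]
      indec := hindec }
  have hτx : τ x = y := huniq _ _ fun u v => by
    change B u (σ x • v) = _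
    rw [← hσ, hxadj]
  obtain ⟨s, h1, h2, h3⟩ := bir_core hS x y hxy hτx hgen
  refine ⟨s, h1, fun v => ?_, h3⟩
  rw [h2, hτx, smul_smul, hxy, one_smul]
end

theorem bir_end {K V : Type*} [Field K] [CharZero K] [AddCommGroup V] [Module K V]
    [FiniteDimensional K V] [Nontrivial V] (B : V →ₗ[K] V →ₗ[K] K)
    (hsymm : ∀ u v, B u v = B v u) (hnd : ∀ u, (∀ v, B u v = 0) → u = 0)
    (x : V →ₗ[K] V) (hx : ∀ u v, B (x u) (x v) = B u v)
    (hindec : ∀ W : Submodule K V, (∀ w ∈ W, x w ∈ W) →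
      (∀ w ∈ W, (∀ w' ∈ W, B w w' = 0) → w = 0) → W = ⊥ ∨ W = ⊤) :
    ∃ s : V →ₗ[K] V, (∀ v, s (s v) = v) ∧ (∀ v, x (s (x v)) = s v) ∧
      ∀ u v, B (s u) (s v) = B u v := by
  let x' : Module.End K V := x
  let S := Algebra.adjoin K {x'}
  let _ : CommRing S := Algebra.adjoinCommRingOfComm K (by
    intro a ha b hb
    rw [Set.mem_singleton_iff.1 ha, Set.mem_singleton_iff.1 hb])
  let xS : S := ⟨x', Algebra.self_mem_adjoin_singleton K x'⟩
  refine bir_abs (A := S) hsymm hnd ?_ xS ?_ hx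
  · intro W hW
    rcases hindec (W.restrictScalars K) (fun w hw => W.smul_mem xS hw) hW with h | h
    · left
      exact (Submodule.restrictScalars_eq_bot_iff K S V).1 h
    · right
      exact (Submodule.restrictScalars_eq_top_iff K S V).1 h
  · rintro ⟨a, ha⟩
    have ha' : a ∈ Algebra.adjoin K {x'} := ha
    rw [Algebra.adjoin_singleton_eq_range_aeval] at ha'
    obtain ⟨p, hp⟩ := ha'
    refine ⟨p, ?_⟩
    apply Subtype.ext
    exact (Polynomial.aeval_algHom_apply S.val xS p).symm.trans hp

theorem bir_main {K : Type*} [Field K] [CharZero K] (n : ℕ) :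
    ∀ {V : Type*} [AddCommGroup V] [Module K V]
    [FiniteDimensional K V] (_ : Module.finrank K V = n) (B : V →ₗ[K] V →ₗ[K] K)
    (_ : ∀ u v, B u v = B v u) (_ : ∀ u, (∀ v, B u v = 0) → u = 0)
    (x : V →ₗ[K] V) (_ : ∀ u v, B (x u) (x v) = B u v),
    ∃ s : V →ₗ[K] V, (∀ v, s (s v) = v) ∧ (∀ v, x (s (x v)) = s v) ∧
      ∀ u v, B (s u) (s v) = B u v := by
  induction n using Nat.strong_induction_on with
  | _ n ih =>
  intro V _ _ _ hn B hsymm hnd x hx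
  rcases subsingleton_or_nontrivial V with hV | hV
  · exact ⟨LinearMap.id, fun v => rfl, fun v => Subsingleton.elim _ _, fun u v => rfl⟩
  by_cases hindec : ∀ W : Submodule K V, (∀ w ∈ W, x w ∈ W) →
      (∀ w ∈ W, (∀ w' ∈ W, B w w' = 0) → w = 0) → W = ⊥ ∨ W = ⊤
  · exact bir_end B hsymm hnd x hx hindec
  push Not at hindec
  obtain ⟨W, hWx, hWnd, hW0, hW1⟩ := hindec
  have hxinj : ∀ v, x v = 0 → v = 0 := by
    intro v hv
    apply hnd
    intro w
    rw [← hx, hv, map_zero, LinearMap.zero_apply]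
  have hWsurj : ∀ w ∈ W, ∃ w' ∈ W, x w' = w := by
    intro w hw
    have hinj : Function.Injective (x.restrict hWx) := by
      rw [injective_iff_map_eq_zero]
      rintro ⟨v, hv⟩ h0
      exact Subtype.ext (hxinj v (congrArg Subtype.val h0))
    obtain ⟨w', hw'⟩ := LinearMap.injective_iff_surjective.1 hinj ⟨w, hw⟩
    exact ⟨w', w'.2, congrArg Subtype.val hw'⟩
  let U : Submodule K V :=
    { carrier := {u | ∀ w ∈ W, B u w = 0}
      add_mem' := fun {a b} ha hb w hw => by simp [ha w hw, hb w hw]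
      zero_mem' := fun w hw => by simp
      smul_mem' := fun c a ha w hw => by simp [ha w hw] }
  have hU : ∀ u, u ∈ U ↔ ∀ w ∈ W, B u w = 0 := fun u => Iff.rfl
  have hUx : ∀ u ∈ U, x u ∈ U := by
    intro u hu w hw
    obtain ⟨w', hw', rfl⟩ := hWsurj w hw
    rw [hx]
    exact hu w' hw'
  have hdisj : Disjoint W U := by
    rw [Submodule.disjoint_def]
    intro v hv hv'
    exact hWnd v hv hv'
  let T : W →ₗ[K] Module.Dual K W := B.domRestrict₁₂ W W
  have hT : ∀ a b : W, T a b = B a b := fun a b => rfl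
  have hTinj : Function.Injective T := by
    rw [injective_iff_map_eq_zero]
    rintro ⟨a, ha⟩ h0
    refine Subtype.ext (hWnd a ha fun w hw => ?_)
    exact LinearMap.congr_fun h0 ⟨w, hw⟩
  have hTsurj : Function.Surjective T :=
    (LinearMap.injective_iff_surjective_of_finrank_eq_finrank
      (Subspace.dual_finrank_eq (K := K) (V := W)).symm).1 hTinj
  have hcod : Codisjoint W U := by
    rw [codisjoint_iff, eq_top_iff]
    intro v _
    obtain ⟨a, ha⟩ := hTsurj ((B v).domRestrict W)
    rw [Submodule.mem_sup]
    refine ⟨a, a.2, v - a, ?_, by abel⟩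
    intro w hw
    have := LinearMap.congr_fun ha ⟨w, hw⟩
    rw [hT] at this
    rw [map_sub, LinearMap.sub_apply, this]
    exact sub_self _
  have hcompl : IsCompl W U := ⟨hdisj, hcod⟩
  have hdec : ∀ v, ∃ (a : W) (b : U), (a : V) + b = v := by
    intro v
    have : v ∈ W ⊔ U := by rw [hcompl.sup_eq_top]; trivial
    obtain ⟨a, ha, b, hb, rfl⟩ := Submodule.mem_sup.1 this
    exact ⟨⟨a, ha⟩, ⟨b, hb⟩, rfl⟩
  have hWlt : Module.finrank K W < n := hn ▸ Submodule.finrank_lt hW1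
  have hUlt : Module.finrank K U < n := by
    rw [← hn]
    apply Submodule.finrank_lt
    intro h0
    rw [h0, disjoint_top] at hdisj
    exact hW0 hdisj
  have hWU : ∀ (a : W) (b : U), B a b = 0 := fun a b => by rw [hsymm]; exact b.2 a a.2
  have hUW : ∀ (a : W) (b : U), B b a = 0 := fun a b => b.2 a a.2
  obtain ⟨s₁, h11, h12, h13⟩ := ih _ hWlt rfl T (fun a b => hsymm a b)
    (fun a ha => Subtype.ext (hWnd a a.2 fun w hw => ha ⟨w, hw⟩)) (x.restrict hWx)
    (fun a b => hx a b)
  obtain ⟨s₂, h21, h22, h23⟩ := ih _ hUlt rfl (B.domRestrict₁₂ U U) (fun a b => hsymm a b)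
    (fun a ha => Subtype.ext (hnd a fun v => by
      obtain ⟨w, b, rfl⟩ := hdec v
      rw [map_add, hUW, zero_add]
      exact ha b)) (x.restrict hUx)
    (fun a b => hx a b)
  let s : V →ₗ[K] V := LinearMap.ofIsCompl hcompl (W.subtype ∘ₗ s₁) (U.subtype ∘ₗ s₂)
  have hs : ∀ (a : W) (b : U), s (a + b) = (s₁ a : V) + s₂ b := by
    intro a b
    simp [s, map_add]
  have hxx : ∀ (a : W) (b : U), x (a + b) = (x.restrict hWx a : V) + x.restrict hUx b := by
    intro a b
    rw [map_add]; rfl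
  refine ⟨s, ?_, ?_, ?_⟩
  · intro v
    obtain ⟨a, b, rfl⟩ := hdec v
    rw [hs, hs, h11, h21]
  · intro v
    obtain ⟨a, b, rfl⟩ := hdec v
    rw [hxx, hs, hxx, h12, h22, hs]
  · intro u v
    obtain ⟨a, b, rfl⟩ := hdec u
    obtain ⟨a', b', rfl⟩ := hdec v
    rw [hs, hs]
    simp only [map_add, LinearMap.add_apply, hWU, hUW]
    have e1 : B (s₁ a) (s₁ a') = B a a' := h13 a a'
    have e2 : B (s₂ b) (s₂ b') = B b b' := h23 b b'
    rw [e1, e2]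

/-- Bireflectionality of orthogonal groups: every isometry of a nondegenerate symmetric
bilinear form on a finite-dimensional vector space over a field of characteristic zero
is a product of two involutive isometries. -/
theorem stmt2 (K : Type*) [Field K] [CharZero K]
    (V : Type*) [AddCommGroup V] [Module K V] [FiniteDimensional K V]
    (B : V →ₗ[K] V →ₗ[K] K)
    (hsymm : ∀ u v : V, B u v = B v u)
    (hnd : ∀ u : V, (∀ v : V, B u v = 0) → u = 0)
    (x : V ≃ₗ[K] V) (hx : ∀ u v : V, B (x u) (x v) = B u v) :
    ∃ s t : V ≃ₗ[K] V,
      (∀ u v : V, B (s u) (s v) = B u v) ∧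
      (∀ u v : V, B (t u) (t v) = B u v) ∧
      s * s = 1 ∧ t * t = 1 ∧ x = s * t := by
  obtain ⟨s, h1, h2, h3⟩ := bir_main _ rfl B hsymm hnd x.toLinearMap hx
  let S : V ≃ₗ[K] V := LinearEquiv.ofInvolutive s h1
  have hS : ∀ v, S v = s v := fun v => rfl
  have h2' : ∀ v, x (s (x v)) = s v := h2
  refine ⟨S, S * x, h3, fun u v => ?_, ?_, ?_, ?_⟩
  · rw [LinearEquiv.mul_apply, LinearEquiv.mul_apply, hS, hS, h3, hx]
  · ext v
    simp [hS, h1]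
  · ext v
    simp [hS, h1, h2']
  · ext v
    simp [hS, h1]
end

section
/- Let K be a field of characteristic zero, V a finite-dimensional K-vector space, and ω a nondegenerate alternating bilinear form on V. Let g be a linear automorphism of V which is anti-symplectic, i.e. ω(g u, g v) = -ω(u, v) for all u, v ∈ V. Then for every symplectic transformation x of (V, ω): (i) g ∘ x ∘ g⁻¹ is again a symplectic transformation, and (ii) there exists a symplectic transformation c of (V, ω) with c ∘ (g ∘ x ∘ g⁻¹) ∘ c⁻¹ = x⁻¹. (This is the symplectic-group instance of the classical fact that ğxğ⁻¹ is conjugate to x⁻¹ inside U(E) for ğ ∈ Ŭ(E)∖U(E).) -/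
namespace AntiSymp

open Polynomial LaurentPolynomial

section

variable {K : Type*} [Field K] {V : Type*} [AddCommGroup V] [Module K V]

lemma E_mul (E : LaurentPolynomial K →ₐ[K] Module.End K V) (f g : LaurentPolynomial K) (v : V) :
    E (f * g) v = E f (E g v) := by
  rw [map_mul]; rfl

lemma E_comm (E : LaurentPolynomial K →ₐ[K] Module.End K V) (f g : LaurentPolynomial K) (v : V) :
    E f (E g v) = E g (E f v) := by
  rw [← E_mul, ← E_mul, mul_comm]

lemma E_one (E : LaurentPolynomial K →ₐ[K] Module.End K V) (v : V) :
    E 1 v = v := by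
  rw [map_one]; rfl

/-- `U` is a nondegenerate subspace on which an anti-isometry inverting the action exists
(given through its graph). -/
def Gd (ω : V →ₗ[K] V →ₗ[K] K) (E : LaurentPolynomial K →ₐ[K] Module.End K V)
    (U : Submodule K V) : Prop :=
  ∃ Γ : Submodule K (V × V),
    (∀ a ∈ Γ, ∀ b ∈ Γ, ω a.2 b.2 = -ω a.1 b.1) ∧
    (∀ f, ∀ a ∈ Γ, (E f a.1, E (invert f) a.2) ∈ Γ) ∧
    Γ.map (LinearMap.fst K V V) = U ∧ Γ.map (LinearMap.snd K V V) = U ∧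
    ∀ u ∈ U, (∀ u' ∈ U, ω u u' = 0) → u = 0

lemma skew {ω : V →ₗ[K] V →ₗ[K] K} (halt : ∀ u : V, ω u u = 0) (u v : V) :
    ω u v = - ω v u := by
  have h := halt (u + v)
  simp only [map_add, LinearMap.add_apply, halt] at h
  linear_combination h

lemma Gd.inv {ω : V →ₗ[K] V →ₗ[K] K} {E : LaurentPolynomial K →ₐ[K] Module.End K V}
    {U : Submodule K V} (h : Gd ω E U) (f : LaurentPolynomial K) {u : V} (hu : u ∈ U) :
    E f u ∈ U := by
  obtain ⟨Γ, -, h2, h3, -, -⟩ := h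
  rw [← h3] at hu ⊢
  obtain ⟨a, ha, rfl⟩ := hu
  exact ⟨_, h2 f a ha, rfl⟩

lemma Gd.bot (ω : V →ₗ[K] V →ₗ[K] K) (E : LaurentPolynomial K →ₐ[K] Module.End K V) :
    Gd ω E ⊥ := by
  refine ⟨⊥, ?_, ?_, ?_, ?_, ?_⟩
  · rintro a ha b hb
    rw [Submodule.mem_bot] at ha hb
    simp [ha, hb]
  · rintro f a ha
    rw [Submodule.mem_bot] at ha
    simp [ha]
  · simp
  · simp
  · intro u hu _
    simpa using hu

lemma Gd.sup {ω : V →ₗ[K] V →ₗ[K] K} (halt : ∀ u : V, ω u u = 0)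
    {E : LaurentPolynomial K →ₐ[K] Module.End K V}
    {U U' : Submodule K V} (h : Gd ω E U) (h' : Gd ω E U')
    (hp : ∀ u ∈ U, ∀ u' ∈ U', ω u u' = 0) : Gd ω E (U ⊔ U') := by
  obtain ⟨Γ, h1, h2, h3, h4, h5⟩ := h
  obtain ⟨Γ', h1', h2', h3', h4', h5'⟩ := h'
  have hp' : ∀ u ∈ U, ∀ u' ∈ U', ω u' u = 0 := by
    intro u hu u' hu'
    rw [skew halt, hp u hu u' hu', neg_zero]
  have m1 : ∀ a ∈ Γ, a.1 ∈ U := fun a ha => by rw [← h3]; exact ⟨a, ha, rfl⟩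
  have m2 : ∀ a ∈ Γ, a.2 ∈ U := fun a ha => by rw [← h4]; exact ⟨a, ha, rfl⟩
  have m1' : ∀ a ∈ Γ', a.1 ∈ U' := fun a ha => by rw [← h3']; exact ⟨a, ha, rfl⟩
  have m2' : ∀ a ∈ Γ', a.2 ∈ U' := fun a ha => by rw [← h4']; exact ⟨a, ha, rfl⟩
  refine ⟨Γ ⊔ Γ', ?_, ?_, ?_, ?_, ?_⟩
  · intro a ha b hb
    obtain ⟨a1, ha1, a2, ha2, rfl⟩ := Submodule.mem_sup.1 ha
    obtain ⟨b1, hb1, b2, hb2, rfl⟩ := Submodule.mem_sup.1 hb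
    simp only [Prod.fst_add, Prod.snd_add, map_add, LinearMap.add_apply]
    rw [h1 a1 ha1 b1 hb1, h1' a2 ha2 b2 hb2, hp _ (m1 a1 ha1) _ (m1' b2 hb2),
      hp _ (m2 a1 ha1) _ (m2' b2 hb2), hp' _ (m1 b1 hb1) _ (m1' a2 ha2),
      hp' _ (m2 b1 hb1) _ (m2' a2 ha2)]
    ring
  · intro f a ha
    obtain ⟨a1, ha1, a2, ha2, rfl⟩ := Submodule.mem_sup.1 ha
    refine Submodule.mem_sup.2 ⟨_, h2 f a1 ha1, _, h2' f a2 ha2, ?_⟩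
    simp
  · rw [Submodule.map_sup, h3, h3']
  · rw [Submodule.map_sup, h4, h4']
  · intro u hu h0
    obtain ⟨a, ha, b, hb, rfl⟩ := Submodule.mem_sup.1 hu
    have e1 : a = 0 := by
      refine h5 a ha fun u' hu' => ?_
      have := h0 u' (Submodule.mem_sup_left hu')
      rwa [map_add, LinearMap.add_apply, hp' u' hu' b hb, add_zero] at this
    have e2 : b = 0 := by
      refine h5' b hb fun u' hu' => ?_
      have := h0 u' (Submodule.mem_sup_right hu')
      rwa [map_add, LinearMap.add_apply, hp a ha u' hu', zero_add] at this
    rw [e1, e2, add_zero]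

/-- The orbit map. -/
noncomputable def orb (E : LaurentPolynomial K →ₐ[K] Module.End K V) (v : V) :
    LaurentPolynomial K →ₗ[K] V :=
  (LinearMap.applyₗ v).comp E.toLinearMap

@[simp] lemma orb_apply (E : LaurentPolynomial K →ₐ[K] Module.End K V) (v : V)
    (f : LaurentPolynomial K) : orb E v f = E f v := rfl

lemma inv_inv' (f : LaurentPolynomial K) : invert (invert f) = f := involutive_invert f

lemma adj_key {ω : V →ₗ[K] V →ₗ[K] K} (halt : ∀ u : V, ω u u = 0)
    {E : LaurentPolynomial K →ₐ[K] Module.End K V}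
    (hE : ∀ f u v, ω (E f u) v = ω u (E (invert f) v)) (f g : LaurentPolynomial K) (a b : V) :
    ω (E (invert f) a) (E (invert g) b) = - ω (E f b) (E g a) := by
  rw [hE, inv_inv', skew halt, E_comm, hE, inv_inv']

lemma gd_cyclic {ω : V →ₗ[K] V →ₗ[K] K} (halt : ∀ u : V, ω u u = 0)
    {E : LaurentPolynomial K →ₐ[K] Module.End K V}
    (hE : ∀ f u v, ω (E f u) v = ω u (E (invert f) v)) (v : V)
    (hv : ∀ f, E f v ≠ 0 → ∃ g, ω (E f v) (E g v) ≠ 0) :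
    Gd ω E (LinearMap.range (orb E v)) := by
  refine ⟨LinearMap.range ((orb E v).prod ((orb E v).comp (invert (R := K)).toLinearMap)),
    ?_, ?_, ?_, ?_, ?_⟩
  · rintro _ ⟨f, rfl⟩ _ ⟨g, rfl⟩
    simp only [LinearMap.prod_apply, Function.prod_apply, LinearMap.comp_apply, orb_apply,
      AlgEquiv.toLinearMap_apply]
    exact adj_key halt hE f g v v
  · rintro h _ ⟨f, rfl⟩
    refine ⟨h * f, ?_⟩
    simp [map_mul]
  · rw [← LinearMap.range_comp, LinearMap.fst_prod]
  · rw [← LinearMap.range_comp, LinearMap.snd_prod, LinearMap.range_comp]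
    rw [LinearMap.range_eq_top.2 (invert (R := K)).surjective, Submodule.map_top]
  · rintro _ ⟨f, rfl⟩ h
    by_contra hne
    obtain ⟨g, hg⟩ := hv f hne
    exact hg (h _ ⟨g, rfl⟩)

lemma gd_two {ω : V →ₗ[K] V →ₗ[K] K} (halt : ∀ u : V, ω u u = 0)
    {E : LaurentPolynomial K →ₐ[K] Module.End K V}
    (hE : ∀ f u v, ω (E f u) v = ω u (E (invert f) v)) (v w : V)
    (hvv : ∀ f, ω (E f v) v = 0) (hww : ∀ f, ω (E f w) w = 0)
    (hv : ∀ f, E f v ≠ 0 → ∃ g, ω (E f v) (E g w) ≠ 0)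
    (hw : ∀ f, E f w ≠ 0 → ∃ g, ω (E f w) (E g v) ≠ 0) :
    Gd ω E (LinearMap.range ((orb E v).coprod (orb E w))) := by
  have hvv' : ∀ f g, ω (E f v) (E g v) = 0 := fun f g => by
    rw [← inv_inv' g, ← hE, ← E_mul, hvv]
  have hww' : ∀ f g, ω (E f w) (E g w) = 0 := fun f g => by
    rw [← inv_inv' g, ← hE, ← E_mul, hww]
  have key := adj_key halt hE
  refine ⟨LinearMap.range (((orb E v).coprod (orb E w)).prod
    (((orb E w).comp (invert (R := K)).toLinearMap).coprod
      ((orb E v).comp (invert (R := K)).toLinearMap))),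
    ?_, ?_, ?_, ?_, ?_⟩
  · rintro _ ⟨⟨f, f'⟩, rfl⟩ _ ⟨⟨g, g'⟩, rfl⟩
    simp only [LinearMap.prod_apply, Function.prod_apply, LinearMap.comp_apply, orb_apply,
      AlgEquiv.toLinearMap_apply, LinearMap.coprod_apply, map_add, LinearMap.add_apply,
      hvv', hww']
    rw [key, key]
    ring
  · rintro h _ ⟨⟨f, f'⟩, rfl⟩
    refine ⟨⟨h * f, h * f'⟩, ?_⟩
    simp [map_mul]
  · rw [← LinearMap.range_comp, LinearMap.fst_prod]
  · rw [← LinearMap.range_comp, LinearMap.snd_prod, LinearMap.range_coprod, LinearMap.range_coprod,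
      LinearMap.range_comp, LinearMap.range_comp]
    rw [LinearMap.range_eq_top.2 (invert (R := K)).surjective, Submodule.map_top, Submodule.map_top,
      sup_comm]
  · rintro _ ⟨⟨f, f'⟩, rfl⟩ h
    simp only [LinearMap.coprod_apply, orb_apply] at h ⊢
    have e1 : E f v = 0 := by
      by_contra hne
      obtain ⟨g, hg⟩ := hv f hne
      have := h _ ⟨⟨0, g⟩, rfl⟩
      simp [hww'] at this
      exact hg this
    have e2 : E f' w = 0 := by
      by_contra hne
      obtain ⟨g, hg⟩ := hw f' hne
      have := h _ ⟨⟨g, 0⟩, rfl⟩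
      simp [hvv'] at this
      exact hg this
    rw [e1, e2, add_zero]

/-- `K[x] v` is uniserial when `v` is killed by a power of an irreducible. -/
lemma uniserial (E : LaurentPolynomial K →ₐ[K] Module.End K V) {p : K[X]} (hp : Irreducible p)
    (k : ℕ) (v : V) (hv : E (toLaurent p ^ (k + 1)) v = 0) (f : LaurentPolynomial K)
    (hf : E f v ≠ 0) : ∃ g, E (g * f) v = E (toLaurent p ^ k) v := by
  classical
  obtain ⟨n, f', hf'⟩ := f.exists_T_pow
  obtain ⟨a, b, hab⟩ : ∃ a b, EuclideanDomain.gcd f' (p ^ (k + 1)) = f' * a + p ^ (k + 1) * b :=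
    ⟨_, _, EuclideanDomain.gcd_eq_gcd_ab _ _⟩
  set d := EuclideanDomain.gcd f' (p ^ (k + 1)) with hd
  have hE : ∀ c, E (toLaurent (d * c)) v = E (toLaurent (a * c) * T n * f) v := by
    intro c
    have : toLaurent (d * c) = toLaurent (a * c) * T n * f
        + toLaurent (b * c) * toLaurent p ^ (k + 1) := by
      rw [hab]
      simp only [map_mul, map_add, map_pow, hf']
      ring
    rw [this, map_add, LinearMap.add_apply, E_mul E (toLaurent (b * c)), hv, map_zero, add_zero]
  obtain ⟨j, hj, hdj⟩ := (dvd_prime_pow hp.prime _).1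
    (EuclideanDomain.gcd_dvd_right f' (p ^ (k + 1)))
  rw [← hd] at hdj
  obtain ⟨u, hu⟩ := hdj
  rcases Nat.lt_or_ge k j with h | h
  · exfalso
    have hjk : j = k + 1 := by omega
    obtain ⟨c, hc⟩ := EuclideanDomain.gcd_dvd_left f' (p ^ (k + 1))
    rw [← hd] at hc
    have hd' : d = p ^ (k + 1) * (↑(u⁻¹) : K[X]) := by
      rw [← hjk, ← hu, mul_assoc, Units.mul_inv, mul_one]
    have h1 : f = (T (-n) * toLaurent c * toLaurent (↑(u⁻¹) : K[X])) * toLaurent p ^ (k + 1) := by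
      have : f = T (-n) * toLaurent f' := by
        rw [hf', mul_comm f, ← mul_assoc, ← T_add]; simp
      rw [this, hc, hd']
      simp only [map_mul, map_pow]
      ring
    apply hf
    rw [h1, E_mul, hv, map_zero]
  · refine ⟨toLaurent (a * ((u : K[X]) * p ^ (k - j))) * T n, ?_⟩
    rw [← hE, ← mul_assoc, hu, ← pow_add, Nat.add_sub_cancel' h, map_pow]

lemma exists_primary [FiniteDimensional K V] (E : LaurentPolynomial K →ₐ[K] Module.End K V)
    (W : Submodule K V) (hW : ∀ f, ∀ w ∈ W, E f w ∈ W) (hW0 : W ≠ ⊥) :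
    ∃ (p q : K[X]) (k : ℕ), p.Monic ∧ Irreducible p ∧ IsCoprime p q ∧
      (∀ w ∈ W, E (toLaurent p ^ (k + 1) * toLaurent q) w = 0) ∧
      ∃ v ∈ W, E (toLaurent p ^ (k + 1)) v = 0 ∧ E (toLaurent p ^ k) v ≠ 0 := by
  have : Nontrivial W := Submodule.nontrivial_iff_ne_bot.2 hW0
  let ψ : Module.End K W := (E (T 1)).restrict (hW (T 1))
  have hψ : ∀ (f : K[X]) (w : W), ((aeval ψ f w : W) : V) = E (toLaurent f) w := by
    intro f
    induction f using Polynomial.induction_on' with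
    | add p q hp hq => intro w; simp [hp, hq]
    | monomial n a =>
      intro w
      rw [← Polynomial.C_mul_X_pow_eq_monomial]
      simp only [map_mul, map_pow, aeval_X, aeval_C, toLaurent_C, toLaurent_X,
        Module.End.mul_apply, Module.algebraMap_end_apply, Submodule.coe_smul]
      rw [show (LaurentPolynomial.C a : LaurentPolynomial K) = algebraMap K _ a from rfl,
        AlgHom.commutes, Module.algebraMap_end_apply]
      congr 1
      induction n generalizing w with
      | zero => simp
      | succ n ih => simp only [pow_succ, Module.End.mul_apply, ih]; rfl
  have hψint : IsIntegral K ψ := Algebra.IsIntegral.isIntegral ψ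
  obtain ⟨p, hpm, hp, hpd⟩ := Polynomial.exists_monic_irreducible_factor (minpoly K ψ)
    (minpoly.not_isUnit K ψ)
  obtain ⟨q, hq, hpq⟩ := (FiniteMultiplicity.of_prime_left hp.prime
    (minpoly.ne_zero hψint)).exists_eq_pow_mul_and_not_dvd
  obtain ⟨k, hk⟩ : ∃ k, multiplicity p (minpoly K ψ) = k + 1 := by
    refine Nat.exists_eq_succ_of_ne_zero fun h0 => hpq ?_
    rw [h0, pow_zero, one_mul] at hq
    rwa [← hq]
  rw [hk] at hq
  have hkill : ∀ w ∈ W, E (toLaurent p ^ (k + 1) * toLaurent q) w = 0 := by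
    intro w hw
    have := hψ (minpoly K ψ) ⟨w, hw⟩
    rw [minpoly.aeval, hq] at this
    simpa using this.symm
  refine ⟨p, q, k, hpm, hp, hp.coprime_iff_not_dvd.2 hpq, hkill, ?_⟩
  have hne : aeval ψ (p ^ k * q) ≠ 0 := by
    apply minpoly.aeval_ne_zero_of_dvdNotUnit_minpoly hψint
    · refine Polynomial.Monic.of_mul_monic_left hpm ?_
      rw [← mul_assoc, ← pow_succ', ← hq]
      exact minpoly.monic hψint
    · refine ⟨?_, p, hp.not_isUnit, ?_⟩
      · intro h0
        apply minpoly.ne_zero hψint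
        rw [hq, pow_succ', mul_assoc, h0, mul_zero]
      · rw [hq]; ring
  obtain ⟨w, hw⟩ : ∃ w, aeval ψ (p ^ k * q) w ≠ 0 := by
    by_contra! h
    exact hne (LinearMap.ext h)
  refine ⟨E (toLaurent q) w, hW _ _ w.2, ?_, ?_⟩
  · rw [← E_mul]; exact hkill w w.2
  · rw [← E_mul]
    intro h0
    apply hw
    apply Subtype.ext
    rw [hψ]
    simpa using h0

/-- Making a vector totally isotropic (unipotent case). -/
lemma isotropize [CharZero K] {ω : V →ₗ[K] V →ₗ[K] K} (halt : ∀ u : V, ω u u = 0)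
    {E : LaurentPolynomial K →ₐ[K] Module.End K V}
    (hE : ∀ f u v, ω (E f u) v = ω u (E (invert f) v))
    (P : Submodule K V) (hP : ∀ f, ∀ u ∈ P, E f u ∈ P)
    (N : LaurentPolynomial K) (hN : invert N = -N)
    (hr : ∀ r, ∃ (c : K) (r' : LaurentPolynomial K), ∀ u ∈ P, E r u = c • u + E (r' * N) u)
    (k : ℕ) (hk : Even k) (hkill : ∀ u ∈ P, E (N ^ (k + 1)) u = 0)
    (v w : V) (hv : v ∈ P) (hw : w ∈ P) (hvw : ω (E (N ^ k) v) w ≠ 0) :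
    ∃ v' ∈ P, ω (E (N ^ k) v') w ≠ 0 ∧ ∀ f, ω (E f v') v' = 0 := by
  have hkill' : ∀ f j, k + 1 ≤ j → ∀ u ∈ P, E (f * N ^ j) u = 0 := by
    intro f j hj u hu
    obtain ⟨i, rfl⟩ := Nat.exists_eq_add_of_le hj
    rw [pow_add, mul_comm (N ^ (k + 1)), ← mul_assoc, E_mul, hkill u hu, map_zero]
  have hadj : ∀ j a b, ω a (E (N ^ j) b) = (-1) ^ j * ω (E (N ^ j) a) b := by
    intro j a b
    rw [hE, map_pow invert N, hN]
    rcases Nat.even_or_odd j with hj | hj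
    · rw [hj.neg_pow N, hj.neg_one_pow, one_mul]
    · rw [hj.neg_pow N, hj.neg_one_pow, map_neg, LinearMap.neg_apply, map_neg]; ring
  have main : ∀ j i, i + j = k + 1 → ∃ v' ∈ P, ω (E (N ^ k) v') w ≠ 0 ∧
      ∀ f, ω (E (f * N ^ i) v') v' = 0 := by
    intro j
    induction j with
    | zero =>
      intro i hi
      refine ⟨v, hv, hvw, fun f => ?_⟩
      rw [hkill' f i (by omega) v hv, map_zero, LinearMap.zero_apply]
    | succ j ih =>
      intro i hi
      obtain ⟨v, hv, hvw, h1⟩ := ih (i + 1) (by omega)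
      -- it suffices to kill the leading coefficient
      suffices h : ∃ v' ∈ P, ω (E (N ^ k) v') w ≠ 0 ∧ (∀ f, ω (E (f * N ^ (i + 1)) v') v' = 0) ∧
          ω (E (N ^ i) v') v' = 0 by
        obtain ⟨v', hv', h2, h3, h4⟩ := h
        refine ⟨v', hv', h2, fun f => ?_⟩
        obtain ⟨c, r', hcr⟩ := hr f
        rw [E_mul, hcr _ (hP _ _ hv'), ← E_mul, mul_assoc, ← pow_succ', map_add,
          LinearMap.add_apply, h3, map_smul, LinearMap.smul_apply, h4, smul_zero, add_zero]
      rcases Nat.even_or_odd i with hi2 | hi2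
      · refine ⟨v, hv, hvw, h1, ?_⟩
        have e1 := hadj i v v
        rw [hi2.neg_one_pow, one_mul, skew halt] at e1
        have : (2 : K) * ω (E (N ^ i) v) v = 0 := by linear_combination -e1
        simpa using this
      · have hij : i + j = k := by omega
        have hj2 : Odd j := by
          rw [← hij] at hk
          by_contra h
          rw [Nat.not_odd_iff_even] at h
          exact (Nat.not_even_iff_odd.2 hi2) ((Nat.even_add.1 hk).2 h)
        have hj1 : 1 ≤ j := hj2.pos
        set d := ω (E (N ^ k) v) w with hd
        set c := ω (E (N ^ i) v) v with hc
        have q1 : ω (E (N ^ i) v) (E (N ^ j) w) = -d := by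
          rw [hadj, hj2.neg_one_pow, ← E_mul, ← pow_add, add_comm j, hij]; ring
        have q2 : ω (E (N ^ i) (E (N ^ j) w)) v = -d := by
          rw [← E_mul, ← pow_add, hij, skew halt, hadj, hk.neg_one_pow, one_mul]
        have q3 : ω (E (N ^ i) (E (N ^ j) w)) (E (N ^ j) w) = 0 := by
          have : E (N ^ j) (E (N ^ i) (E (N ^ j) w)) = 0 := by
            simp only [← E_mul, ← pow_add]
            rw [← one_mul (N ^ _), hkill' 1 _ (by omega) w hw]
          rw [hadj, this, map_zero, LinearMap.zero_apply, mul_zero]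
        refine ⟨v + (c / (2 * d)) • E (N ^ j) w, ?_, ?_, ?_, ?_⟩
        · exact P.add_mem hv (P.smul_mem _ (hP _ _ hw))
        · rw [map_add, map_smul, ← E_mul, ← pow_add, ← one_mul (N ^ (k + j)),
            hkill' 1 (k + j) (by omega) w hw, smul_zero, add_zero]
          exact hvw
        · intro f
          have z1 : E (f * N ^ (i + 1)) (E (N ^ j) w) = 0 := by
            rw [← E_mul, mul_assoc, ← pow_add, hkill' f _ (by omega) w hw]
          have z2 : ω (E (f * N ^ (i + 1)) v) (E (N ^ j) w) = 0 := by
            rw [hadj, ← E_mul, mul_left_comm, ← pow_add, hkill' f _ (by omega) v hv]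
            simp
          simp only [map_add, map_smul, z1, z2, h1, LinearMap.add_apply]
          simp
        · simp only [map_add, map_smul, LinearMap.add_apply, LinearMap.smul_apply, q1, q2, q3,
            smul_eq_mul, ← hc]
          have hd0 : d ≠ 0 := hvw
          field_simp
          ring
  obtain ⟨v', h1, h2, h3⟩ := main (k + 1) 0 (by omega)
  exact ⟨v', h1, h2, fun f => by simpa using h3 f⟩

lemma inv_dvd {p : K[X]} (hp : p ∣ p.reverse) :
    ∃ c, invert (toLaurent p) = c * toLaurent p := by
  obtain ⟨c, hc⟩ := hp
  have h := toLaurent_reverse p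
  refine ⟨T (-p.natDegree) * toLaurent c, ?_⟩
  have : invert (toLaurent p) = invert (toLaurent p) * T p.natDegree * T (-p.natDegree) := by
    rw [mul_assoc, ← T_add]; simp
  rw [this, ← h, hc, map_mul]
  ring

lemma dvd_sub_C {ε : K} (hε : ε * ε = 1) (r : LaurentPolynomial K) :
    ∃ (c : K) (g : LaurentPolynomial K),
      r = LaurentPolynomial.C c + g * (T 1 - LaurentPolynomial.C ε) := by
  have hC : (LaurentPolynomial.C ε : LaurentPolynomial K) * LaurentPolynomial.C ε = 1 := by
    rw [← map_mul, hε, map_one]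
  have hT : (T 1 : LaurentPolynomial K) * T (-1) = 1 := by rw [← T_add]; simp
  induction r using LaurentPolynomial.induction_on with
  | h_C a => exact ⟨a, 0, by simp⟩
  | h_add h1 h2 =>
    obtain ⟨c, g, h⟩ := h1
    obtain ⟨c', g', h'⟩ := h2
    exact ⟨c + c', g + g', by rw [h, h', map_add]; ring⟩
  | h_C_mul_T n a ih =>
    obtain ⟨c, g, h⟩ := ih
    refine ⟨c * ε, LaurentPolynomial.C c + g * T 1, ?_⟩
    rw [T_add, ← mul_assoc, h, map_mul]; ring
  | h_C_mul_T_Z n a ih =>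
    obtain ⟨c, g, h⟩ := ih
    refine ⟨c * ε, - (LaurentPolynomial.C c * LaurentPolynomial.C ε * T (-1)) + g * T (-1), ?_⟩
    rw [sub_eq_add_neg, T_add, ← mul_assoc, h, map_mul]
    linear_combination (- LaurentPolynomial.C c * T (-1)) * hC
      + (LaurentPolynomial.C c * LaurentPolynomial.C ε) * hT

lemma piece [CharZero K] [FiniteDimensional K V] {ω : V →ₗ[K] V →ₗ[K] K}
    (halt : ∀ u : V, ω u u = 0) {E : LaurentPolynomial K →ₐ[K] Module.End K V}
    (hE : ∀ f u v, ω (E f u) v = ω u (E (invert f) v))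
    (W : Submodule K V) (hW : ∀ f, ∀ w ∈ W, E f w ∈ W) (hW0 : W ≠ ⊥)
    (hnd : ∀ w ∈ W, (∀ w' ∈ W, ω w w' = 0) → w = 0) :
    ∃ U ≤ W, U ≠ ⊥ ∧ Gd ω E U := by
  obtain ⟨p, q, k, hpm, hp, hpq, hkill, v, hvW, hv1, hv2⟩ := exists_primary E W hW hW0
  set P := toLaurent p with hPdef
  set Q := toLaurent q with hQdef
  have hcyc : ∀ v ∈ W, LinearMap.range (orb E v) ≤ W := by
    rintro v hv _ ⟨f, rfl⟩
    exact hW f v hv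
  have hmem : ∀ v, v ∈ LinearMap.range (orb E v) := fun v => ⟨1, by simp⟩
  have hv0 : v ≠ 0 := by rintro rfl; simp at hv2
  -- existence of dual vectors
  have hdual : ∀ z ∈ W, E (P ^ (k + 1)) z = 0 → z ≠ 0 →
      ∃ w ∈ W, E (invert P ^ (k + 1)) w = 0 ∧ ω z w ≠ 0 := by
    intro z hz hz1 hz0
    obtain ⟨w0, hw0, hzw⟩ : ∃ w0 ∈ W, ω z w0 ≠ 0 := by
      by_contra! h
      exact hz0 (hnd z hz h)
    obtain ⟨a, b, hab⟩ := (hpq.pow_left (m := k + 1))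
    have hab' : toLaurent a * P ^ (k + 1) + toLaurent b * Q = 1 := by
      rw [hPdef, hQdef, ← map_pow, ← map_mul, ← map_mul, ← map_add, hab, map_one]
    refine ⟨E (invert (toLaurent b * Q)) w0, hW _ _ hw0, ?_, ?_⟩
    · apply hnd _ (hW _ _ (hW _ _ hw0))
      intro w' hw'
      rw [skew halt, ← map_pow, ← hE, ← hE, ← E_mul,
        show toLaurent b * Q * P ^ (k + 1) = toLaurent b * (P ^ (k + 1) * Q) by ring, E_mul,
        hkill w' hw']
      simp
    · rw [← hE]
      have : E (toLaurent b * Q) z = z := by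
        conv_rhs => rw [← E_one E z, ← hab', map_add, LinearMap.add_apply, E_mul E (toLaurent a),
          hz1, map_zero, zero_add]
      rwa [this]
  by_cases hc1 : ∃ v ∈ W, E (P ^ (k + 1)) v = 0 ∧ ∃ r, ω (E (r * P ^ k) v) v ≠ 0
  · -- cyclic case
    obtain ⟨v, hvW, hv1, r, hr⟩ := hc1
    refine ⟨_, hcyc v hvW, ?_, gd_cyclic halt hE v ?_⟩
    · intro h
      have := hmem v
      rw [h, Submodule.mem_bot] at this
      simp [this] at hr
    · intro f hf
      obtain ⟨g, hg⟩ := uniserial E hp k v hv1 f hf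
      refine ⟨invert (r * g), ?_⟩
      rw [← hE, ← E_mul, mul_assoc, E_mul, hg, ← E_mul]
      exact hr
  push Not at hc1
  -- it suffices to find a hyperbolic pair
  suffices h : ∃ v ∈ W, ∃ w ∈ W, ∃ s₁ s₂ : V, (∀ f, ω (E f v) v = 0) ∧ (∀ f, ω (E f w) w = 0) ∧
      (∀ f, E f v ≠ 0 → ∃ g, E (g * f) v = s₁) ∧ (∀ f, E f w ≠ 0 → ∃ g, E (g * f) w = s₂) ∧
      ω s₁ w ≠ 0 ∧ ω s₂ v ≠ 0 by
    obtain ⟨v, hv, w, hw, s₁, s₂, h1, h2, h3, h4, h5, h6⟩ := h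
    refine ⟨_, ?_, ?_, gd_two halt hE v w h1 h2 ?_ ?_⟩
    · rw [LinearMap.range_coprod]
      exact sup_le (hcyc v hv) (hcyc w hw)
    · intro h
      rw [LinearMap.range_coprod, sup_eq_bot_iff] at h
      have := hmem v
      rw [h.1, Submodule.mem_bot] at this
      simp [this] at h6
    · intro f hf
      obtain ⟨g, hg⟩ := h3 f hf
      refine ⟨invert g, ?_⟩
      rwa [← hE, ← E_mul, hg]
    · intro f hf
      obtain ⟨g, hg⟩ := h4 f hf
      refine ⟨invert g, ?_⟩
      rwa [← hE, ← E_mul, hg]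
  have hz1 : E (P ^ (k + 1)) (E (P ^ k) v) = 0 := by rw [E_comm, hv1, map_zero]
  obtain ⟨w, hwW, hw1, hvw⟩ := hdual _ (hW _ _ hvW) hz1 hv2
  by_cases hrev : p ∣ p.reverse
  · -- self-dual case
    obtain ⟨c, hc⟩ := inv_dvd hrev
    have hc' : P = invert c * invert P := by
      rw [← map_mul, ← hc, inv_inv']
    have hker : ∀ u, E (invert P ^ (k + 1)) u = 0 → E (P ^ (k + 1)) u = 0 := by
      intro u hu
      rw [hc', mul_pow, E_mul, hu, map_zero]
    have hsym : ∀ v ∈ W, E (P ^ (k + 1)) v = 0 → ∀ r,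
        E (r * P ^ k) v = E (invert (r * P ^ k)) v := by
      intro v hv hv1 r
      by_contra hne
      have hz : E (P ^ (k + 1)) (E (r * P ^ k) v - E (invert (r * P ^ k)) v) = 0 := by
        rw [map_sub, E_comm, hv1, E_comm, hv1]; simp
      obtain ⟨w, hw, hw1, hw2⟩ := hdual _ (W.sub_mem (hW _ _ hv) (hW _ _ hv)) hz (sub_ne_zero.2 hne)
      apply hw2
      have hw1' := hker w hw1
      have e := hc1 (v + w) (W.add_mem hv hw) (by rw [map_add, hv1, hw1', add_zero]) r
      simp only [map_add, LinearMap.add_apply, hc1 v hv hv1 r, hc1 w hw hw1' r] at e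
      rw [map_sub, LinearMap.sub_apply, hE (invert (r * P ^ k)), inv_inv', skew halt v]
      linear_combination e
    set z := E (P ^ k) v with hz
    have hPz : E P z = 0 := by rw [hz, ← E_mul, ← pow_succ', hv1]
    have hTz : E (T 1) z = E (T (-1)) z := by
      have e0 := hsym v hvW hv1 1
      have e1 := hsym v hvW hv1 (T 1)
      rw [one_mul] at e0
      rw [map_mul invert, E_mul, E_mul, ← e0, invert_T] at e1
      exact e1
    have hTT : (T 1 : LaurentPolynomial K) * T (-1) = 1 := by rw [← T_add]; simp
    have hsq : E (toLaurent ((X - 1) * (X + 1) : K[X])) z = 0 := by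
      have : toLaurent ((X - 1) * (X + 1) : K[X]) = T 1 * (T 1 - T (-1)) := by
        simp only [map_mul, map_sub, map_add, toLaurent_X, map_one]
        linear_combination hTT
      rw [this, E_mul, map_sub, LinearMap.sub_apply, hTz, sub_self, map_zero]
    have hdvd : p ∣ (X - 1) * (X + 1) := by
      by_contra h
      obtain ⟨a, b, hab⟩ := hp.coprime_iff_not_dvd.2 h
      apply hv2
      have : E (toLaurent (a * p + b * ((X - 1) * (X + 1)))) z = 0 := by
        rw [map_add, map_mul, map_mul toLaurent b, map_add, LinearMap.add_apply, E_mul, E_mul, hsq,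
          ← hPdef, hPz, map_zero, map_zero, add_zero]
      rwa [hab, map_one, E_one] at this
    obtain ⟨ε, hε, hpε⟩ : ∃ ε : K, ε * ε = 1 ∧ p = X - Polynomial.C ε := by
      rcases hp.prime.dvd_or_dvd hdvd with h | h
      · refine ⟨1, by ring, ?_⟩
        rw [← map_one Polynomial.C] at h
        exact eq_of_monic_of_associated hpm (monic_X_sub_C _)
          (hp.associated_of_dvd (irreducible_X_sub_C _) h)
      · refine ⟨-1, by ring, ?_⟩
        rw [show (X + 1 : K[X]) = X - Polynomial.C (-1) by simp] at h
        exact eq_of_monic_of_associated hpm (monic_X_sub_C _)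
          (hp.associated_of_dvd (irreducible_X_sub_C _) h)
    set e : LaurentPolynomial K := LaurentPolynomial.C ε with he
    have hee : e * e = 1 := by rw [he, ← map_mul, hε, map_one]
    have hPe : P = T 1 - e := by rw [hPdef, hpε, map_sub, toLaurent_X, toLaurent_C]
    have hiP : invert P = -(e * T (-1)) * P := by
      rw [hPe, map_sub, invert_T, he, invert_C, ← he]
      linear_combination e * hTT - T (-1) * hee
    have huz : E (e * T (-1)) z = z := by
      have h1 : E (T 1) z = E e z := by
        rw [hPe, map_sub, LinearMap.sub_apply, sub_eq_zero] at hPz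
        exact hPz
      rw [mul_comm, E_mul, ← h1, ← E_mul, mul_comm, hTT, E_one]
    have hkeven : Even k := by
      by_contra hodd
      rw [Nat.not_even_iff_odd] at hodd
      have e0 := hsym v hvW hv1 1
      rw [one_mul, map_pow invert, hiP, mul_pow, hodd.neg_pow, E_mul, ← hz, map_neg,
        LinearMap.neg_apply] at e0
      have hpow : ∀ n : ℕ, E ((e * T (-1)) ^ n) z = z := by
        intro n
        induction n with
        | zero => rw [pow_zero, E_one]
        | succ n ih => rw [pow_succ, E_mul, huz, ih]
      rw [hpow] at e0
      apply hv2
      have h2 : (2 : K) • z = 0 := by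
        rw [two_smul]; nth_rewrite 1 [e0]; simp
      simpa using h2
    -- the skew nilpotent element
    set N : LaurentPolynomial K := T 1 - T (-1) with hNdef
    have hNP : N = (T (-1) * (T 1 + e)) * P := by
      rw [hPe, hNdef]
      linear_combination (- T 1) * hTT + T (-1) * hee
    have hN : invert N = -N := by
      rw [hNdef, map_sub, invert_T, invert_T]; simp
    set P0 : Submodule K V := W ⊓ LinearMap.ker (E (P ^ (k + 1))) with hP0
    have hP0mem : ∀ u, u ∈ P0 ↔ u ∈ W ∧ E (P ^ (k + 1)) u = 0 := by
      intro u; rw [hP0, Submodule.mem_inf, LinearMap.mem_ker]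
    have hP0inv : ∀ f, ∀ u ∈ P0, E f u ∈ P0 := by
      intro f u hu
      rw [hP0mem] at hu ⊢
      exact ⟨hW _ _ hu.1, by rw [E_comm, hu.2, map_zero]⟩
    have hcop : IsCoprime (T 1 + e) (P ^ (k + 1)) := by
      apply IsCoprime.pow_right
      refine ⟨LaurentPolynomial.C (ε / 2), -LaurentPolynomial.C (ε / 2), ?_⟩
      have h2 : LaurentPolynomial.C (ε / 2) * (e + e) = (1 : LaurentPolynomial K) := by
        rw [he, ← map_add, ← map_mul, ← map_one LaurentPolynomial.C]
        congr 1
        linear_combination hε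
      rw [hPe]
      linear_combination h2
    obtain ⟨α, β, hαβ⟩ := hcop
    have hr : ∀ r, ∃ (c : K) (r' : LaurentPolynomial K), ∀ u ∈ P0,
        E r u = c • u + E (r' * N) u := by
      intro r
      obtain ⟨c, g, hg⟩ := dvd_sub_C hε r
      refine ⟨c, g * α * T 1, fun u hu => ?_⟩
      have h1 : r = LaurentPolynomial.C c + g * α * T 1 * N + g * P * β * P ^ (k + 1) := by
        rw [hg, ← he, ← hPe, hNP]
        linear_combination (- g * P) * hαβ - g * α * (T 1 + e) * P * hTT
      conv_lhs => rw [h1]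
      rw [map_add, map_add, LinearMap.add_apply, LinearMap.add_apply,
        E_mul E (g * P * β), ((hP0mem u).1 hu).2, map_zero, add_zero,
        show (LaurentPolynomial.C c : LaurentPolynomial K) = algebraMap K _ c from rfl,
        AlgHom.commutes, Module.algebraMap_end_apply]
    have hNkill : ∀ u ∈ P0, E (N ^ (k + 1)) u = 0 := by
      intro u hu
      rw [hNP, mul_pow, E_mul, ((hP0mem u).1 hu).2, map_zero]
    have hv0 : v ∈ P0 := (hP0mem v).2 ⟨hvW, hv1⟩
    -- N ^ k v is nonzero
    have hNv : E (N ^ k) v ≠ 0 := by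
      intro h0
      apply hv2
      have hα : E (α * (T 1 + e)) z = z := by
        have h3 : α * (T 1 + e) = 1 - β * P ^ (k + 1) := by linear_combination hαβ
        rw [h3, map_sub, LinearMap.sub_apply, E_one, E_mul, hz1, map_zero, sub_zero]
      have hpow : ∀ n : ℕ, E ((α * (T 1 + e)) ^ n) z = z := by
        intro n
        induction n with
        | zero => rw [pow_zero, E_one]
        | succ n ih => rw [pow_succ, E_mul, hα, ih]
      have h1 : (α * T 1) ^ k * N ^ k = (α * (T 1 + e)) ^ k * P ^ k := by
        rw [← mul_pow, ← mul_pow]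
        congr 1
        rw [hNP]
        linear_combination α * (T 1 + e) * P * hTT
      rw [← hpow k, hz, ← E_mul, ← h1, E_mul, h0, map_zero]
    obtain ⟨w, hwW, hw1, hvw⟩ := hdual _ (hW _ _ hvW) (by rw [E_comm, hv1, map_zero]) hNv
    have hw0 : w ∈ P0 := (hP0mem w).2 ⟨hwW, hker w hw1⟩
    obtain ⟨v', hv', h1, h2⟩ := isotropize halt hE P0 hP0inv N hN hr k hkeven hNkill v w hv0 hw0 hvw
    have hswap : ∀ a b, ω (E (N ^ k) a) b = - ω (E (N ^ k) b) a := by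
      intro a b
      rw [hE, map_pow invert, hN, hkeven.neg_pow, skew halt]
    have h1' : ω (E (N ^ k) w) v' ≠ 0 := by
      rw [hswap]; exact neg_ne_zero.2 h1
    obtain ⟨w', hw', h3, h4⟩ := isotropize halt hE P0 hP0inv N hN hr k hkeven hNkill w v' hw0 hv' h1'
    have huni : ∀ u ∈ P0, ∀ f, E f u ≠ 0 → ∃ g, E (g * f) u = E (N ^ k) u := by
      intro u hu f hf
      obtain ⟨g, hg⟩ := uniserial E hp k u ((hP0mem u).1 hu).2 f hf
      refine ⟨(T (-1) * (T 1 + e)) ^ k * g, ?_⟩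
      rw [mul_assoc, E_mul, hg, ← E_mul, hNP, mul_pow _ P]
    refine ⟨v', ((hP0mem v').1 hv').1, w', ((hP0mem w').1 hw').1, _, _, h2, h4, huni v' hv',
      huni w' hw', ?_, h3⟩
    rw [hswap]; exact neg_ne_zero.2 h3
  · -- coprime case
    obtain ⟨a, b, hab⟩ := ((hp.coprime_iff_not_dvd.2 hrev).pow (m := k + 1) (n := k + 1))
    have hab' : toLaurent a * P ^ (k + 1) + toLaurent b * (T p.natDegree) ^ (k + 1)
        * invert P ^ (k + 1) = 1 := by
      have := congrArg toLaurent hab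
      rw [map_add, map_mul, map_mul, map_pow, map_pow, toLaurent_reverse, map_one, ← hPdef] at this
      rw [← this]; ring
    have hone : ∀ u, u = E (toLaurent a) (E (P ^ (k + 1)) u) +
        E (toLaurent b * (T p.natDegree) ^ (k + 1)) (E (invert P ^ (k + 1)) u) := by
      intro u
      rw [← E_mul, ← E_mul, ← LinearMap.add_apply, ← map_add, hab', E_one]
    refine ⟨v, hvW, w, hwW, _, E (invert P ^ k) w, ?_, ?_, uniserial E hp k v hv1, ?_, hvw, ?_⟩
    · intro f
      rw [hone (E f v), E_comm E _ f, hv1, map_zero, map_zero, zero_add, E_comm, ← map_pow, hE,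
        inv_inv', hv1, map_zero]
    · intro f
      rw [hone (E f w), E_comm E (invert P ^ (k + 1)) f, hw1, map_zero, map_zero, add_zero, E_comm,
        hE, map_pow, hw1, map_zero]
    · intro f hf
      obtain ⟨g, hg⟩ := uniserial (E.comp (invert (R := K)).toAlgHom) hp k w
        (by simpa using hw1) (invert f) (by simpa [inv_inv'] using hf)
      refine ⟨invert g, ?_⟩
      simpa [inv_inv'] using hg
    · rw [← map_pow, hE, inv_inv', skew halt]
      exact neg_ne_zero.2 hvw

lemma gd_top [CharZero K] [FiniteDimensional K V] {ω : V →ₗ[K] V →ₗ[K] K}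
    (halt : ∀ u : V, ω u u = 0) (hnd : ∀ u : V, (∀ v : V, ω u v = 0) → u = 0)
    {E : LaurentPolynomial K →ₐ[K] Module.End K V}
    (hE : ∀ f u v, ω (E f u) v = ω u (E (invert f) v)) : Gd ω E ⊤ := by
  obtain ⟨U, hU, hmax⟩ := exists_maximal_of_wellFoundedGT (fun U => Gd ω E U) ⟨⊥, Gd.bot ω E⟩
  have hrefl : LinearMap.BilinForm.IsRefl (ω : LinearMap.BilinForm K V) := by
    intro u v h
    rw [skew halt, h, neg_zero]
  set W := LinearMap.BilinForm.orthogonal (ω : LinearMap.BilinForm K V) U with hWdef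
  have hWmem : ∀ w, w ∈ W ↔ ∀ u ∈ U, ω u w = 0 := fun w => Iff.rfl
  have hUnd : ∀ u ∈ U, (∀ u' ∈ U, ω u u' = 0) → u = 0 := by
    obtain ⟨_, _, _, _, _, h⟩ := hU
    exact h
  have hcompl : IsCompl U W := by
    rw [hWdef, LinearMap.BilinForm.isCompl_orthogonal_iff_disjoint hrefl, Submodule.disjoint_def]
    intro u hu hu'
    apply hUnd u hu
    intro u' h'
    exact hrefl _ _ (hu' u' h')
  have htop : U ⊔ W = ⊤ := hcompl.sup_eq_top
  have hWinv : ∀ f, ∀ w ∈ W, E f w ∈ W := by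
    intro f w hw
    rw [hWmem] at hw ⊢
    intro u hu
    rw [← inv_inv' f, ← hE]
    exact hw _ (hU.inv _ hu)
  have hWnd : ∀ w ∈ W, (∀ w' ∈ W, ω w w' = 0) → w = 0 := by
    intro w hw h
    apply hnd
    intro v
    have hv : v ∈ U ⊔ W := by rw [htop]; trivial
    obtain ⟨a, ha, b, hb, rfl⟩ := Submodule.mem_sup.1 hv
    rw [map_add, h b hb, hrefl _ _ (hw a ha), add_zero]
  by_cases hW0 : W = ⊥
  · rw [hW0, sup_bot_eq] at htop
    rwa [← htop]
  · exfalso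
    obtain ⟨U', hU'W, hU'0, hU'⟩ := piece halt hE W hWinv hW0 hWnd
    have hs := hU.sup halt hU' (fun u hu u' hu' => hU'W hu' u hu)
    have hle : U' ≤ U := le_sup_right.trans (hmax hs le_sup_left)
    apply hU'0
    rw [eq_bot_iff, ← hcompl.inf_eq_bot]
    exact le_inf hle hU'W

/-- Every symplectic transformation is inverted by some anti-symplectic one. -/
lemma exists_anti [CharZero K] [FiniteDimensional K V] {ω : V →ₗ[K] V →ₗ[K] K}
    (halt : ∀ u : V, ω u u = 0) (hnd : ∀ u : V, (∀ v : V, ω u v = 0) → u = 0)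
    (x : V ≃ₗ[K] V) (hx : ∀ u v : V, ω (x u) (x v) = ω u v) :
    ∃ h : V ≃ₗ[K] V, (∀ u v, ω (h u) (h v) = - ω u v) ∧ ∀ u, h (x u) = x⁻¹ (h u) := by
  let F : Multiplicative ℤ →* Module.End K V :=
    (LinearEquiv.automorphismGroup.toLinearMapMonoidHom (R := K) (M := V)).comp (zpowersHom _ x)
  let E : LaurentPolynomial K →ₐ[K] Module.End K V := AddMonoidAlgebra.lift K _ ℤ F
  have hET : ∀ (n : ℤ) (a : K) (u : V), E (LaurentPolynomial.C a * T n) u = a • (x ^ n) u := by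
    intro n a u
    rw [← single_eq_C_mul_T]
    simp only [E, AddMonoidAlgebra.lift_single, LinearMap.smul_apply]
    rfl
  have hxn : ∀ (n : ℤ) u v, ω ((x ^ n) u) v = ω u ((x ^ (-n)) v) := by
    have hinv : ∀ u v, ω (x⁻¹ u) v = ω u (x v) := by
      intro u v
      rw [← hx (x⁻¹ u) v]
      congr 2
      exact x.apply_symm_apply u
    have hinv' : ∀ u v, ω (x u) v = ω u (x⁻¹ v) := by
      intro u v
      rw [← hx u (x⁻¹ v)]
      congr 1
      exact (x.apply_symm_apply v).symm
    intro n
    induction n using Int.induction_on with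
    | zero => intro u v; simp
    | succ n ih =>
      intro u v
      rw [zpow_add_one, LinearEquiv.mul_apply, ih, hinv', neg_add, add_comm, zpow_add, zpow_neg_one]
      rfl
    | pred n ih =>
      intro u v
      rw [zpow_sub_one, LinearEquiv.mul_apply, ih, hinv, neg_sub, sub_neg_eq_add, neg_neg,
        zpow_add, zpow_one]
      rfl
  have hE : ∀ f u v, ω (E f u) v = ω u (E (invert f) v) := by
    intro f
    induction f using LaurentPolynomial.induction_on' with
    | add p q hp hq => intro u v; simp [hp, hq]
    | C_mul_T n a =>
      intro u v
      rw [map_mul invert, invert_C, invert_T, hET, hET, map_smul, LinearMap.smul_apply, hxn,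
        map_smul]
  obtain ⟨Γ, h1, h2, h3, h4, -⟩ := gd_top halt hnd hE
  let f1 : Γ →ₗ[K] V := (LinearMap.fst K V V).comp Γ.subtype
  let f2 : Γ →ₗ[K] V := (LinearMap.snd K V V).comp Γ.subtype
  have s1 : Function.Surjective f1 := by
    rw [← LinearMap.range_eq_top, LinearMap.range_comp, Submodule.range_subtype, h3]
  have s2 : Function.Surjective f2 := by
    rw [← LinearMap.range_eq_top, LinearMap.range_comp, Submodule.range_subtype, h4]
  have i1 : Function.Injective f1 := by
    rw [← LinearMap.ker_eq_bot, LinearMap.ker_eq_bot']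
    intro a ha
    have ha1 : a.1.1 = 0 := ha
    have ha2 : a.1.2 = 0 := by
      apply hnd
      intro v
      obtain ⟨b, rfl⟩ := s2 v
      have := h1 a a.2 b b.2
      rw [ha1, map_zero, LinearMap.zero_apply, neg_zero] at this
      exact this
    exact Subtype.ext (Prod.ext ha1 ha2)
  have i2 : Function.Injective f2 := by
    rw [← LinearMap.ker_eq_bot, LinearMap.ker_eq_bot']
    intro a ha
    have ha2 : a.1.2 = 0 := ha
    have ha1 : a.1.1 = 0 := by
      apply hnd
      intro v
      obtain ⟨b, rfl⟩ := s1 v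
      have := h1 a a.2 b b.2
      rw [ha2, map_zero, LinearMap.zero_apply, zero_eq_neg] at this
      exact this
    exact Subtype.ext (Prod.ext ha1 ha2)
  let e1 := LinearEquiv.ofBijective f1 ⟨i1, s1⟩
  let e2 := LinearEquiv.ofBijective f2 ⟨i2, s2⟩
  refine ⟨e1.symm.trans e2, ?_, ?_⟩
  · intro u v
    obtain ⟨a, rfl⟩ := e1.surjective u
    obtain ⟨b, rfl⟩ := e1.surjective v
    simp only [LinearEquiv.trans_apply, LinearEquiv.symm_apply_apply]
    exact h1 a a.2 b b.2
  · intro u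
    obtain ⟨a, rfl⟩ := e1.surjective u
    have e0 : ∀ (n : ℤ) u, E (T n) u = (x ^ n) u := by
      intro n u
      have := hET n 1 u
      simpa using this
    have hm := h2 (T 1) a a.2
    have hx1 : x (e1 a) = e1 ⟨_, hm⟩ := by
      change x (a.1.1) = E (T 1) a.1.1
      rw [e0, zpow_one]
    rw [hx1]
    simp only [LinearEquiv.trans_apply, LinearEquiv.symm_apply_apply]
    change E (invert (T 1)) a.1.2 = x⁻¹ a.1.2
    rw [invert_T, e0, zpow_neg_one]

end

end AntiSymp

/-- If `g` is an anti-symplectic automorphism of a nondegenerate alternating form `ω` on a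
finite-dimensional vector space over a field of characteristic zero, then for every
symplectic transformation `x`: (i) `g ∘ x ∘ g⁻¹` is symplectic, and (ii) `g ∘ x ∘ g⁻¹` is
conjugate to `x⁻¹` within the symplectic group. -/
theorem stmt3 (K : Type*) [Field K] [CharZero K]
    (V : Type*) [AddCommGroup V] [Module K V] [FiniteDimensional K V]
    (ω : V →ₗ[K] V →ₗ[K] K)
    (halt : ∀ u : V, ω u u = 0)
    (hnd : ∀ u : V, (∀ v : V, ω u v = 0) → u = 0)
    (g : V ≃ₗ[K] V) (hg : ∀ u v : V, ω (g u) (g v) = -ω u v)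
    (x : V ≃ₗ[K] V) (hx : ∀ u v : V, ω (x u) (x v) = ω u v) :
    (∀ u v : V, ω ((g * x * g⁻¹) u) ((g * x * g⁻¹) v) = ω u v) ∧
    ∃ c : V ≃ₗ[K] V, (∀ u v : V, ω (c u) (c v) = ω u v) ∧
      c * (g * x * g⁻¹) * c⁻¹ = x⁻¹ := by
  obtain ⟨h, h1, h2⟩ := AntiSymp.exists_anti halt hnd x hx
  have hgi : ∀ u v, ω (g⁻¹ u) (g⁻¹ v) = - ω u v := by
    intro u v
    have := hg (g⁻¹ u) (g⁻¹ v)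
    have e : ∀ u, g (g⁻¹ u) = u := fun u => g.apply_symm_apply u
    rw [e, e] at this
    rw [this, neg_neg]
  refine ⟨fun u v => ?_, h * g⁻¹, fun u v => ?_, ?_⟩
  · simp only [LinearEquiv.mul_apply]
    rw [hg, hx, hgi, neg_neg]
  · simp only [LinearEquiv.mul_apply]
    rw [h1, hgi, neg_neg]
  · have hh : h * x = x⁻¹ * h := LinearEquiv.ext h2
    calc h * g⁻¹ * (g * x * g⁻¹) * (h * g⁻¹)⁻¹ = (h * x) * h⁻¹ := by group
      _ = x⁻¹ := by rw [hh]; group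
end

section
/- Let K be a field of characteristic zero, V a finite-dimensional K-vector space, and ω a nondegenerate alternating bilinear form on V. Then every symplectic transformation x of (V, ω) is a product of two anti-symplectic involutions: there exist linear automorphisms s, t of V with s² = 1, t² = 1, ω(s u, s v) = -ω(u, v) and ω(t u, t v) = -ω(u, v) for all u, v, such that x = s ∘ t. In particular, s x s⁻¹ = x⁻¹ with s anti-symplectic. -/
open Polynomial

/-- Gluing along an orthogonal direct sum. -/
theorem glue_aux {K : Type*} [Field K] {V : Type*} [AddCommGroup V] [Module K V]
    (ω : V →ₗ[K] V →ₗ[K] K) (halt : ∀ u : V, ω u u = 0)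
    (U U' : Submodule K V) (hc : IsCompl U U') (ho : ∀ u ∈ U, ∀ v ∈ U', ω u v = 0)
    (s₁ : U →ₗ[K] U) (s₂ : U' →ₗ[K] U')
    (h₁ : ∀ u, s₁ (s₁ u) = u) (h₂ : ∀ u, s₂ (s₂ u) = u)
    (a₁ : ∀ u v : U, ω (s₁ u) (s₁ v) = -ω u v)
    (a₂ : ∀ u v : U', ω (s₂ u) (s₂ v) = -ω u v) :
    ∃ s : V →ₗ[K] V, (∀ u : U, s u = s₁ u) ∧ (∀ u : U', s u = s₂ u) ∧
      (∀ v, s (s v) = v) ∧ (∀ u v, ω (s u) (s v) = -ω u v) := by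
  have ho' : ∀ u ∈ U', ∀ v ∈ U, ω u v = 0 := by
    intro u hu v hv
    have h := halt (u + v)
    simp only [map_add, LinearMap.add_apply, halt, ho v hv u hu] at h
    simpa using h
  have hd : ∀ v : V, ∃ (a : U) (b : U'), v = a + b := by
    intro v
    have : v ∈ U ⊔ U' := by rw [hc.sup_eq_top]; trivial
    obtain ⟨a, ha, b, hb, rfl⟩ := Submodule.mem_sup.1 this
    exact ⟨⟨a, ha⟩, ⟨b, hb⟩, rfl⟩
  let s : V →ₗ[K] V := LinearMap.ofIsCompl hc (U.subtype ∘ₗ s₁) (U'.subtype ∘ₗ s₂)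
  have e₁ : ∀ u : U, s u = s₁ u := fun u => by simp [s]
  have e₂ : ∀ u : U', s u = s₂ u := fun u => by simp [s]
  refine ⟨s, e₁, e₂, ?_, ?_⟩
  · intro v
    obtain ⟨a, b, rfl⟩ := hd v
    simp only [map_add, e₁, e₂, h₁, h₂]
  · intro u v
    obtain ⟨a, b, rfl⟩ := hd u
    obtain ⟨c, d, rfl⟩ := hd v
    simp only [map_add, e₁, e₂, LinearMap.add_apply, a₁, a₂,
      ho _ (Subtype.prop _) _ (Subtype.prop _), ho' _ (Subtype.prop _) _ (Subtype.prop _)]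
    ring

/-- The restricted form to a member of an orthogonal decomposition is nondegenerate. -/
theorem nondeg_aux {K : Type*} [Field K] {V : Type*} [AddCommGroup V] [Module K V]
    (ω : V →ₗ[K] V →ₗ[K] K) 
    (hnd : ∀ u : V, (∀ v : V, ω u v = 0) → u = 0)
    (U U' : Submodule K V) (hc : IsCompl U U') (ho : ∀ u ∈ U, ∀ v ∈ U', ω u v = 0) :
    ∀ u : U, (∀ v : U, ω u v = 0) → u = 0 := by
  intro u hu
  apply Subtype.ext
  apply hnd
  intro v
  have : v ∈ U ⊔ U' := by rw [hc.sup_eq_top]; trivial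
  obtain ⟨a, ha, b, hb, rfl⟩ := Submodule.mem_sup.1 this
  rw [map_add, ho u u.2 b hb, hu ⟨a, ha⟩, add_zero]

theorem swap_aux {K : Type*} [Field K] {V : Type*} [AddCommGroup V] [Module K V]
    (ω : V →ₗ[K] V →ₗ[K] K) (halt : ∀ u : V, ω u u = 0) (u v : V) : ω u v = -ω v u := by
  have h := halt (u + v)
  simp only [map_add, LinearMap.add_apply, halt] at h
  linear_combination h

/-- polynomials in a self-adjoint operator are self-adjoint -/
theorem selfadj_aux {K : Type*} [Field K] {V : Type*} [AddCommGroup V] [Module K V]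
    (ω : V →ₗ[K] V →ₗ[K] K) (y : Module.End K V) (hy : ∀ u v, ω (y u) v = ω u (y v))
    (p : K[X]) : ∀ u v, ω (aeval y p u) v = ω u (aeval y p v) := by
  induction p using Polynomial.induction_on' with
  | add p q hp hq => intro u v; simp [hp, hq]
  | monomial n a =>
    have : ∀ n : ℕ, ∀ u v, ω ((y ^ n) u) v = ω u ((y ^ n) v) := by
      intro n
      induction n with
      | zero => intro u v; simp
      | succ n ih =>
        intro u v
        rw [pow_succ, Module.End.mul_apply, ih, hy, ← Module.End.mul_apply, ← pow_succ', pow_succ]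
    intro u v
    simp [aeval_monomial, this, Module.algebraMap_end_apply]

theorem adj_aux {K : Type*} [Field K] {V : Type*} [AddCommGroup V] [Module K V]
    (ω : V →ₗ[K] V →ₗ[K] K) (N : Module.End K V) (hN : ∀ u v, ω (N u) v = -ω u (N v))
    (p : K[X]) : ∀ u v, ω (aeval N p u) v = ω u (aeval N (aeval (-X : K[X]) p) v) := by
  induction p using Polynomial.induction_on' with
  | add p q hp hq => intro u v; simp [hp, hq]
  | monomial n a =>
    have : ∀ n : ℕ, ∀ u v, ω ((N ^ n) u) v = ω u (((-N) ^ n) v) := by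
      intro n
      induction n with
      | zero => intro u v; simp
      | succ n ih =>
        intro u v
        rw [pow_succ, Module.End.mul_apply, ih, hN, pow_succ' (-N), Module.End.mul_apply,
          LinearMap.neg_apply, map_neg]
    intro u v
    simp [aeval_monomial, this, Module.algebraMap_end_apply]

/-- orthogonal splitting from coprime polynomials in a self-adjoint operator -/
theorem split_aux {K : Type*} [Field K] {V : Type*} [AddCommGroup V] [Module K V]
    (ω : V →ₗ[K] V →ₗ[K] K) (y : Module.End K V) (hy : ∀ u v, ω (y u) v = ω u (y v))
    (p q : K[X]) (hpq : IsCoprime p q) (h0 : aeval y (p * q) = 0) :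
    IsCompl (LinearMap.ker (aeval y p)) (LinearMap.ker (aeval y q)) ∧
    ∀ u ∈ LinearMap.ker (aeval y p), ∀ v ∈ LinearMap.ker (aeval y q), ω u v = 0 := by
  have hs := selfadj_aux ω y hy
  constructor
  · constructor
    · exact disjoint_ker_aeval_of_isCoprime y hpq
    · rw [codisjoint_iff, sup_ker_aeval_eq_ker_aeval_mul_of_coprime y hpq, h0, LinearMap.ker_zero]
  · obtain ⟨a, b, hab⟩ := hpq
    intro u hu v hv
    rw [LinearMap.mem_ker] at hu hv
    have : u = aeval y q (aeval y b u) := by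
      have h1 : aeval y (a * p + b * q) u = u := by rw [hab]; simp
      rw [← Module.End.mul_apply, ← map_mul, mul_comm q b]
      conv_lhs => rw [← h1]
      simp only [map_add, map_mul, LinearMap.add_apply, Module.End.mul_apply, hu, map_zero, zero_add]
    rw [this, hs, hv, map_zero]

/-- key Bezout fact -/
theorem bezout_aux {K : Type*} [Field K] (q : K[X]) (hq : Irreducible q) (k : ℕ) (b : K[X])
    (hb : ¬ q ^ (k + 1) ∣ b) : ∃ g h : K[X], g * b + h * q ^ (k + 1) = q ^ k := by
  by_cases hb0 : q ^ k ∣ b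
  · obtain ⟨c, rfl⟩ := hb0
    have hc : ¬ q ∣ c := fun h => hb (by rw [pow_succ]; exact mul_dvd_mul_left _ h)
    obtain ⟨g, h, e⟩ := (hq.coprime_iff_not_dvd.2 hc)
    exact ⟨h, g, by linear_combination q ^ k * e⟩
  · induction k with
    | zero => simp at hb0
    | succ k ih =>
      by_cases h1 : q ^ k ∣ b
      · obtain ⟨c, rfl⟩ := h1
        have hc : ¬ q ∣ c := fun h => hb0 (by rw [pow_succ]; exact mul_dvd_mul_left _ h)
        obtain ⟨g, h, e⟩ := (hq.coprime_iff_not_dvd.2 hc)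
        exact ⟨q * h, g, by linear_combination q ^ (k+1) * e⟩
      · obtain ⟨g, h, e⟩ := ih hb0 h1
        exact ⟨q * g, h, by linear_combination q * e⟩

/-- the building block: an invariant nondegenerate range, with an involution -/
theorem block_aux {K : Type*} [Field K] {V : Type*} [AddCommGroup V] [Module K V]
    (ω : V →ₗ[K] V →ₗ[K] K) (N : Module.End K V)
    {P : Type*} [AddCommGroup P] [Module K P] (π : P →ₗ[K] V) (σ ν : P →ₗ[K] P)
    (hσ : ∀ a, σ (σ a) = a) (hν : ∀ a, π (ν a) = N (π a))
    (hσν : ∀ a, σ (ν a) = - ν (σ a))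
    (hω : ∀ a b, ω (π (σ a)) (π (σ b)) = - ω (π a) (π b))
    (hnd : ∀ a, (∀ b, ω (π a) (π b) = 0) → π a = 0) :
    ∃ s : LinearMap.range π →ₗ[K] LinearMap.range π, (∀ u, s (s u) = u) ∧
      (∀ u v : LinearMap.range π, ω (s u) (s v) = -ω u v) ∧
      (∀ u v : LinearMap.range π, (v : V) = N u → (s v : V) = - N (s u)) := by
  obtain ⟨g, hg⟩ := π.rangeRestrict.exists_rightInverse_of_surjective π.range_rangeRestrict
  have hg' : ∀ w, π (g w) = w := fun w => by
    have := congrArg Subtype.val (LinearMap.congr_fun hg w)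
    simpa using this
  have hker : ∀ a, π a = 0 → π (σ a) = 0 := by
    intro a ha
    apply hnd
    intro b
    have := hω a (σ b)
    rw [hσ, ha] at this
    simpa using this
  let s : LinearMap.range π →ₗ[K] LinearMap.range π := π.rangeRestrict ∘ₗ σ ∘ₗ g
  have hs : ∀ (a : P) (w : LinearMap.range π), (w : V) = π a → (s w : V) = π (σ a) := by
    intro a w hw
    have h1 : π (g w - a) = 0 := by rw [map_sub, hg', hw, sub_self]
    have h2 := hker _ h1
    rw [map_sub, map_sub, sub_eq_zero] at h2
    simpa [s] using h2
  refine ⟨s, ?_, ?_, ?_⟩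
  · rintro ⟨_, a, rfl⟩
    apply Subtype.ext
    rw [hs (σ a) _ (hs a _ rfl), hσ]
  · rintro ⟨_, a, rfl⟩ ⟨_, b, rfl⟩
    rw [hs a _ rfl, hs b _ rfl, hω]
  · rintro ⟨_, a, rfl⟩ v hv
    rw [hs a ⟨π a, a, rfl⟩ rfl, hs (ν a) v (by rw [hv, hν]), hσν, map_neg, hν]

theorem commN_aux {K : Type*} [Field K] {V : Type*} [AddCommGroup V] [Module K V]
    (N : Module.End K V) (p : K[X]) : Commute N (aeval (N * N) p) := by
  have h2 : N * N = aeval N (X * X : K[X]) := by simp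
  have h3 : Commute (aeval N (X : K[X])) (aeval N (p.comp (X * X))) :=
    Commute.map (Commute.all (X : K[X]) _) (aeval N)
  rw [aeval_comp, ← h2, aeval_X] at h3
  exact h3

/-- `U` carries a good involution -/
def SkewGoodOn {K : Type*} [Field K] {V : Type*} [AddCommGroup V] [Module K V]
    (ω : V →ₗ[K] V →ₗ[K] K) (N : Module.End K V) (U : Submodule K V) : Prop :=
  ∃ s : U →ₗ[K] U, (∀ u, s (s u) = u) ∧ (∀ u v : U, ω (s u) (s v) = -ω u v) ∧
      (∀ u v : U, (v : V) = N u → (s v : V) = - N (s u))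

def SkewGood {K : Type*} [Field K] {V : Type*} [AddCommGroup V] [Module K V]
    (ω : V →ₗ[K] V →ₗ[K] K) (N : Module.End K V) : Prop :=
  ∃ s : V →ₗ[K] V, (∀ u, s (s u) = u) ∧ (∀ u v : V, ω (s u) (s v) = -ω u v) ∧
      (∀ u : V, s (N u) = - N (s u))

theorem glueN_aux {K : Type*} [Field K] {V : Type*} [AddCommGroup V] [Module K V]
    (ω : V →ₗ[K] V →ₗ[K] K) (halt : ∀ u : V, ω u u = 0) (N : Module.End K V)
    (U U' : Submodule K V) (hc : IsCompl U U') (ho : ∀ u ∈ U, ∀ v ∈ U', ω u v = 0)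
    (hU : ∀ u ∈ U, N u ∈ U) (hU' : ∀ u ∈ U', N u ∈ U')
    (h : SkewGoodOn ω N U) (h' : SkewGoodOn ω N U') : SkewGood ω N := by
  obtain ⟨s₁, h₁, a₁, n₁⟩ := h
  obtain ⟨s₂, h₂, a₂, n₂⟩ := h'
  obtain ⟨s, e₁, e₂, hs, ha⟩ := glue_aux ω halt U U' hc ho s₁ s₂ h₁ h₂ a₁ a₂
  refine ⟨s, hs, ha, ?_⟩
  intro v
  have : v ∈ U ⊔ U' := by rw [hc.sup_eq_top]; trivial
  obtain ⟨a, ha, b, hb, rfl⟩ := Submodule.mem_sup.1 this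
  have i₁ := n₁ ⟨a, ha⟩ ⟨N a, hU a ha⟩ rfl
  have i₂ := n₂ ⟨b, hb⟩ ⟨N b, hU' b hb⟩ rfl
  rw [← e₁, ← e₁] at i₁
  rw [← e₂, ← e₂] at i₂
  simp only [map_add] at *
  rw [i₁, i₂]
  abel

theorem block_finish {K : Type*} [Field K] {V : Type*} [AddCommGroup V] [Module K V]
    [FiniteDimensional K V]
    (ω : V →ₗ[K] V →ₗ[K] K) (halt : ∀ u : V, ω u u = 0)
    (hnd : ∀ u : V, (∀ v : V, ω u v = 0) → u = 0)
    (N : Module.End K V) (hN : ∀ u v, ω (N u) v = -ω u (N v))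
    (H : ∀ U : Submodule K V, U ≠ ⊤ → (∀ u ∈ U, N u ∈ U) →
      (∀ u : U, (∀ v : U, ω u v = 0) → u = 0) → SkewGoodOn ω N U)
    {P : Type*} [AddCommGroup P] [Module K P] (π : P →ₗ[K] V) (σ ν : P →ₗ[K] P)
    (hσ : ∀ a, σ (σ a) = a) (hν : ∀ a, π (ν a) = N (π a))
    (hσν : ∀ a, σ (ν a) = - ν (σ a))
    (hω : ∀ a b, ω (π (σ a)) (π (σ b)) = - ω (π a) (π b))
    (hndP : ∀ a, (∀ b, ω (π a) (π b) = 0) → π a = 0)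
    (a₀ : P) (ha₀ : π a₀ ≠ 0) : SkewGood ω N := by
  have hgood := block_aux ω N π σ ν hσ hν hσν hω hndP
  have sw := swap_aux ω halt
  have hrefl : LinearMap.BilinForm.IsRefl ω := by
    intro u v h
    rw [sw, h, neg_zero]
  let W := LinearMap.range π
  let W' : Submodule K V := LinearMap.BilinForm.orthogonal ω W
  have ho : ∀ u ∈ W, ∀ v ∈ W', ω u v = 0 := fun u hu v hv => hv u hu
  have hc : IsCompl W W' := by
    refine (LinearMap.BilinForm.isCompl_orthogonal_iff_disjoint hrefl).2 ?_
    rw [Submodule.disjoint_def]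
    rintro _ ⟨a, rfl⟩ ha
    apply hndP
    intro b
    rw [sw, ho (π b) ⟨b, rfl⟩ _ ha, neg_zero]
  have hW : ∀ u ∈ W, N u ∈ W := by
    rintro _ ⟨a, rfl⟩
    exact ⟨ν a, hν a⟩
  have hW' : ∀ u ∈ W', N u ∈ W' := by
    intro u hu v hv
    have := hN v u
    rw [ho _ (hW v hv) _ hu] at this
    change ω v (N u) = 0
    linear_combination this
  refine glueN_aux ω halt N W W' hc ho hW hW' hgood (H W' ?_ hW' ?_)
  · intro ht
    have : W = ⊥ := by
      have := hc.inf_eq_bot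
      rwa [ht, inf_top_eq] at this
    have h2 : π a₀ ∈ W := ⟨a₀, rfl⟩
    rw [this] at h2
    exact ha₀ (by simpa using h2)
  · refine nondeg_aux ω hnd W' W hc.symm ?_
    intro u hu v hv
    rw [sw, ho v hv u hu, neg_zero]

/-- case one: the cyclic block -/
theorem case_one {K : Type*} [Field K] [CharZero K] {V : Type*} [AddCommGroup V] [Module K V]
    [FiniteDimensional K V]
    (ω : V →ₗ[K] V →ₗ[K] K) (halt : ∀ u : V, ω u u = 0)
    (hnd : ∀ u : V, (∀ v : V, ω u v = 0) → u = 0)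
    (N : Module.End K V) (hN : ∀ u v, ω (N u) v = -ω u (N v))
    (H : ∀ U : Submodule K V, U ≠ ⊤ → (∀ u ∈ U, N u ∈ U) →
      (∀ u : U, (∀ v : U, ω u v = 0) → u = 0) → SkewGoodOn ω N U)
    (q : K[X]) (hq : Irreducible q) (k : ℕ) (h0 : aeval (N * N) (q ^ (k + 1)) = 0)
    (h1 : aeval (N * N) (q ^ k) * N ≠ 0) : SkewGood ω N := by
  have sw := swap_aux ω halt
  have hz : ∀ u v, ω ((N * N) u) v = ω u ((N * N) v) := by
    intro u v; simp [hN]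
  have hs := selfadj_aux ω (N * N) hz
  have hcomm : ∀ p : K[X], ∀ u, N (aeval (N * N) p u) = aeval (N * N) p (N u) := by
    intro p u
    have := commN_aux N p
    simpa using LinearMap.congr_fun this.eq u
  have hz0 : ∀ p : K[X], ∀ u, ω (aeval (N * N) p u) u = 0 := by
    intro p u
    have h2 := hs p u u
    rw [sw u] at h2
    have : (2 : K) * ω (aeval (N * N) p u) u = 0 := by linear_combination h2
    simpa using this
  -- choose u
  have hex : ∃ u, ω (aeval (N * N) (q ^ k) (N u)) u ≠ 0 := by
    by_contra! hcon
    apply h1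
    ext v
    apply hnd
    intro w
    change ω (aeval (N * N) (q ^ k) (N v)) w = 0
    have e := hcon (v + w)
    simp only [map_add, LinearMap.add_apply, hcon] at e
    have e2 : ω (aeval (N * N) (q ^ k) (N w)) v = ω (aeval (N * N) (q ^ k) (N v)) w := by
      rw [hs, hN, sw w, hcomm]; simp
    rw [e2] at e
    have : (2 : K) * ω (aeval (N * N) (q ^ k) (N v)) w = 0 := by linear_combination e
    simpa using this
  obtain ⟨u, hu⟩ := hex
  have haev : ∀ p r : K[X], ∀ v, aeval (N * N) p (aeval (N * N) r v) = aeval (N * N) (p * r) v := by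
    intro p r v; simp
  let ψ : K[X] → K := fun p => ω (aeval (N * N) p (N u)) u
  let ev : V → K[X] →ₗ[K] V := fun v => (LinearMap.applyₗ v) ∘ₗ (aeval (N * N)).toLinearMap
  let π : K[X] × K[X] →ₗ[K] V := (ev u).coprod (ev (N u))
  have hπ : ∀ a b, π (a, b) = aeval (N * N) a u + aeval (N * N) b (N u) := by
    intro a b; simp [π, ev]
  have hform : ∀ a b c d, ω (π (a, b)) (π (c, d)) = ψ (b * c) - ψ (a * d) := by
    intro a b c d
    simp only [hπ, map_add, LinearMap.add_apply, ψ]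
    have t1 : ω (aeval (N * N) a u) (aeval (N * N) c u) = 0 := by
      rw [← hs, haev, hz0]
    have t2 : ω (aeval (N * N) b (N u)) (aeval (N * N) d (N u)) = 0 := by
      rw [← hs, haev, hz0]
    have t3 : ω (aeval (N * N) b (N u)) (aeval (N * N) c u) = ω (aeval (N * N) (b * c) (N u)) u := by
      rw [← hs, haev, mul_comm]
    have t4 : ω (aeval (N * N) a u) (aeval (N * N) d (N u))
        = - ω (aeval (N * N) (a * d) (N u)) u := by
      rw [← hs, haev, mul_comm, ← hcomm, hN]; simp
    simp only [map_mul, Module.End.mul_apply] at t1 t2 t3 t4 ⊢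
    rw [t1, t2, t3, t4]
    ring
  have hψ : ∀ b, (∀ c, ψ (b * c) = 0) → aeval (N * N) b = 0 := by
    intro b hb
    by_cases hd : q ^ (k + 1) ∣ b
    · obtain ⟨c, rfl⟩ := hd
      rw [map_mul, h0, zero_mul]
    · exfalso
      obtain ⟨g, h, e⟩ := bezout_aux q hq k b hd
      apply hu
      have := hb g
      simp only [ψ] at this
      rw [← e, map_add, map_mul _ h, h0, mul_zero, add_zero, mul_comm, this]
  let σ : K[X] × K[X] →ₗ[K] K[X] × K[X] :=
    (LinearMap.fst K _ _).prod (-(LinearMap.snd K _ _))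
  let ν : K[X] × K[X] →ₗ[K] K[X] × K[X] :=
    ((LinearMap.mulLeft K (X : K[X])) ∘ₗ (LinearMap.snd K _ _)).prod (LinearMap.fst K _ _)
  refine block_finish ω halt hnd N hN H π σ ν ?_ ?_ ?_ ?_ ?_ (1, 0) ?_
  · rintro ⟨a, b⟩; simp [σ]
  · rintro ⟨a, b⟩
    change π (X * b, a) = _
    simp only [hπ, map_add, hcomm]
    rw [← hcomm b (N u), ← hcomm b u]
    simp [add_comm]
  · rintro ⟨a, b⟩; simp [σ, ν]
  · rintro ⟨a, b⟩ ⟨c, d⟩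
    change ω (π (a, -b)) (π (c, -d)) = _
    rw [hform, hform]
    simp [ψ]
    ring
  · rintro ⟨a, b⟩ hab
    have hb := hψ b (fun c => by
      have := hab (c, 0)
      rw [hform] at this
      simpa [ψ] using this)
    have ha := hψ a (fun c => by
      have := hab (0, c)
      rw [hform] at this
      simpa [ψ] using this)
    rw [hπ, ha, hb]; simp
  · rw [hπ]
    intro h
    apply hu
    have : u = 0 := by simpa using h
    rw [this]; simp

/-- case two: nilpotent blocks of odd size, in pairs -/
theorem case_two {K : Type*} [Field K] [CharZero K] {V : Type*} [AddCommGroup V] [Module K V]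
    [FiniteDimensional K V]
    (ω : V →ₗ[K] V →ₗ[K] K) (halt : ∀ u : V, ω u u = 0)
    (hnd : ∀ u : V, (∀ v : V, ω u v = 0) → u = 0)
    (N : Module.End K V) (hN : ∀ u v, ω (N u) v = -ω u (N v))
    (H : ∀ U : Submodule K V, U ≠ ⊤ → (∀ u ∈ U, N u ∈ U) →
      (∀ u : U, (∀ v : U, ω u v = 0) → u = 0) → SkewGoodOn ω N U)
    (k : ℕ) (h0 : N ^ (2 * k + 1) = 0)
    (h1 : N ^ (2 * k) ≠ 0) : SkewGood ω N := by
  have sw := swap_aux ω halt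
  have hadj := adj_aux ω N hN
  let bar : K[X] →ₐ[K] K[X] := aeval (-X : K[X])
  have hbar : ∀ p, bar (bar p) = p := by
    intro p
    have : bar.comp bar = AlgHom.id K K[X] := by
      apply Polynomial.algHom_ext
      simp [bar]
    exact DFunLike.congr_fun this p
  have hadj' : ∀ p u v, ω u (aeval N p v) = ω (aeval N (bar p) u) v := by
    intro p u v
    rw [hadj]
    change _ = ω u (aeval N (bar (bar p)) v)
    rw [hbar]
  have haev : ∀ p r : K[X], ∀ v, aeval N p (aeval N r v) = aeval N (p * r) v := by
    intro p r v; simp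
  have hcoeff : ∀ p, (bar p).coeff (2 * k) = p.coeff (2 * k) := by
    intro p
    induction p using Polynomial.induction_on' with
    | add p q hp hq => simp [hp, hq]
    | monomial n a =>
      have e : bar (monomial n a) = C (a * (-1) ^ n) * X ^ n := by
        simp only [bar, aeval_monomial, neg_pow (X : K[X]) n, Polynomial.algebraMap_eq, map_mul, map_pow,
          map_neg, map_one]
        ring
      rw [e, coeff_C_mul_X_pow, coeff_monomial]
      by_cases h : 2 * k = n
      · rw [if_pos h, if_pos h.symm, ← h, pow_mul]; simp
      · rw [if_neg h, if_neg (Ne.symm h)]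
  obtain ⟨u, hu⟩ : ∃ u, (N ^ (2 * k)) u ≠ 0 := by
    by_contra! hcon
    exact h1 (LinearMap.ext hcon)
  let ev : V → K[X] →ₗ[K] V := fun v => (LinearMap.applyₗ v) ∘ₗ (aeval N).toLinearMap
  have hev : ∀ v p, ev v p = aeval N p v := fun v p => by simp [ev]
  have hX0 : aeval N (X ^ (2 * k + 1) : K[X]) = 0 := by simpa using h0
  have hker : LinearMap.ker (ev u) ≤ LinearMap.ker (Polynomial.lcoeff K (2 * k)) := by
    intro p hp
    rw [LinearMap.mem_ker, hev] at hp
    rw [LinearMap.mem_ker, Polynomial.lcoeff_apply]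
    by_cases hd : (X : K[X]) ^ (2 * k + 1) ∣ p
    · exact Polynomial.X_pow_dvd_iff.1 hd _ (by omega)
    · exfalso
      obtain ⟨g, h, e⟩ := bezout_aux X Polynomial.irreducible_X (2 * k) p hd
      apply hu
      have e2 := congrArg (fun r => aeval N r u) e
      simp only [map_add, map_mul, hX0, mul_zero, add_zero, Module.End.mul_apply, hp, map_zero,
        map_pow, aeval_X] at e2
      exact e2.symm
  obtain ⟨l, hl⟩ : ∃ l : V →ₗ[K] K, ∀ p, l (aeval N p u) = p.coeff (2 * k) := by
    have : Polynomial.lcoeff K (2 * k) ∈ LinearMap.range (ev u).dualMap := by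
      rw [LinearMap.range_dualMap_eq_dualAnnihilator_ker, Submodule.mem_dualAnnihilator]
      intro p hp
      exact hker hp
    obtain ⟨l, hl⟩ := this
    refine ⟨l, fun p => ?_⟩
    have := LinearMap.congr_fun hl p
    simpa [hev] using this
  obtain ⟨w, hw⟩ : ∃ w, ∀ p, ω (aeval N p u) w = p.coeff (2 * k) := by
    have hinj : Function.Injective ω := by
      rw [← LinearMap.ker_eq_bot, LinearMap.ker_eq_bot']
      intro m hm
      exact hnd m (fun v => by rw [hm]; rfl)
    have hsurj : Function.Surjective ω :=
      (LinearMap.injective_iff_surjective_of_finrank_eq_finrank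
        (Subspace.dual_finrank_eq (K := K) (V := V)).symm).1 hinj
    obtain ⟨w, hw⟩ := hsurj (-l)
    refine ⟨w, fun p => ?_⟩
    rw [sw, hw, LinearMap.neg_apply, neg_neg, hl]
  let π : K[X] × K[X] →ₗ[K] V := (ev u).coprod (ev w)
  have hπ : ∀ a b, π (a, b) = aeval N a u + aeval N b w := by
    intro a b; simp [π, hev]
  let σ : K[X] × K[X] →ₗ[K] K[X] × K[X] :=
    (bar.toLinearMap ∘ₗ (LinearMap.fst K _ _)).prod (-(bar.toLinearMap ∘ₗ LinearMap.snd K _ _))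
  have hσ : ∀ a b, σ (a, b) = (bar a, - bar b) := fun a b => by simp [σ]
  let ν : K[X] × K[X] →ₗ[K] K[X] × K[X] :=
    (LinearMap.mulLeft K (X : K[X])).prodMap (LinearMap.mulLeft K (X : K[X]))
  have hν : ∀ a b, ν (a, b) = (X * a, X * b) := fun a b => by simp [ν]
  have hself : ∀ f g v, ω (aeval N (bar f) v) (aeval N (bar g) v)
      = - ω (aeval N f v) (aeval N g v) := by
    intro f g v
    rw [sw (aeval N f v), neg_neg, hadj', hadj' f, hbar, haev, haev, mul_comm]
  have hcross : ∀ f g, ω (aeval N f u) (aeval N g w) = (bar g * f).coeff (2 * k) := by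
    intro f g
    rw [hadj', haev, hw]
  have hcross' : ∀ f g, ω (aeval N (bar f) u) (aeval N (bar g) w)
      = ω (aeval N f u) (aeval N g w) := by
    intro f g
    rw [hcross, hcross, ← hcoeff, map_mul, hbar, hbar]
  have heven : ∀ v, ω ((N ^ (2 * k)) v) v = 0 := by
    intro v
    have e := hadj' (X ^ (2 * k)) v v
    have e2 : bar (X ^ (2 * k)) = X ^ (2 * k) := by simp [bar, pow_mul]
    rw [e2, sw] at e
    have : (2 : K) * ω (aeval N (X ^ (2 * k) : K[X]) v) v = 0 := by linear_combination -e
    simpa using this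
  have hMu : ω ((N ^ (2 * k)) u) w = 1 := by
    have := hw (X ^ (2 * k))
    simpa using this
  have hMw : ω ((N ^ (2 * k)) w) u = -1 := by
    have e : ω (aeval N (X ^ (2 * k) : K[X]) w) u = -1 := by
      rw [sw, hadj', hw]
      have e2 : bar (X ^ (2 * k)) = X ^ (2 * k) := by simp [bar, pow_mul]
      rw [e2]; simp
    simpa using e
  have hM : ∀ f : K[X], ∀ v, aeval N (X ^ (2 * k) * f) v = f.coeff 0 • (N ^ (2 * k)) v := by
    intro f v
    obtain ⟨g, hg⟩ : (X : K[X]) ∣ f - C (f.coeff 0) := by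
      rw [Polynomial.X_dvd_iff]; simp
    have : X ^ (2 * k) * f = g * X ^ (2 * k + 1) + C (f.coeff 0) * X ^ (2 * k) := by
      linear_combination X ^ (2 * k) * hg
    rw [this, map_add, map_mul, hX0, mul_zero, zero_add]
    simp [Module.algebraMap_end_apply]
  refine block_finish ω halt hnd N hN H π σ ν ?_ ?_ ?_ ?_ ?_ (1, 0) ?_
  · rintro ⟨a, b⟩; simp [hσ, hbar]
  · rintro ⟨a, b⟩
    simp [hν, hπ]
  · rintro ⟨a, b⟩
    simp [hσ, hν, bar]
  · rintro ⟨a, b⟩ ⟨c, d⟩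
    simp only [hσ, hπ, map_add, map_neg, LinearMap.add_apply, LinearMap.neg_apply]
    rw [hself, hself, hcross', sw (aeval N (bar b) w), hcross', sw (aeval N b w) (aeval N c u)]
    ring
  · rintro ⟨f, g⟩ hfg
    have hfg' : ∀ (p : K[X]) (v : V), (v = u ∨ v = w) → ω (aeval N p (π (f, g))) v = 0 := by
      intro p v hv
      rw [hadj]
      rcases hv with rfl | rfl
      · have := hfg (bar p, 0)
        rw [hπ (bar p)] at this
        simpa using this
      · have := hfg (0, bar p)
        rw [hπ 0] at this
        simpa using this
    have key : ∀ i, i ≤ 2 * k + 1 → (X : K[X]) ^ i ∣ f ∧ (X : K[X]) ^ i ∣ g := by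
      intro i
      induction i with
      | zero => simp
      | succ i ih =>
        intro hi
        obtain ⟨⟨f', hf⟩, ⟨g', hg⟩⟩ := ih (by omega)
        have e : aeval N (X ^ (2 * k - i) : K[X]) (π (f, g))
            = f'.coeff 0 • (N ^ (2 * k)) u + g'.coeff 0 • (N ^ (2 * k)) w := by
          rw [hπ, map_add, haev, haev, hf, hg, ← mul_assoc, ← mul_assoc, ← pow_add,
            show 2 * k - i + i = 2 * k by omega, hM, hM]
        have e1 := hfg' (X ^ (2 * k - i)) u (Or.inl rfl)
        have e2 := hfg' (X ^ (2 * k - i)) w (Or.inr rfl)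
        rw [e] at e1 e2
        simp only [map_add, map_smul, LinearMap.add_apply, LinearMap.smul_apply, heven, hMu, hMw,
          smul_eq_mul, mul_zero, zero_add, add_zero, mul_one, mul_neg, neg_eq_zero] at e1 e2
        rw [hf, hg, pow_succ]
        exact ⟨mul_dvd_mul_left _ (Polynomial.X_dvd_iff.2 e2),
          mul_dvd_mul_left _ (Polynomial.X_dvd_iff.2 e1)⟩
    obtain ⟨⟨f', hf⟩, ⟨g', hg⟩⟩ := key _ le_rfl
    rw [hπ, hf, hg, map_mul, map_mul, hX0]
    simp
  · rw [hπ]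
    intro h
    apply hu
    have : u = 0 := by simpa using h
    rw [this]; simp

theorem skew_good_aux.{u} (K : Type*) [Field K] [CharZero K] : ∀ (n : ℕ) (V : Type u)
    [AddCommGroup V] [Module K V] [FiniteDimensional K V]
    (ω : V →ₗ[K] V →ₗ[K] K) (_ : ∀ u : V, ω u u = 0)
    (_ : ∀ u : V, (∀ v : V, ω u v = 0) → u = 0)
    (N : Module.End K V) (_ : ∀ u v, ω (N u) v = -ω u (N v)) (_ : Module.finrank K V = n),
    SkewGood ω N := by
  intro n
  induction n using Nat.strong_induction_on with
  | _ n ih =>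
  intro V _ _ _ ω halt hnd N hN hn
  have H : ∀ U : Submodule K V, U ≠ ⊤ → (∀ u ∈ U, N u ∈ U) →
      (∀ u : U, (∀ v : U, ω u v = 0) → u = 0) → SkewGoodOn ω N U := by
    intro U hU hNU hndU
    have hlt : Module.finrank K U < n := hn ▸ Submodule.finrank_lt hU
    obtain ⟨s, h1, h2, h3⟩ := ih _ hlt U (ω.domRestrict₁₂ U U) (fun u => halt u)
      (fun u hu => hndU u hu) (N.restrict hNU) (fun u v => hN u v) rfl
    refine ⟨s, h1, fun u v => h2 u v, ?_⟩
    intro u v hv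
    have : v = N.restrict hNU u := Subtype.ext hv
    rw [this, h3]
    rfl
  rcases subsingleton_or_nontrivial V with hV | hV
  · exact ⟨0, fun u => Subsingleton.elim _ _, fun u v => by simp [Subsingleton.elim u 0],
      fun u => Subsingleton.elim _ _⟩
  have hz : ∀ u v, ω ((N * N) u) v = ω u ((N * N) v) := by
    intro u v; simp [hN]
  have hcomm := commN_aux (K := K) N
  have hint : IsIntegral K (N * N) := Algebra.IsIntegral.isIntegral _
  have hm0 := minpoly.ne_zero hint
  obtain ⟨q, hq, hqd⟩ := WfDvdMonoid.exists_irreducible_factor (minpoly.not_isUnit K (N * N)) hm0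
  have hfin : FiniteMultiplicity q (minpoly K (N * N)) :=
    FiniteMultiplicity.of_not_isUnit hq.not_isUnit hm0
  obtain ⟨r, hr, hqr⟩ := hfin.exists_eq_pow_mul_and_not_dvd
  obtain ⟨k, hk⟩ : ∃ k, multiplicity q (minpoly K (N * N)) = k + 1 := by
    apply Nat.exists_eq_succ_of_ne_zero
    intro h
    rw [h, pow_zero, one_mul] at hr
    exact hqr (hr ▸ hqd)
  rw [hk] at hr
  by_cases h0 : aeval (N * N) (q ^ (k + 1)) = 0
  · have hqk : aeval (N * N) (q ^ k) ≠ 0 := by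
      intro h
      have h2 : q ^ (k + 1) ∣ q ^ k := (Dvd.intro r hr.symm).trans (minpoly.dvd K _ h)
      rw [pow_dvd_pow_iff hq.ne_zero hq.not_isUnit] at h2
      omega
    by_cases h1 : aeval (N * N) (q ^ k) * N = 0
    · have hqX : q ∣ X := by
        by_contra hcon
        obtain ⟨a, b, hab⟩ := hq.coprime_iff_not_dvd.2 hcon
        apply hqk
        have : q ^ k = a * q ^ (k + 1) + b * (q ^ k * X) := by
          linear_combination (-q ^ k) * hab
        have h3 : aeval (N * N) (q ^ k * X) = 0 := by
          rw [map_mul, aeval_X, ← mul_assoc, h1, zero_mul]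
        rw [this, map_add, map_mul, h0, map_mul, h3, mul_zero, mul_zero, add_zero]
      have hXq : X ∣ q := (hq.associated_of_dvd Polynomial.irreducible_X hqX).symm.dvd
      have eX : aeval (N * N) (X ^ k : K[X]) = N ^ (2 * k) := by
        rw [map_pow, aeval_X, pow_mul, pow_two]
      apply case_two ω halt hnd N hN H k
      · obtain ⟨c, hc⟩ := pow_dvd_pow_of_dvd hqX k
        rw [pow_succ, ← eX, hc, map_mul, mul_assoc, ← (hcomm c).eq, ← mul_assoc, h1, zero_mul]
      · intro h
        obtain ⟨c, hc⟩ := pow_dvd_pow_of_dvd hXq k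
        apply hqk
        rw [hc, map_mul, eX, h, zero_mul]
    · exact case_one ω halt hnd N hN H q hq k h0 h1
  · have hcop : IsCoprime (q ^ (k + 1)) r := IsCoprime.pow_left (hq.coprime_iff_not_dvd.2 hqr)
    obtain ⟨hc, ho⟩ := split_aux ω (N * N) hz _ _ hcop (by rw [← hr, minpoly.aeval])
    have hinv : ∀ p : K[X], ∀ u ∈ LinearMap.ker (aeval (N * N) p),
        N u ∈ LinearMap.ker (aeval (N * N) p) := by
      intro p u hu
      rw [LinearMap.mem_ker] at hu ⊢
      rw [← Module.End.mul_apply, ← (hcomm p).eq, Module.End.mul_apply, hu, map_zero]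
    have ho' := fun u hu v hv => (swap_aux ω halt u v).trans (by rw [ho v hv u hu, neg_zero])
    refine glueN_aux ω halt N _ _ hc ho (hinv _) (hinv _) (H _ ?_ (hinv _) ?_) (H _ ?_ (hinv _) ?_)
    · rwa [Ne, LinearMap.ker_eq_top]
    · exact nondeg_aux ω hnd _ _ hc ho
    · rw [Ne, LinearMap.ker_eq_top]
      intro h
      have h2 := minpoly.dvd K _ h
      have hr0 : r ≠ 0 := by rintro rfl; simp at hqr
      rw [hr] at h2
      have h3 : q ^ (k + 1) * r ∣ 1 * r := by simpa using h2
      have h4 := (mul_dvd_mul_iff_right hr0).1 h3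
      exact hq.not_isUnit (isUnit_of_dvd_one ((dvd_pow_self q (by omega)).trans h4))
    · exact nondeg_aux ω hnd _ _ hc.symm ho'

theorem cayley_aux {K : Type*} [Field K] [CharZero K] {V : Type*} [AddCommGroup V] [Module K V]
    [FiniteDimensional K V]
    (ω : V →ₗ[K] V →ₗ[K] K) (halt : ∀ u : V, ω u u = 0)
    (hnd : ∀ u : V, (∀ v : V, ω u v = 0) → u = 0)
    (x : Module.End K V) (hx : ∀ u v, ω (x u) (x v) = ω u v)
    (hinj : ∀ v, x v = -v → v = 0) :
    ∃ s : V →ₗ[K] V, (∀ u, s (s u) = u) ∧ (∀ u v : V, ω (s u) (s v) = -ω u v) ∧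
      (∀ u : V, x (s (x u)) = s u) := by
  have hi : Function.Injective (x + 1 : Module.End K V) := by
    rw [← LinearMap.ker_eq_bot, LinearMap.ker_eq_bot']
    intro m hm
    exact hinj m (eq_neg_of_add_eq_zero_left (by simpa using hm))
  let e : V ≃ₗ[K] V := LinearEquiv.ofInjectiveEndo (x + 1) hi
  have he : ∀ v, e v = x v + v := fun v => by simp [e]
  let N : Module.End K V := (x - 1) ∘ₗ e.symm.toLinearMap
  have hNe : ∀ v, N (e v) = x v - v := fun v => by simp [N]
  have hN : ∀ u v, ω (N u) v = -ω u (N v) := by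
    intro u v
    obtain ⟨a, rfl⟩ := e.surjective u
    obtain ⟨b, rfl⟩ := e.surjective v
    rw [hNe, hNe, he, he]
    simp only [map_add, map_sub, LinearMap.add_apply, LinearMap.sub_apply, hx]
    ring
  obtain ⟨s, h1, h2, h3⟩ := skew_good_aux K _ V ω halt hnd N hN rfl
  refine ⟨s, h1, h2, ?_⟩
  have hxN : ∀ p, x (p - N p) = p + N p := by
    intro p
    obtain ⟨a, rfl⟩ := e.surjective p
    rw [hNe, he]
    have : x a + a - (x a - a) = (2 : K) • a := by rw [two_smul]; abel
    rw [this, map_smul, two_smul]; abel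
  intro v
  obtain ⟨p, hp⟩ : ∃ p, v = p - N p := by
    refine ⟨e ((2 : K)⁻¹ • v), ?_⟩
    rw [hNe, he]
    have : x ((2 : K)⁻¹ • v) + (2 : K)⁻¹ • v - (x ((2 : K)⁻¹ • v) - (2 : K)⁻¹ • v)
      = (2 : K) • (2 : K)⁻¹ • v := by rw [two_smul]; abel
    rw [this, smul_smul, mul_inv_cancel₀ two_ne_zero, one_smul]
  rw [hp, hxN, map_add, h3, ← sub_eq_add_neg, hxN, map_sub, h3, sub_neg_eq_add]

theorem eval_aux {K : Type*} [Field K] {V : Type*} [AddCommGroup V] [Module K V]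
    (y : Module.End K V) (c : K) (v : V) (h : y v = c • v) (p : K[X]) :
    aeval y p v = p.eval c • v := by
  have hp : ∀ n : ℕ, (y ^ n) v = c ^ n • v := by
    intro n
    induction n with
    | zero => simp
    | succ n ih => rw [pow_succ', Module.End.mul_apply, ih, map_smul, h, smul_smul, pow_succ]
  induction p using Polynomial.induction_on' with
  | add p q hp hq => simp [hp, hq, add_smul]
  | monomial n a => simp [aeval_monomial, hp, Module.algebraMap_end_apply, smul_smul, mul_comm]

/-- Every symplectic transformation of a nondegenerate alternating form on a
finite-dimensional vector space over a field of characteristic zero is a product of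
two anti-symplectic involutions; in particular `s * x * s⁻¹ = x⁻¹` with `s`
anti-symplectic. -/
theorem stmt4 (K : Type*) [Field K] [CharZero K]
    (V : Type*) [AddCommGroup V] [Module K V] [FiniteDimensional K V]
    (ω : V →ₗ[K] V →ₗ[K] K)
    (halt : ∀ u : V, ω u u = 0)
    (hnd : ∀ u : V, (∀ v : V, ω u v = 0) → u = 0)
    (x : V ≃ₗ[K] V) (hx : ∀ u v : V, ω (x u) (x v) = ω u v) :
    ∃ s t : V ≃ₗ[K] V,
      s * s = 1 ∧ t * t = 1 ∧
      (∀ u v : V, ω (s u) (s v) = -ω u v) ∧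
      (∀ u v : V, ω (t u) (t v) = -ω u v) ∧
      x = s * t ∧ s * x * s⁻¹ = x⁻¹ := by
  have main : ∃ s : V →ₗ[K] V, (∀ u, s (s u) = u) ∧ (∀ u v : V, ω (s u) (s v) = -ω u v) ∧
      (∀ u : V, x (s (x u)) = s u) := by
    let y : Module.End K V := x.toLinearMap + x.symm.toLinearMap
    have hyv : ∀ v, y v = x v + x.symm v := fun v => rfl
    have hy : ∀ u v, ω (y u) v = ω u (y v) := by
      intro u v
      have e1 := hx (x.symm u) v
      have e2 := hx u (x.symm v)
      rw [x.apply_symm_apply] at e1 e2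
      rw [hyv, hyv, map_add, map_add, LinearMap.add_apply, e2, e1, add_comm]
    have hxy : ∀ v, x (y v) = y (x v) := by intro v; simp [hyv]
    have hcomm : ∀ p : K[X], ∀ v, x (aeval y p v) = aeval y p (x v) := by
      intro p v
      have hc : Commute x.toLinearMap y := LinearMap.ext hxy
      have hp : ∀ n : ℕ, ∀ v, x ((y ^ n) v) = (y ^ n) (x v) := fun n v =>
        LinearMap.congr_fun (hc.pow_right n).eq v
      induction p using Polynomial.induction_on' with
      | add p q hp hq => simp [hp, hq]
      | monomial n a => simp [aeval_monomial, hp, Module.algebraMap_end_apply]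
    have hint : IsIntegral K y := Algebra.IsIntegral.isIntegral _
    have hm0 := minpoly.ne_zero hint
    have hirr : Irreducible (X - C (-2 : K)) := irreducible_X_sub_C _
    obtain ⟨r, hr, hqr⟩ :=
      (FiniteMultiplicity.of_not_isUnit hirr.not_isUnit hm0).exists_eq_pow_mul_and_not_dvd
    generalize multiplicity (X - C (-2 : K)) (minpoly K y) = k at hr
    have hcop : IsCoprime ((X - C (-2 : K)) ^ k) r :=
      IsCoprime.pow_left (hirr.coprime_iff_not_dvd.2 hqr)
    obtain ⟨hc, ho⟩ := split_aux ω y hy _ _ hcop (by rw [← hr, minpoly.aeval])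
    have ho' := fun u hu v hv => (swap_aux ω halt u v).trans (by rw [ho v hv u hu, neg_zero])
    have hinv : ∀ p : K[X], ∀ u ∈ LinearMap.ker (aeval y p),
        x.toLinearMap u ∈ LinearMap.ker (aeval y p) := by
      intro p u hu
      rw [LinearMap.mem_ker] at hu ⊢
      rw [LinearEquiv.coe_coe, ← hcomm, hu, map_zero]
    have hx2 : ∀ v, ∀ c : K, c * c = 1 → x v = c • v → y v = (2 * c) • v := by
      intro v c hcc hv
      have : x.symm v = c • v := by
        rw [LinearEquiv.symm_apply_eq, map_smul, hv, smul_smul, hcc, one_smul]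
      rw [hyv, hv, this, two_mul, add_smul]
    obtain ⟨s₁, h₁, a₁, n₁⟩ := cayley_aux (V := LinearMap.ker (aeval y ((X - C (-2 : K)) ^ k)))
      (ω.domRestrict₁₂ _ _) (fun u => halt u) (nondeg_aux ω hnd _ _ hc ho)
      (-(x.toLinearMap.restrict (hinv _))) (fun u v => by
        change ω (-(x u)) (-(x v)) = ω u v
        simp [hx]) (by
        intro v hv
        have hv1 : x v = (1 : K) • (v : V) := by
          have := congrArg Subtype.val hv
          change -(x v) = -(v : V) at this
          rw [one_smul]; exact neg_injective this
        have h2 := eval_aux y _ _ (hx2 _ 1 (by ring) hv1) ((X - C (-2 : K)) ^ k)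
        rw [LinearMap.mem_ker.1 v.2] at h2
        have h3 := (smul_eq_zero.1 h2.symm).resolve_left (by
          rw [eval_pow]; apply pow_ne_zero; norm_num)
        exact Subtype.ext h3)
    obtain ⟨s₂, h₂, a₂, n₂⟩ := cayley_aux (V := LinearMap.ker (aeval y r))
      (ω.domRestrict₁₂ _ _) (fun u => halt u) (nondeg_aux ω hnd _ _ hc.symm ho')
      (x.toLinearMap.restrict (hinv _)) (fun u v => hx u v) (by
        intro v hv
        have hv1 : x v = (-1 : K) • (v : V) := by
          have := congrArg Subtype.val hv
          change x v = -(v : V) at this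
          rw [neg_one_smul]; exact this
        have h2 := eval_aux y _ _ (hx2 _ (-1) (by ring) hv1) r
        rw [LinearMap.mem_ker.1 v.2] at h2
        have h3 := (smul_eq_zero.1 h2.symm).resolve_left (by
          intro h
          apply hqr
          rw [dvd_iff_isRoot, IsRoot]
          simpa using h)
        exact Subtype.ext h3)
    obtain ⟨s, e₁, e₂, hs, ha⟩ := glue_aux ω halt _ _ hc ho s₁ s₂ h₁ h₂
      (fun u v => a₁ u v) (fun u v => a₂ u v)
    refine ⟨s, hs, ha, ?_⟩
    intro v
    have : v ∈ LinearMap.ker (aeval y ((X - C (-2 : K)) ^ k)) ⊔ LinearMap.ker (aeval y r) := by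
      rw [hc.sup_eq_top]; trivial
    obtain ⟨a, ha, b, hb, rfl⟩ := Submodule.mem_sup.1 this
    have i₁ : x (s (x a)) = s a := by
      have h3 := congrArg Subtype.val (n₁ ⟨a, ha⟩)
      have h4 := e₁ ((-(x.toLinearMap.restrict (hinv _))) ⟨a, ha⟩)
      rw [← e₁ ⟨a, ha⟩] at h3
      change s (-(x a)) = _ at h4
      change -(x (Subtype.val (s₁ ((-(x.toLinearMap.restrict (hinv _))) ⟨a, ha⟩)))) = s a at h3
      rw [← h4, map_neg, map_neg, neg_neg] at h3
      exact h3
    have i₂ : x (s (x b)) = s b := by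
      have := congrArg Subtype.val (n₂ ⟨b, hb⟩)
      rw [← e₂ ⟨b, hb⟩] at this
      rw [← this]
      change _ = x (s₂ _)
      rw [← e₂]
      rfl
    simp only [map_add, i₁, i₂]
  obtain ⟨s, hs, ha, hsx⟩ := main
  let S : V ≃ₗ[K] V := LinearEquiv.ofLinearMap s s (LinearMap.ext hs) (LinearMap.ext hs)
  have hS : ∀ v, S v = s v := fun v => rfl
  have hSS : S * S = 1 := LinearEquiv.ext hs
  have hSi : S⁻¹ = S := inv_eq_of_mul_eq_one_left hSS
  have hxSx : x * S * x = S := LinearEquiv.ext hsx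
  refine ⟨S, S * x, hSS, ?_, ha, ?_, ?_, ?_⟩
  · calc S * x * (S * x) = S * (x * S * x) := by group
      _ = 1 := by rw [hxSx, hSS]
  · intro u v
    change ω (s (x u)) (s (x v)) = _
    rw [ha, hx]
  · rw [← mul_assoc, hSS, one_mul]
  · rw [hSi, eq_inv_iff_mul_eq_one]
    calc S * x * S * x = S * (x * S * x) := by group
      _ = 1 := by rw [hxSx, hSS]
end

section
/- Let n be a natural number. Every unitary n×n complex matrix x is conjugate to its transpose within the unitary group: there exists a unitary matrix u ∈ U(n) with u * x * u⁻¹ = xᵀ. Equivalently, the entrywise complex conjugate matrix x̄ (which is again unitary) is conjugate within U(n) to x⁻¹. (This is the unitary-group analogue of the classical fact that ğxğ⁻¹ is conjugate to x⁻¹ inside U(E) for ğ ∈ Ŭ(E)∖U(E), where ğ acts by the antilinear map of coordinatewise complex conjugation.) -/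
open Matrix

open scoped Matrix.Norms.L2Operator in
lemma exists_hermitian_exp (n : ℕ) (x : Matrix.unitaryGroup (Fin n) ℂ) :
    ∃ A : Matrix (Fin n) (Fin n) ℂ, A.IsHermitian ∧
      NormedSpace.exp (Complex.I • A) = (x : Matrix (Fin n) (Fin n) ℂ) := by
  have hx : (x : Matrix (Fin n) (Fin n) ℂ) ∈ unitary (Matrix (Fin n) (Fin n) ℂ) := x.2
  have hn : IsStarNormal (x : Matrix (Fin n) (Fin n) ℂ) :=
    ⟨by rw [commute_iff_eq, Unitary.star_mul_self_of_mem hx, Unitary.mul_star_self_of_mem hx]⟩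
  have hc : ContinuousOn (fun z : ℂ => (Complex.arg z : ℂ))
      (spectrum ℂ (x : Matrix (Fin n) (Fin n) ℂ)) :=
    (Matrix.finite_spectrum _).continuousOn _
  refine ⟨cfc (fun z : ℂ => (Complex.arg z : ℂ)) (x : Matrix (Fin n) (Fin n) ℂ),
    IsSelfAdjoint.cfc_arg _, ?_⟩
  rw [← CFC.exp_eq_normedSpace_exp (𝕜 := ℂ), ← cfc_comp_smul .., ← cfc_comp' ..]
  conv_rhs => rw [← cfc_id' ℂ (x : Matrix (Fin n) (Fin n) ℂ)]
  refine cfc_congr fun y hy ↦ ?_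
  have hy₁ : ‖y‖ = 1 := spectrum.norm_eq_one_of_unitary hx hy
  have : Complex.I * y.arg = Complex.log y :=
    Complex.ext (by simp [Complex.log_re, hy₁]) (by simp [Complex.log_im])
  have h0 : y ≠ 0 := by
    rintro rfl
    simp at hy₁
  simpa [← Complex.exp_eq_exp_ℂ, this] using Complex.exp_log h0

lemma exists_unitary_diag (n : ℕ) (x : Matrix.unitaryGroup (Fin n) ℂ) :
    ∃ (V : Matrix.unitaryGroup (Fin n) ℂ) (d : Fin n → ℂ),
      (x : Matrix (Fin n) (Fin n) ℂ) = V.1 * diagonal d * V.1ᴴ := by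
  obtain ⟨A, hA, hexp⟩ := exists_hermitian_exp n x
  have h := hA.spectral_theorem
  rw [Unitary.conjStarAlgAut_apply] at h
  set V := hA.eigenvectorUnitary
  have hV : V.1⁻¹ = V.1ᴴ := Matrix.inv_eq_left_inv (Unitary.star_mul_self_of_mem V.2)
  have hU : IsUnit V.1 := ⟨Unitary.toUnits V, rfl⟩
  refine ⟨V, NormedSpace.exp (Complex.I • (RCLike.ofReal ∘ hA.eigenvalues)), ?_⟩
  rw [← hexp, ← Matrix.exp_diagonal, ← hV, ← Matrix.exp_conj _ _ hU, hV]
  congr 1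
  conv_lhs => rw [h]
  rw [Matrix.diagonal_smul, Matrix.mul_smul, Matrix.smul_mul]
  rfl

lemma exists_conj_transpose (n : ℕ) (x : Matrix.unitaryGroup (Fin n) ℂ) :
    ∃ u : Matrix.unitaryGroup (Fin n) ℂ, u.1 * x.1 * u.1ᴴ = x.1ᵀ := by
  obtain ⟨V, d, h⟩ := exists_unitary_diag n x
  have h1 : V.1ᴴ * V.1 = 1 := Unitary.star_mul_self_of_mem V.2
  have h2 : V.1 * V.1ᴴ = 1 := Unitary.mul_star_self_of_mem V.2
  have h3 : V.1ᴴᵀ * V.1ᵀ = 1 := by rw [← Matrix.transpose_mul, h2, Matrix.transpose_one]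
  have h4 : V.1ᴴᵀᴴ = V.1ᵀ := by
    ext i j
    simp [Matrix.conjTranspose_apply]
  have hu : V.1ᴴᵀ * V.1ᴴ ∈ Matrix.unitaryGroup (Fin n) ℂ := by
    rw [Matrix.mem_unitaryGroup_iff, Matrix.star_eq_conjTranspose, Matrix.conjTranspose_mul,
      Matrix.conjTranspose_conjTranspose, h4, Matrix.mul_assoc, ← Matrix.mul_assoc V.1ᴴ, h1,
      Matrix.one_mul, h3]
  refine ⟨⟨_, hu⟩, ?_⟩
  simp only [h, Matrix.conjTranspose_mul, Matrix.conjTranspose_conjTranspose, h4,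
    Matrix.transpose_mul, Matrix.diagonal_transpose]
  calc _ = V.1ᴴᵀ * (V.1ᴴ * V.1) * diagonal d * (V.1ᴴ * V.1) * V.1ᵀ := by
        simp only [Matrix.mul_assoc]
    _ = _ := by simp only [h1, Matrix.mul_one, Matrix.mul_assoc]

/-- Every unitary `n × n` complex matrix is conjugate to its transpose within the unitary
group `U(n)`; equivalently, its entrywise complex conjugate is conjugate within `U(n)`
to its inverse. -/
theorem stmt5 (n : ℕ) (x : Matrix.unitaryGroup (Fin n) ℂ) :
    (∃ u : Matrix.unitaryGroup (Fin n) ℂ,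
      ((u * x * u⁻¹ : Matrix.unitaryGroup (Fin n) ℂ) : Matrix (Fin n) (Fin n) ℂ)
        = ((x : Matrix (Fin n) (Fin n) ℂ))ᵀ) ∧
    (∃ v : Matrix.unitaryGroup (Fin n) ℂ,
      (v : Matrix (Fin n) (Fin n) ℂ) *
          ((x : Matrix (Fin n) (Fin n) ℂ).map (starRingEnd ℂ)) *
          ((v⁻¹ : Matrix.unitaryGroup (Fin n) ℂ) : Matrix (Fin n) (Fin n) ℂ)
        = ((x⁻¹ : Matrix.unitaryGroup (Fin n) ℂ) : Matrix (Fin n) (Fin n) ℂ)) := by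
  obtain ⟨u, hu⟩ := exists_conj_transpose n x
  have h1 : u.1ᴴ * u.1 = 1 := Unitary.star_mul_self_of_mem u.2
  refine ⟨⟨u, hu⟩, ⟨u⁻¹, ?_⟩⟩
  have h2 : x.1.map (starRingEnd ℂ) = u.1 * x.1ᴴ * u.1ᴴ := by
    have h3 := congrArg Matrix.conjTranspose hu
    simp only [Matrix.conjTranspose_mul, Matrix.conjTranspose_conjTranspose] at h3
    rw [Matrix.mul_assoc, h3]
    rfl
  rw [inv_inv, h2]
  change u.1ᴴ * (u.1 * x.1ᴴ * u.1ᴴ) * u.1 = x.1ᴴ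
  calc _ = (u.1ᴴ * u.1) * x.1ᴴ * (u.1ᴴ * u.1) := by simp only [Matrix.mul_assoc]
    _ = _ := by rw [h1, Matrix.one_mul, Matrix.mul_one]
end

section
/- Let K be a field of characteristic zero and n a natural number. The symplectic group Sp(2n, K) = {x ∈ GL(2n, K) : xᵀ J x = J}, where J is the standard skew-symmetric matrix (with blocks J = [[0, -I_n], [I_n, 0]]), is a perfect group: it equals its own commutator subgroup. -/
open Matrix

namespace SpPerfect

lemma exists_symm {l R : Type*} [DecidableEq l] [Fintype l] [Field R]
    {A C : Matrix l l R} (hker : ∀ (x : l → R), (A • x = 0) → (C • x = 0) → x = 0)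
    (hsymm : Aᵀ * C = Cᵀ * A) :
    ∃ (X : Matrix l l R), X.IsSymm ∧ IsUnit (A + X * C) := by
  -- `C` is transformed into `P = fromBlocks 1 0 0 0` by invertible matrices `V` and `U`.
  rcases exists_rank_normal_form C with ⟨V, U, s, hV, hU, heq⟩
  set P := V * C * U with P_def; set Q := Vᵀ⁻¹ * A * U with Q_def
  set f := fun (x : Matrix l l R) ↦ x.submatrix s.symm s.symm
  have hf (x) : f x = x.submatrix s.symm s.symm := rfl
  have f_unit {x} : IsUnit x → IsUnit (f x) := (isUnit_submatrix_equiv ..).2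
  have f_mul (x y) : f (x * y) = f x * f y := submatrix_mul _ _ _ _ _ s.symm.bijective
  have _ : Invertible V := hV.invertible
  have _ : Invertible U := hU.invertible
  have _ : Invertible (f Vᵀ) := (f_unit (V.isUnit_transpose.2 hV)).invertible
  -- The hypothesis that the only vector annihilated by both matrices is 0, holds for `P` and `Q`.
  have con1 (x : Fin C.rank ⊕ Fin (Fintype.card l - C.rank) → R)
      (heq1 : (f Q) • x = 0) (heq2 : (f P) • x = 0) : x = 0 := by
    refine (f_unit hU).smul_left_cancel.1 ?_
    rw [f_mul, f_mul, mul_assoc, mul_smul, IsUnit.smul_eq_zero, mul_smul, hf,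
      smul_eq_mulVec, submatrix_mulVec_equiv, Equiv.symm_symm] at heq1 heq2
    · rw [Equiv.comp_symm_eq, Pi.zero_comp] at heq1 heq2
      exact s.surjective.injective_comp_right <| by simpa using hker _ heq1 heq2
    · exact f_unit hV
    · exact f_unit <| isUnit_nonsing_inv_iff.2 <| V.isUnit_transpose.2 hV
  -- The symmetry relation also holds for `P` and `Q`.
  have con2 : Qᵀ * P = Pᵀ * Q := by
    simp only [P_def, mul_assoc, transpose_mul, transpose_nonsing_inv, transpose_transpose, Q_def,
      inv_mul_cancel_left_of_invertible, mul_inv_cancel_left_of_invertible]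
    rw [← mul_assoc Aᵀ, hsymm, mul_assoc]
  replace con2 : (f Q).toBlocks₁₁ᵀ = (f Q).toBlocks₁₁ ∧ (f Q).toBlocks₁₂ = 0 := by
    apply_fun reindex s s at con2
    rw [reindex_apply, reindex_apply, ← hf, ← hf, f_mul, f_mul Pᵀ, heq, hf,
      ← transpose_submatrix, ← hf Q, ← (f Q).fromBlocks_toBlocks, hf (_)ᵀ, hf
      ((fromBlocks 1 0 0 0).submatrix _ _)] at con2
    simp [fromBlocks_transpose, fromBlocks_multiply] at con2; tauto
  -- The lower-right block of `Q` is invertible.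
  have con3 : IsUnit (f Q).toBlocks₂₂ := by
    refine mulVec_injective_iff_isUnit.1 ?_
    rw [← coe_mulVecLin, ← LinearMap.ker_eq_bot]
    refine ker_mulVecLin_eq_bot_iff.2 fun x hx ↦ Sum.elim_injective' <|
      (con1 _ ?_ ?_).trans Sum.elim_zero_zero.symm
    · rw [← (f Q).fromBlocks_toBlocks]; simp [hx, con2.2, fromBlocks_mulVec]
    · simp [hf, heq, fromBlocks_mulVec]
  set Y : Matrix (Fin C.rank ⊕ Fin (Fintype.card l - C.rank)) (Fin C.rank ⊕
    Fin (Fintype.card l - C.rank)) R := fromBlocks (1 - (f Q).toBlocks₁₁) 0 0 0 with Y_def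
  have hY_symm : Y.IsSymm := by
    rw [Y_def, isSymm_fromBlocks_iff]
    exact ⟨IsSymm.sub isSymm_one con2.1, by simp⟩
  -- We now take `X = Vᵀ * Y * V` and this gives the desired matrix `X.submatrix s s`.
  set X := (f Vᵀ) * Y * (f V) with X_def
  refine ⟨X.submatrix s s, IsSymm.submatrix ?_ s, (isUnit_submatrix_equiv s.symm s.symm).1 ?_⟩
  · simp_rw [X_def, Matrix.IsSymm, transpose_mul, hY_symm.eq, hf, transpose_submatrix,
      transpose_transpose, mul_assoc]
  · have heq' : f (A + X.submatrix s s * C) = (f Vᵀ) * (f Q + Y * (f P)) * f (U⁻¹) := by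
      simp_rw [hf, submatrix_add, Pi.add_apply, Q_def, P_def, ← hf, f_mul, hf, mul_add, ← mul_assoc,
        ← inv_submatrix_equiv, add_mul, mul_assoc _ (U.submatrix _ _), mul_inv_of_invertible]
      simp [X_def]; rfl
    rw [← hf, heq', IsUnit.mul_iff, IsUnit.mul_iff]
    refine ⟨⟨isUnit_of_invertible _, ?_⟩, ?_⟩
    · nth_rw 1 [Y_def, heq, ← (f Q).fromBlocks_toBlocks, con2.2]
      simpa [hf, fromBlocks_multiply, fromBlocks_add]
    · exact f_unit <| isUnit_nonsing_inv_iff.2 hU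

open SymplecticGroup

variable {l K : Type*} [DecidableEq l] [Fintype l] [Field K]

/-- The symplectic group as a subgroup of `GL`. -/
def Sp (l K : Type*) [DecidableEq l] [Fintype l] [Field K] : Subgroup (GL (l ⊕ l) K) where
  carrier := {x | (x : Matrix (l ⊕ l) (l ⊕ l) K) ∈ symplecticGroup l K}
  mul_mem' {a b} ha hb := by
    simpa using (symplecticGroup l K).mul_mem ha hb
  one_mem' := by
    simpa using (symplecticGroup l K).one_mem
  inv_mem' {a} ha := by
    have h := ((⟨_, ha⟩ : symplecticGroup l K)⁻¹).2
    rw [coe_inv'] at h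
    simpa using h

/-- A matrix which lies in the commutator subgroup. -/
def C (M : Matrix (l ⊕ l) (l ⊕ l) K) : Prop :=
  ∃ g ∈ ⁅Sp l K, Sp l K⁆, (g : Matrix (l ⊕ l) (l ⊕ l) K) = M

lemma C.mul {M N : Matrix (l ⊕ l) (l ⊕ l) K} (hM : C M) (hN : C N) : C (M * N) := by
  obtain ⟨g, hg, rfl⟩ := hM
  obtain ⟨h, hh, rfl⟩ := hN
  exact ⟨g * h, mul_mem hg hh, by simp⟩

lemma exists_lift {M : Matrix (l ⊕ l) (l ⊕ l) K} (hM : M ∈ symplecticGroup l K) :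
    ∃ g ∈ Sp l K, (g : Matrix (l ⊕ l) (l ⊕ l) K) = M :=
  ⟨Matrix.GeneralLinearGroup.mk'' M (symplectic_det hM), hM, rfl⟩

lemma C.of_comm {P Q M : Matrix (l ⊕ l) (l ⊕ l) K} (hP : P ∈ symplecticGroup l K)
    (hQ : Q ∈ symplecticGroup l K) (h : P * Q = M * (Q * P)) : C M := by
  obtain ⟨p, hp, rfl⟩ := exists_lift hP
  obtain ⟨q, hq, rfl⟩ := exists_lift hQ
  refine ⟨p * q * (q * p)⁻¹, ?_, ?_⟩
  · have e : p * q * (q * p)⁻¹ = p * q * p⁻¹ * q⁻¹ := by group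
    rw [e]
    exact Subgroup.commutator_mem_commutator hp hq
  · rw [Units.val_mul, Units.val_mul, h, ← Units.val_mul q p, Units.mul_inv_cancel_right]

lemma diag_mem {A B : Matrix l l K} (h : A * B = 1) :
    fromBlocks A 0 0 Bᵀ ∈ symplecticGroup l K := by
  rw [fromBlocks_mem_iff]
  simp [← transpose_mul, mul_eq_one_comm.1 h]

lemma upper_mem {X : Matrix l l K} (h : X.IsSymm) :
    fromBlocks 1 X 0 1 ∈ symplecticGroup l K := by
  rw [fromBlocks_mem_iff]
  simp [h.eq]

lemma lower_mem {X : Matrix l l K} (h : X.IsSymm) :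
    fromBlocks 1 0 X 1 ∈ symplecticGroup l K := by
  rw [fromBlocks_mem_iff]
  simp [h.eq]

variable [CharZero K]

lemma two_mem : fromBlocks ((2 : K) • 1) 0 0 ((2⁻¹ : K) • 1) ∈ symplecticGroup l K := by
  have := diag_mem (l := l) (K := K) (A := (2 : K) • 1) (B := (2⁻¹ : K) • 1) (by simp)
  simpa using this

lemma C.upper {X : Matrix l l K} (h : X.IsSymm) : C (fromBlocks 1 X 0 1) := by
  refine C.of_comm two_mem (upper_mem (X := (3⁻¹ : K) • X) (h.smul _)) ?_
  simp only [fromBlocks_multiply, fromBlocks_inj]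
  simp [smul_smul, ← add_smul]
  congr 1
  norm_num

lemma C.lower {X : Matrix l l K} (h : X.IsSymm) : C (fromBlocks 1 0 X 1) := by
  refine C.of_comm two_mem (lower_mem (X := (-(4/3) : K) • X) (h.smul _)) ?_
  simp only [fromBlocks_multiply, fromBlocks_inj]
  refine ⟨by simp, by simp, ?_, by simp⟩
  ext i j
  simp
  ring

lemma C.diag_symm {S T : Matrix l l K} (h : S.IsSymm) (hT : T.IsSymm) (hS : S * T = 1) :
    C (fromBlocks S 0 0 T) := by
  have hw : ∀ {S T : Matrix l l K}, S.IsSymm → T.IsSymm → S * T = 1 →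
      C (fromBlocks 0 S (-T) 0) := by
    intro S T h hT hS
    have := ((C.upper h).mul (C.lower hT.neg)).mul (C.upper h)
    simpa [fromBlocks_multiply, hS, mul_eq_one_comm.1 hS] using this
  have := (hw h hT hS).mul (hw (S := -1) (T := -1) (isSymm_one.neg) (isSymm_one.neg) (by simp))
  simpa [fromBlocks_multiply] using this

lemma C.diag (A : Matrix l l K) (hA : A.det ≠ 0) : ∀ B, A * B = 1 → C (fromBlocks A 0 0 Bᵀ) := by
  refine diagonal_transvection_induction_of_det_ne_zero
    (fun A => ∀ B, A * B = 1 → C (fromBlocks A 0 0 Bᵀ)) A hA ?_ ?_ ?_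
  · intro D hD B hB
    rw [det_diagonal, Finset.prod_ne_zero_iff] at hD
    have e : diagonal D * diagonal D⁻¹ = 1 := by
      rw [diagonal_mul_diagonal, ← diagonal_one]
      congr 1
      ext i
      simp [hD i]
    have : B = diagonal D⁻¹ := by
      rw [← inv_eq_right_inv hB, inv_eq_right_inv e]
    subst this
    rw [diagonal_transpose]
    exact C.diag_symm (isSymm_diagonal _) (isSymm_diagonal _) hB
  · rintro ⟨i, j, hij, c⟩ B hB
    set D : l → K := Function.update 1 i 2 with hD
    have e : diagonal D * diagonal D⁻¹ = 1 := by
      rw [diagonal_mul_diagonal, ← diagonal_one]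
      congr 1
      ext k
      by_cases hk : k = i
      · subst hk; simp [hD]
      · simp [hD, hk]
    have key : diagonal D * transvection i j c = 
        transvection i j c * (transvection i j c * diagonal D) := by
      have h1 : diagonal D * single i j c = single i j (2 * c) := by
        ext a b
        by_cases ha : i = a
        · subst ha; by_cases hb : j = b <;> simp [hD, single_apply, hb]
        · simp [single_apply, ha]
      have h2 : single i j c * diagonal D = single i j c := by
        ext a b
        by_cases hb : j = b
        · subst hb; simp [hD, hij.symm]
        · simp [single_apply, hb]
      simp only [transvection, mul_add, add_mul, mul_one, one_mul, h1, h2]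
      simp [hij.symm, two_mul, single_add]
      abel
    simp only [TransvectionStruct.toMatrix] at hB ⊢
    refine C.of_comm (diag_mem e) (diag_mem hB) ?_
    simp only [fromBlocks_multiply, fromBlocks_inj]
    simp only [mul_zero, zero_mul, add_zero, zero_add, key, ← transpose_mul, true_and]
    congr 1
    set T := transvection i j c
    have e' := mul_eq_one_comm.1 e
    have hB' := mul_eq_one_comm.1 hB
    have k1 : (diagonal D * T) * (B * diagonal D⁻¹) = 1 := by
      rw [mul_assoc, ← mul_assoc T, hB, one_mul, e]
    have k2 : (T * (T * diagonal D)) * (diagonal D⁻¹ * B * B) = 1 := by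
      simp only [mul_assoc]
      rw [← mul_assoc (diagonal D), e, one_mul, ← mul_assoc T B, hB, one_mul, hB]
    rw [← inv_eq_right_inv k1, key, inv_eq_right_inv k2]
  · intro A B hA hB ihA ihB M hM
    have a : A * A⁻¹ = 1 := mul_nonsing_inv _ (isUnit_iff_ne_zero.2 hA)
    have b : B * B⁻¹ = 1 := mul_nonsing_inv _ (isUnit_iff_ne_zero.2 hB)
    have : M = B⁻¹ * A⁻¹ := by rw [← inv_eq_right_inv hM, Matrix.mul_inv_rev]
    subst this
    have := (ihA _ a).mul (ihB _ b)
    simpa [fromBlocks_multiply] using this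

lemma C.of_isUnit {A B Z D : Matrix l l K} (hM : fromBlocks A B Z D ∈ symplecticGroup l K)
    (hA : IsUnit A) : C (fromBlocks A B Z D) := by
  have hd := (isUnit_iff_isUnit_det _).1 hA
  have a : A * A⁻¹ = 1 := mul_nonsing_inv _ hd
  have a' : A⁻¹ * A = 1 := nonsing_inv_mul _ hd
  have at1 : (A⁻¹)ᵀ * Aᵀ = 1 := by rw [← transpose_mul, a, transpose_one]
  obtain ⟨h1, h2, h3⟩ := fromBlocks_mem_iff.1 hM
  have hL : (Z * A⁻¹).IsSymm := by
    have : (A⁻¹)ᵀ * (Aᵀ * Z) * A⁻¹ = (A⁻¹)ᵀ * (Zᵀ * A) * A⁻¹ := by rw [h1]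
    rw [← mul_assoc, at1, one_mul, mul_assoc, mul_assoc Zᵀ, a, mul_one] at this
    rw [Matrix.IsSymm, transpose_mul, this]
  have hLD := (C.lower hL).mul (C.diag A hd.ne_zero _ a)
  have hLD' := (symplecticGroup l K).mul_mem (lower_mem hL.neg) hM
  have e1 : fromBlocks 1 0 (-(Z * A⁻¹)) 1 * fromBlocks A B Z D
      = fromBlocks A B 0 (D - Z * A⁻¹ * B) := by
    simp [fromBlocks_multiply, mul_assoc, a', sub_eq_neg_add]
  rw [e1, fromBlocks_mem_iff] at hLD'
  obtain ⟨-, g2, g3⟩ := hLD'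
  simp only [transpose_zero, zero_mul, sub_zero] at g3
  set E := D - Z * A⁻¹ * B with hE
  have hEA : E = (A⁻¹)ᵀ := by
    have : (A⁻¹)ᵀ * (Aᵀ * E) = (A⁻¹)ᵀ := by rw [g3, mul_one]
    rwa [← mul_assoc, at1, one_mul] at this
  have hU : (A⁻¹ * B).IsSymm := by
    rw [hEA, transpose_transpose] at g2
    rw [Matrix.IsSymm, transpose_mul, g2]
  have := hLD.mul (C.upper hU)
  have hD : D = Z * A⁻¹ * B + (A⁻¹)ᵀ := by rw [← hEA, hE]; abel
  rw [hD]
  simpa [fromBlocks_multiply, mul_assoc, a', ← mul_assoc A A⁻¹, a] using this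

lemma C.all {M : Matrix (l ⊕ l) (l ⊕ l) K} (hM : M ∈ symplecticGroup l K) : C M := by
  obtain ⟨A, B, Z, D, rfl⟩ : ∃ A B Z D, M = fromBlocks A B Z D :=
    ⟨_, _, _, _, M.fromBlocks_toBlocks.symm⟩
  have hF : IsUnit (fromBlocks A B Z D) := (isUnit_iff_isUnit_det _).2 (symplectic_det hM)
  obtain ⟨X, hX, hu⟩ := exists_symm (A := A) (C := Z) (by
    intro x hx1 hx2
    rw [smul_eq_mulVec] at hx1 hx2
    have hv0 : fromBlocks A B Z D *ᵥ (Sum.elim x 0) = fromBlocks A B Z D *ᵥ (Sum.elim 0 0) := by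
      simp [fromBlocks_mulVec, hx1, hx2]
    exact (Sum.elim_eq_iff.1 (mulVec_injective_iff_isUnit.2 hF hv0)).1)
    (fromBlocks_mem_iff.1 hM).1
  have h := (symplecticGroup l K).mul_mem (upper_mem hX) hM
  have e : fromBlocks 1 X 0 1 * fromBlocks A B Z D
      = fromBlocks (A + X * Z) (B + X * D) Z D := by
    simp [fromBlocks_multiply]
  rw [e] at h
  have := (C.upper hX.neg).mul (C.of_isUnit h hu)
  rw [← e, ← mul_assoc] at this
  simpa [fromBlocks_multiply] using this

end SpPerfect

/-- The symplectic group `Sp(2n, K) = {x ∈ GL(2n, K) : xᵀ J x = J}`, with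
`J = [[0, -1], [1, 0]]` (block form), over a field of characteristic zero, is perfect. -/
theorem stmt8 (K : Type*) [Field K] [CharZero K] (n : ℕ) :
    ∃ S : Subgroup (GL (Fin n ⊕ Fin n) K),
      (S : Set (GL (Fin n ⊕ Fin n) K)) =
        {x : GL (Fin n ⊕ Fin n) K |
          (↑x : Matrix (Fin n ⊕ Fin n) (Fin n ⊕ Fin n) K)ᵀ *
              Matrix.fromBlocks 0 (-1) 1 0 *
              (↑x : Matrix (Fin n ⊕ Fin n) (Fin n ⊕ Fin n) K)
            = Matrix.fromBlocks 0 (-1) 1 0} ∧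
      commutator S = ⊤ := by
  refine ⟨SpPerfect.Sp (Fin n) K, ?_, ?_⟩
  · ext x
    exact SymplecticGroup.mem_iff'
  · rw [eq_top_iff]
    rintro ⟨x, hx⟩ -
    obtain ⟨g, hg, hgx⟩ := SpPerfect.C.all hx
    obtain rfl : g = x := Units.ext hgx
    rw [← Subgroup.map_subtype_commutator] at hg
    obtain ⟨y, hy, hyg⟩ := hg
    have : y = ⟨g, hx⟩ := Subtype.ext hyg
    exact this ▸ hy
end
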